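/- arXiv:1507.01710 — 9 statements merged into one kernel-verified Lean document; each statement's English description precedes it below -/
import Mathlib

section
/- Let κ ∈ ℂ with κ ∉ (−∞,−1] ∪ [1,+∞) (i.e. κ avoids the two real rays). Then there exists a twice differentiable function u : ℝ → ℂ satisfying the Painlevé II equation u''(τ) = τ·u(τ) + 2·u(τ)³ for every τ ∈ ℝ, and such that u(τ)/A(τ) → κ as τ → +∞. (This expresses that the Ablowitz–Segur solution of Painlevé II with asymptotics u ∼ κ·Ai at +∞ has no poles on the real line.) -/
open MeasureTheory Filter Polynomial

noncomputable section

/-- `A` is the Airy function `Ai` and `A'` its derivative: the unique solution of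
`A'' = x·A` with `A 0 = 3^(-2/3)/Γ(2/3)` and `A' 0 = -3^(-1/3)/Γ(1/3)`. -/
def IsAiry (A A' : ℝ → ℝ) : Prop :=
  (∀ x : ℝ, HasDerivAt A (A' x) x) ∧ (∀ x : ℝ, HasDerivAt A' (x * A x) x) ∧
  A 0 = (3 : ℝ) ^ (-(2 : ℝ) / 3) / Real.Gamma (2 / 3) ∧
  A' 0 = -((3 : ℝ) ^ (-(1 : ℝ) / 3)) / Real.Gamma (1 / 3)

/-- An Ablowitz–Segur Painlevé II function for `κ`: a twice differentiable `u : ℝ → ℂ`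
with `u'' τ = τ·u τ + 2·(u τ)^3` for all `τ` and `u τ / Ai τ → κ` as `τ → +∞`. -/
def IsAblowitzSegur (A : ℝ → ℝ) (κ : ℂ) (u : ℝ → ℂ) : Prop :=
  Differentiable ℝ u ∧ Differentiable ℝ (deriv u) ∧
  (∀ τ : ℝ, deriv (deriv u) τ = (τ : ℂ) * u τ + 2 * u τ ^ 3) ∧
  Tendsto (fun τ : ℝ => u τ / (A τ : ℂ)) atTop (nhds κ)

/-! ### The Airy function as an integral along a horizontal line -/

/-- The point `k + iη` of the horizontal line at height `η`. -/
def hline (η k : ℝ) : ℂ := (k : ℂ) + η * Complex.I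

/-- The `m`-th `x`-derivative of the Airy integrand `exp (i (z³ / 3 + x z))`. -/
def airyInt (m : ℕ) (x : ℝ) (z : ℂ) : ℂ :=
  (Complex.I * z) ^ m * Complex.exp (Complex.I * (z ^ 3 / 3 + x * z))

/-- `airyFn m η` is the `m`-th derivative of the Airy function, computed on the line `Im z = η`. -/
def airyFn (m : ℕ) (η x : ℝ) : ℂ :=
  (1 / (2 * Real.pi) : ℂ) * ∫ k : ℝ, airyInt m x (hline η k)

lemma hline_phase_re (η k x : ℝ) :
    (Complex.I * ((hline η k) ^ 3 / 3 + x * hline η k)).re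
      = η ^ 3 / 3 - η * k ^ 2 - η * x := by
  have : Complex.I * ((hline η k) ^ 3 / 3 + x * hline η k)
      = ((η ^ 3 / 3 - η * k ^ 2 - η * x : ℝ) : ℂ)
        + ((k ^ 3 / 3 - k * η ^ 2 + x * k : ℝ) : ℂ) * Complex.I := by
    unfold hline
    push_cast
    linear_combination (Complex.I * (k : ℂ) * η ^ 2 + k ^ 2 * η + x * η
      + η ^ 3 * (Complex.I ^ 2 - 1) / 3 ) * Complex.I_sq
  rw [this, Complex.add_re, Complex.ofReal_re, Complex.re_ofReal_mul, Complex.I_re]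
  ring

lemma norm_airyInt (m : ℕ) (η k x : ℝ) :
    ‖airyInt m x (hline η k)‖
      = ‖hline η k‖ ^ m * Real.exp (η ^ 3 / 3 - η * k ^ 2 - η * x) := by
  unfold airyInt
  rw [norm_mul, norm_pow, norm_mul, Complex.norm_I, one_mul, Complex.norm_exp, hline_phase_re]

lemma norm_hline_le {η : ℝ} (hη : 0 < η) (k : ℝ) : ‖hline η k‖ ≤ |k| + η := by
  unfold hline
  refine (norm_add_le _ _).trans ?_
  simp [abs_of_pos hη]

/-- A constant for the Gaussian domination of `airyInt` on a horizontal line. -/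
def airyConst (m : ℕ) (η : ℝ) : ℝ := m.factorial * Real.exp (η + 1 / (2 * η) + η ^ 3 / 3)

lemma norm_airyInt_le (m : ℕ) {η : ℝ} (hη : 0 < η) (k x : ℝ) :
    ‖airyInt m x (hline η k)‖
      ≤ airyConst m η * Real.exp (-η * x) * Real.exp (-(η / 2) * k ^ 2) := by
  rw [norm_airyInt, airyConst]
  have h1 : ‖hline η k‖ ^ m ≤ m.factorial * Real.exp (|k| + η) := by
    have h := Real.pow_div_factorial_le_exp _ (norm_nonneg (hline η k)) m
    rw [div_le_iff₀ (by positivity)] at h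
    have h2 : Real.exp ‖hline η k‖ ≤ Real.exp (|k| + η) :=
      Real.exp_le_exp.2 (norm_hline_le hη k)
    calc _ ≤ _ := h
      _ ≤ Real.exp (|k| + η) * m.factorial := by gcongr
      _ = _ := mul_comm _ _
  have h3 : |k| ≤ η / 2 * k ^ 2 + 1 / (2 * η) := by
    have h4 : 0 ≤ (η * |k| - 1) ^ 2 / (2 * η) := by positivity
    have h5 : (η * |k| - 1) ^ 2 / (2 * η) = η / 2 * k ^ 2 + 1 / (2 * η) - |k| := by
      field_simp
      rw [← sq_abs k]
      ring
    linarith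
  calc _ ≤ m.factorial * Real.exp (|k| + η) * Real.exp (η ^ 3 / 3 - η * k ^ 2 - η * x) := by
        gcongr
    _ = m.factorial * Real.exp (|k| + η + (η ^ 3 / 3 - η * k ^ 2 - η * x)) := by
        rw [Real.exp_add (|k| + η)]; ring
    _ ≤ m.factorial * Real.exp (η + 1 / (2 * η) + η ^ 3 / 3 + -η * x + -(η / 2) * k ^ 2) := by
        refine mul_le_mul_of_nonneg_left (Real.exp_le_exp.2 ?_) (by positivity)
        linarith
    _ = _ := by rw [Real.exp_add, Real.exp_add]; ring

lemma continuous_airyInt_hline (m : ℕ) (η x : ℝ) :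
    Continuous fun k => airyInt m x (hline η k) := by
  unfold airyInt hline
  fun_prop

lemma integrable_airyBound (m : ℕ) {η : ℝ} (hη : 0 < η) (c : ℝ) :
    Integrable fun k : ℝ => airyConst m η * c * Real.exp (-(η / 2) * k ^ 2) :=
  (integrable_exp_neg_mul_sq (by positivity)).const_mul _

lemma integrable_airyInt (m : ℕ) {η : ℝ} (hη : 0 < η) (x : ℝ) :
    Integrable fun k => airyInt m x (hline η k) :=
  (integrable_airyBound m hη (Real.exp (-η * x))).mono'
    (continuous_airyInt_hline m η x).aestronglyMeasurable
    (Eventually.of_forall fun k => norm_airyInt_le m hη k x)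

lemma hasDerivAt_airyFn (m : ℕ) {η : ℝ} (hη : 0 < η) (x : ℝ) :
    HasDerivAt (airyFn m η) (airyFn (m + 1) η x) x := by
  unfold airyFn
  refine HasDerivAt.const_mul _ ?_
  refine (hasDerivAt_integral_of_dominated_loc_of_deriv_le
    (F := fun x k => airyInt m x (hline η k)) (F' := fun x k => airyInt (m + 1) x (hline η k))
    (bound := fun k => airyConst (m + 1) η * Real.exp (-η * (x - 1))
      * Real.exp (-(η / 2) * k ^ 2))
    (Ioi_mem_nhds (show x - 1 < x by linarith)) ?_ (integrable_airyInt m hη x) ?_ ?_ ?_ ?_).2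
  · exact Eventually.of_forall fun y => (continuous_airyInt_hline m η y).aestronglyMeasurable
  · exact (continuous_airyInt_hline (m + 1) η x).aestronglyMeasurable
  · refine Eventually.of_forall fun k y hy => (norm_airyInt_le (m + 1) hη k y).trans ?_
    have : 0 ≤ airyConst (m + 1) η := by unfold airyConst; positivity
    have : -η * y ≤ -η * (x - 1) := by
      have : x - 1 < y := hy
      nlinarith
    gcongr
  · exact integrable_airyBound _ hη _
  · refine Eventually.of_forall fun k y _ => ?_
    unfold airyInt
    have h1 : HasDerivAt (fun y : ℝ => Complex.I * ((hline η k) ^ 3 / 3 + y * hline η k))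
        (Complex.I * hline η k) y := by
      have := ((((Complex.ofRealCLM.hasDerivAt (x := y)).mul_const (hline η k)).const_add
        ((hline η k) ^ 3 / 3)).const_mul Complex.I)
      simpa using this
    refine ((h1.cexp).const_mul ((Complex.I * hline η k) ^ m)).congr_deriv ?_
    ring

lemma norm_airyFn_le (m : ℕ) {η : ℝ} (hη : 0 < η) :
    ∃ C : ℝ, ∀ x, ‖airyFn m η x‖ ≤ C * Real.exp (-η * x) := by
  refine ⟨‖(1 / (2 * Real.pi) : ℂ)‖ *
    (airyConst m η * ∫ k : ℝ, Real.exp (-(η / 2) * k ^ 2)), fun x => ?_⟩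
  unfold airyFn
  rw [norm_mul, mul_assoc]
  gcongr
  refine (norm_integral_le_of_norm_le (integrable_airyBound m hη (Real.exp (-η * x)))
    (Eventually.of_forall fun k => norm_airyInt_le m hη k x)).trans ?_
  rw [integral_const_mul]
  exact le_of_eq (by ring)

lemma airyFn_two {η : ℝ} (hη : 0 < η) (x : ℝ) : airyFn 2 η x = x * airyFn 0 η x := by
  have key : ∫ k : ℝ, Complex.I * (x * airyInt 0 x (hline η k) - airyInt 2 x (hline η k)) = 0 := by
    refine integral_eq_zero_of_hasDerivAt_of_integrable
      (f := fun k => airyInt 0 x (hline η k)) (fun k => ?_) ?_ (integrable_airyInt 0 hη x)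
    · have h0 : HasDerivAt (fun k : ℝ => hline η k) 1 k := by
        unfold hline
        exact (Complex.ofRealCLM.hasDerivAt (x := k)).add_const _
      have h1 : HasDerivAt (fun k : ℝ => Complex.I * ((hline η k) ^ 3 / 3 + x * hline η k))
          (Complex.I * ((hline η k) ^ 2 + x)) k := by
        refine ((((h0.pow 3).div_const 3).add (h0.const_mul (x : ℂ))).const_mul
          Complex.I).congr_deriv ?_
        push_cast
        ring
      unfold airyInt
      simp only [pow_zero, one_mul]
      refine h1.cexp.congr_deriv ?_
      linear_combination (hline η k) ^ 2 * Complex.I *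
        Complex.exp (Complex.I * ((hline η k) ^ 3 / 3 + x * hline η k)) * Complex.I_sq
    · exact (((integrable_airyInt 0 hη x).const_mul _).sub (integrable_airyInt 2 hη x)).const_mul _
  rw [integral_const_mul, integral_sub ((integrable_airyInt 0 hη x).const_mul _)
    (integrable_airyInt 2 hη x), integral_const_mul] at key
  have := (mul_eq_zero.1 key).resolve_left Complex.I_ne_zero
  unfold airyFn
  linear_combination -(1 / (2 * Real.pi) : ℂ) * this

/-! ### Values at the origin -/

/-- The directions `±√3/2 + i/2` along which `exp (i z³ / 3)` decays fastest. -/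
def rayDir (s : ℝ) : ℂ := hline (1 / 2) (s * (√3 / 2))

lemma rayDir_cube {s : ℝ} (hs : s ^ 2 = 1) : (rayDir s) ^ 3 = Complex.I := by
  have h3 : ((√3 : ℝ) : ℂ) ^ 2 = 3 := by
    rw [← Complex.ofReal_pow, Real.sq_sqrt (by norm_num)]; norm_num
  have hs' : (s : ℂ) ^ 2 = 1 := by rw [← Complex.ofReal_pow, hs]; norm_num
  unfold rayDir hline
  push_cast
  linear_combination (3 * Complex.I * (s : ℂ) ^ 2 / 8 + (s : ℂ) ^ 3 * √3 / 8) * h3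
    + (9 * Complex.I / 8 + 3 * √3 * s / 8) * hs'
    + (3 * (√3 : ℝ) * (s : ℂ) / 8 + Complex.I / 8) * Complex.I_sq

lemma airyInt_ray (m : ℕ) {s : ℝ} (hs : s ^ 2 = 1) (r : ℝ) :
    airyInt m 0 (r * rayDir s)
      = (Complex.I * rayDir s) ^ m * ((r ^ m * Real.exp (-r ^ 3 / 3) : ℝ) : ℂ) := by
  unfold airyInt
  have : Complex.I * (((r : ℂ) * rayDir s) ^ 3 / 3 + (0 : ℝ) * (r * rayDir s))
      = ((-r ^ 3 / 3 : ℝ) : ℂ) := by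
    rw [mul_pow, rayDir_cube hs]
    push_cast
    linear_combination (r : ℂ) ^ 3 / 3 * Complex.I_sq
  rw [this]
  push_cast
  ring

lemma differentiable_airyInt (m : ℕ) (x : ℝ) : Differentiable ℂ (airyInt m x) := by
  unfold airyInt
  fun_prop

lemma tendsto_arc {m : ℕ} {η : ℝ} (hη : 0 < η) {s : ℝ} (hs : s ^ 2 = 1) {G : ℂ → ℂ}
    (hG : ∀ z, HasDerivAt G (airyInt m 0 z) z) :
    Tendsto (fun ρ : ℝ => G (ρ * rayDir s) - G (hline η (ρ * (s * (√3 / 2))))) atTop (nhds 0) := by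
  have hlim : Tendsto (fun ρ : ℝ => ρ ^ ((m + 1 : ℕ) : ℝ) * Real.exp (-(2 / 3 * η) * ρ))
      atTop (nhds 0) := tendsto_rpow_mul_exp_neg_mul_atTop_nhds_zero _ _ (by positivity)
  refine squeeze_zero_norm' ?_ hlim
  filter_upwards [eventually_ge_atTop 1, eventually_ge_atTop (2 * η)] with ρ h1 h2
  have hray : (ρ : ℂ) * rayDir s = hline (ρ / 2) (ρ * (s * (√3 / 2))) := by
    unfold rayDir hline; push_cast; ring
  set X := ρ * (s * (√3 / 2)) with hX
  have hX2 : X ^ 2 = 3 / 4 * ρ ^ 2 := by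
    have : X ^ 2 = ρ ^ 2 * (s ^ 2 * (√3 ^ 2 / 4)) := by rw [hX]; ring
    rw [this, hs, Real.sq_sqrt (by norm_num)]; ring
  rw [hray]
  have hd : ∀ y ∈ Set.Icc η (ρ / 2), HasDerivWithinAt (fun y : ℝ => G (hline y X))
      (airyInt m 0 (hline y X) * Complex.I) (Set.Icc η (ρ / 2)) y := by
    intro y _
    have h0 : HasDerivAt (fun y : ℝ => hline y X) Complex.I y := by
      unfold hline
      simpa using ((Complex.ofRealCLM.hasDerivAt (x := y)).mul_const Complex.I).const_add (X : ℂ)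
    exact ((hG _).comp y h0).hasDerivWithinAt
  have hb : ∀ y ∈ Set.Icc η (ρ / 2), ‖airyInt m 0 (hline y X) * Complex.I‖
      ≤ ρ ^ m * Real.exp (-(2 / 3 * η) * ρ) := by
    intro y hy
    have hy0 : 0 < y := hη.trans_le hy.1
    rw [norm_mul, Complex.norm_I, mul_one, norm_airyInt]
    have hn : ‖hline y X‖ ≤ ρ := by
      refine abs_le_of_sq_le_sq' ?_ (by linarith) |>.2
      rw [← Complex.normSq_eq_norm_sq]
      have : Complex.normSq (hline y X) = X ^ 2 + y ^ 2 := by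
        simp [hline, Complex.normSq_apply]; ring
      rw [this, hX2]
      nlinarith [hy.2]
    have he : y ^ 3 / 3 - y * X ^ 2 - y * 0 ≤ -(2 / 3 * η) * ρ := by
      rw [hX2]
      have h3 : y ^ 2 ≤ ρ ^ 2 / 4 := by nlinarith [hy.2]
      have h4 : y ^ 3 ≤ y * (ρ ^ 2 / 4) := by nlinarith
      have h5 : η * ρ ≤ y * ρ ^ 2 := by
        have : ρ ≤ ρ ^ 2 := by nlinarith
        exact mul_le_mul hy.1 this (by linarith) hy0.le
      nlinarith
    gcongr
  have hη2 : η ≤ ρ / 2 := by linarith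
  have := (convex_Icc η (ρ / 2)).norm_image_sub_le_of_norm_hasDerivWithin_le hd hb
    (Set.left_mem_Icc.2 hη2) (Set.right_mem_Icc.2 hη2)
  refine this.trans ?_
  have h6 : ‖ρ / 2 - η‖ ≤ ρ := by
    rw [Real.norm_eq_abs, abs_of_nonneg (by linarith)]; linarith
  calc _ ≤ ρ ^ m * Real.exp (-(2 / 3 * η) * ρ) * ρ := by gcongr
    _ = _ := by rw [Real.rpow_natCast]; ring

/-- The Gamma-type integral giving the values of the Airy function and its derivatives at `0`. -/
def airyMoment (m : ℕ) : ℝ := ∫ r in Set.Ioi (0 : ℝ), r ^ m * Real.exp (-r ^ 3 / 3)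

lemma airyMoment_eq (m : ℕ) :
    airyMoment m
      = (1 / 3 : ℝ) ^ (-((m : ℝ) + 1) / 3) * (1 / 3) * Real.Gamma (((m : ℝ) + 1) / 3) := by
  have := integral_rpow_mul_exp_neg_mul_rpow (p := 3) (q := m) (b := 1 / 3) (by norm_num)
    (by have : (0 : ℝ) ≤ m := m.cast_nonneg
        linarith) (by norm_num)
  rw [← this, airyMoment]
  refine setIntegral_congr_fun measurableSet_Ioi fun r _ => ?_
  rw [Real.rpow_natCast, show (3 : ℝ) = ((3 : ℕ) : ℝ) by norm_num, Real.rpow_natCast]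
  congr 2
  push_cast
  ring

lemma integrableOn_airyMoment (m : ℕ) :
    IntegrableOn (fun r : ℝ => r ^ m * Real.exp (-r ^ 3 / 3)) (Set.Ioi 0) := by
  by_contra h
  have h0 : airyMoment m = 0 := integral_undef h
  have h1 : 0 < Real.Gamma (((m : ℝ) + 1) / 3) := Real.Gamma_pos_of_pos (by positivity)
  rw [airyMoment_eq] at h0
  have : 0 < (1 / 3 : ℝ) ^ (-((m : ℝ) + 1) / 3) * (1 / 3) * Real.Gamma (((m : ℝ) + 1) / 3) := by
    positivity
  linarith

lemma tendsto_ray {m : ℕ} {s : ℝ} (hs : s ^ 2 = 1) {G : ℂ → ℂ}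
    (hG : ∀ z, HasDerivAt G (airyInt m 0 z) z) :
    Tendsto (fun ρ : ℝ => G (ρ * rayDir s)) atTop
      (nhds (G 0 + (Complex.I * rayDir s) ^ m * rayDir s * airyMoment m)) := by
  have h1 : Tendsto (fun ρ : ℝ => ∫ r in (0 : ℝ)..ρ, r ^ m * Real.exp (-r ^ 3 / 3)) atTop
      (nhds (airyMoment m)) :=
    intervalIntegral_tendsto_integral_Ioi 0 (integrableOn_airyMoment m) tendsto_id
  have h2 := ((Complex.continuous_ofReal.tendsto _).comp h1).const_mul
    ((Complex.I * rayDir s) ^ m * rayDir s)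
  refine (h2.const_add (G 0)).congr fun ρ => ?_
  have h3 : ∫ r in (0 : ℝ)..ρ, airyInt m 0 (r * rayDir s) * rayDir s
      = G (ρ * rayDir s) - G ((0 : ℝ) * rayDir s) := by
    refine intervalIntegral.integral_eq_sub_of_hasDerivAt
      (f := fun r : ℝ => G (r * rayDir s)) (fun r _ => ?_) ?_
    · have h0 : HasDerivAt (fun r : ℝ => (r : ℂ) * rayDir s) (rayDir s) r := by
        simpa using (Complex.ofRealCLM.hasDerivAt (x := r)).mul_const (rayDir s)
      exact (hG _).comp r h0
    · have := (differentiable_airyInt m 0).continuous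
      exact Continuous.intervalIntegrable (by fun_prop) _ _
  simp only [airyInt_ray m hs, Complex.ofReal_zero, zero_mul] at h3
  have h4 : G (ρ * rayDir s) = G 0 + ∫ r in (0 : ℝ)..ρ, (Complex.I * rayDir s) ^ m
      * ((r ^ m * Real.exp (-r ^ 3 / 3) : ℝ) : ℂ) * rayDir s := by rw [h3]; ring
  rw [h4, intervalIntegral.integral_mul_const, intervalIntegral.integral_const_mul,
    intervalIntegral.integral_ofReal]
  simp only [Function.comp]
  ring

lemma integral_airyInt_zero (m : ℕ) {η : ℝ} (hη : 0 < η) :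
    ∫ k : ℝ, airyInt m 0 (hline η k) = ((Complex.I * rayDir 1) ^ m * rayDir 1
      - (Complex.I * rayDir (-1)) ^ m * rayDir (-1)) * airyMoment m := by
  obtain ⟨G, hG⟩ := (differentiable_airyInt m 0).isExactOn_univ
  replace hG := fun z => hG z (Set.mem_univ z)
  have hp := (tendsto_ray (s := 1) (by norm_num) hG).sub (tendsto_arc hη (s := 1) (by norm_num) hG)
  have hm := (tendsto_ray (s := -1) (by norm_num) hG).sub
    (tendsto_arc hη (s := -1) (by norm_num) hG)
  have hR : Tendsto (fun ρ : ℝ => ρ * (1 * (√3 / 2))) atTop atTop :=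
    tendsto_id.atTop_mul_const (by positivity)
  have hL : Tendsto (fun ρ : ℝ => ρ * (-1 * (√3 / 2))) atTop atBot :=
    tendsto_id.atTop_mul_const_of_neg (by
      have : 0 < √3 / 2 := by positivity
      linarith)
  have hInt := intervalIntegral_tendsto_integral (integrable_airyInt m hη 0) hL hR
  refine tendsto_nhds_unique hInt (((hp.sub hm).congr fun ρ => ?_).trans (le_of_eq ?_))
  · rw [intervalIntegral.integral_eq_sub_of_hasDerivAt (f := fun k => G (hline η k))]
    · ring
    · intro k _
      have h0 : HasDerivAt (fun k : ℝ => hline η k) 1 k := by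
        unfold hline
        exact (Complex.ofRealCLM.hasDerivAt (x := k)).add_const _
      exact ((hG _).comp k h0).congr_deriv (mul_one _)
    · exact (continuous_airyInt_hline m η 0).intervalIntegrable _ _
  · congr 1
    ring

lemma rayDir_sub : rayDir 1 - rayDir (-1) = √3 := by
  unfold rayDir hline
  push_cast
  ring

lemma rayDir_add : rayDir 1 + rayDir (-1) = Complex.I := by
  unfold rayDir hline
  push_cast
  ring

lemma Gamma_third : Real.Gamma (1 / 3) * Real.Gamma (2 / 3) * √3 = 2 * Real.pi := by
  have h := Real.Gamma_mul_Gamma_one_sub (1 / 3)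
  rw [show Real.pi * (1 / 3) = Real.pi / 3 by ring, Real.sin_pi_div_three,
    show (1 : ℝ) - 1 / 3 = 2 / 3 by norm_num] at h
  rw [h]
  have : √3 ≠ 0 := by positivity
  field_simp

lemma airyFn_zero_zero {η : ℝ} (hη : 0 < η) :
    airyFn 0 η 0 = ((3 : ℝ) ^ (-(2 : ℝ) / 3) / Real.Gamma (2 / 3) : ℝ) := by
  have h3 : (1 / 3 : ℝ) ^ (-((0 : ℕ) + 1 : ℝ) / 3) * (1 / 3) = (3 : ℝ) ^ (-(2 : ℝ) / 3) := by
    rw [one_div, Real.inv_rpow (by norm_num), ← Real.rpow_neg (by norm_num),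
      ← Real.rpow_neg_one 3, ← Real.rpow_add (by norm_num)]
    norm_num
  have hm : airyMoment 0 = (3 : ℝ) ^ (-(2 : ℝ) / 3) * Real.Gamma (1 / 3) := by
    rw [airyMoment_eq, h3]; norm_num
  rw [airyFn, integral_airyInt_zero 0 hη]
  simp only [pow_zero, one_mul]
  rw [rayDir_sub, hm, ← Complex.ofReal_mul]
  have h2 : Real.Gamma (2 / 3) ≠ 0 := (Real.Gamma_pos_of_pos (by norm_num)).ne'
  rw [show (1 / (2 * Real.pi) : ℂ) = ((1 / (2 * Real.pi) : ℝ) : ℂ) by push_cast; ring,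
    ← Complex.ofReal_mul]
  congr 1
  rw [eq_div_iff h2]
  have hpi := Real.pi_pos.ne'
  field_simp
  linear_combination Gamma_third

lemma airyFn_one_zero {η : ℝ} (hη : 0 < η) :
    airyFn 1 η 0 = (-((3 : ℝ) ^ (-(1 : ℝ) / 3)) / Real.Gamma (1 / 3) : ℝ) := by
  have h3 : (1 / 3 : ℝ) ^ (-((1 : ℕ) + 1 : ℝ) / 3) * (1 / 3) = (3 : ℝ) ^ (-(1 : ℝ) / 3) := by
    rw [one_div, Real.inv_rpow (by norm_num), ← Real.rpow_neg (by norm_num),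
      ← Real.rpow_neg_one 3, ← Real.rpow_add (by norm_num)]
    norm_num
  have hm : airyMoment 1 = (3 : ℝ) ^ (-(1 : ℝ) / 3) * Real.Gamma (2 / 3) := by
    rw [airyMoment_eq, h3]; norm_num
  rw [airyFn, integral_airyInt_zero 1 hη]
  have hd : (Complex.I * rayDir 1) ^ 1 * rayDir 1 - (Complex.I * rayDir (-1)) ^ 1 * rayDir (-1)
      = ((-√3 : ℝ) : ℂ) := by
    push_cast
    linear_combination Complex.I * (rayDir 1 + rayDir (-1)) * rayDir_sub
      + Complex.I * √3 * rayDir_add + √3 * Complex.I_sq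
  rw [hd, hm, ← Complex.ofReal_mul]
  have h2 : Real.Gamma (1 / 3) ≠ 0 := (Real.Gamma_pos_of_pos (by norm_num)).ne'
  rw [show (1 / (2 * Real.pi) : ℂ) = ((1 / (2 * Real.pi) : ℝ) : ℂ) by push_cast; ring,
    ← Complex.ofReal_mul]
  congr 1
  rw [eq_div_iff h2]
  have hpi := Real.pi_pos.ne'
  field_simp
  linear_combination -Gamma_third

/-! ### Uniqueness for the Airy equation -/

lemma airy_unique {f f' : ℝ → ℂ} (hf : ∀ x, HasDerivAt f (f' x) x)
    (hf' : ∀ x : ℝ, HasDerivAt f' (x * f x) x) {x₀ : ℝ} (h0 : f x₀ = 0) (h1 : f' x₀ = 0) (x : ℝ) :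
    f x = 0 ∧ f' x = 0 := by
  set R : ℝ := |x| + |x₀| + 1 with hR
  have hRx : |x| < R := by
    have := abs_nonneg x₀
    linarith
  have hRx0 : |x₀| < R := by
    have := abs_nonneg x
    linarith
  let v : ℝ → ℂ × ℂ → ℂ × ℂ := fun t y => (y.2, (t : ℂ) * y.1)
  have hv : ∀ t ∈ Set.Ioo (-R) R, LipschitzOnWith (Real.toNNReal (1 + R)) (v t) Set.univ := by
    intro t ht
    refine LipschitzOnWith.of_dist_le_mul fun y _ w _ => ?_
    rw [Real.coe_toNNReal _ (by positivity), dist_eq_norm, dist_eq_norm]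
    have e : v t y - v t w = ((y - w).2, (t : ℂ) * (y - w).1) := by
      simp [v, mul_sub]
    rw [e, Prod.norm_def]
    have ht' : |t| ≤ R := (abs_lt.2 ht).le
    have hR0 : 0 ≤ R := (abs_nonneg t).trans ht'
    refine max_le ?_ ?_
    · have := norm_snd_le (y - w)
      have := norm_nonneg (y - w)
      nlinarith
    · simp only [norm_mul, Complex.norm_real, Real.norm_eq_abs]
      have := norm_fst_le (y - w)
      have := norm_nonneg (y - w)
      have := mul_le_mul ht' (norm_fst_le (y - w)) (norm_nonneg _) hR0
      nlinarith
  have := ODE_solution_unique_of_mem_Ioo (v := v) (s := fun _ => Set.univ)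
    (f := fun t => (f t, f' t)) (g := fun _ => 0) hv (abs_lt.1 hRx0)
    (fun t _ => ⟨(hf t).prodMk (hf' t), Set.mem_univ _⟩)
    (fun t _ => ⟨by
      have e : v t 0 = 0 := by simp [v]
      rw [e]
      exact hasDerivAt_const t _, Set.mem_univ _⟩)
    (by simp [h0, h1])
  have := this (abs_lt.1 hRx)
  simpa using this

lemma IsAiry.eq_airyFn {A A' : ℝ → ℝ} (hA : IsAiry A A') {η : ℝ} (hη : 0 < η) (x : ℝ) :
    (A x : ℂ) = airyFn 0 η x ∧ (A' x : ℂ) = airyFn 1 η x := by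
  obtain ⟨h1, h2, h3, h4⟩ := hA
  have := airy_unique (f := fun x => (A x : ℂ) - airyFn 0 η x)
    (f' := fun x => (A' x : ℂ) - airyFn 1 η x) (x₀ := 0)
    (fun x => (h1 x).ofReal_comp.sub (hasDerivAt_airyFn 0 hη x))
    (fun x => ((h2 x).ofReal_comp.sub (hasDerivAt_airyFn 1 hη x)).congr_deriv (by
      rw [airyFn_two hη]; push_cast; ring))
    (by simp only [h3, airyFn_zero_zero hη, sub_self])
    (by simp only [h4, airyFn_one_zero hη, sub_self]) x
  exact ⟨sub_eq_zero.1 this.1, sub_eq_zero.1 this.2⟩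

/-! ### Hankel operators with exponentially decaying kernels on `L²(0, ∞)` -/

/-- Lebesgue measure on `(0, ∞)`. -/
abbrev halfVol : Measure ℝ := volume.restrict (Set.Ioi 0)

/-- The Hilbert space `L²(0, ∞)`. -/
abbrev HalfL2 : Type := Lp ℂ 2 halfVol

/-- Bounded continuous functions; `ψ` stands for the decaying kernel `x ↦ e^{-x} ψ x`. -/
abbrev Wt : Type := BoundedContinuousFunction ℝ ℂ

/-- The kernel `x ↦ e^{-x} ψ x`. -/
def expKer (ψ : Wt) (x : ℝ) : ℂ := (Real.exp (-x) : ℂ) * ψ x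

lemma continuous_expKer (ψ : Wt) : Continuous (expKer ψ) := by
  unfold expKer
  fun_prop

lemma norm_expKer_le (ψ : Wt) (x : ℝ) : ‖expKer ψ x‖ ≤ ‖ψ‖ * Real.exp (-x) := by
  unfold expKer
  rw [norm_mul, Complex.norm_real, Real.norm_eq_abs, abs_of_pos (Real.exp_pos _), mul_comm]
  gcongr
  exact ψ.norm_coe_le_norm x

lemma expKer_add (ψ χ : Wt) (x : ℝ) : expKer (ψ + χ) x = expKer ψ x + expKer χ x := by
  simp [expKer, mul_add]

lemma expKer_smul (c : ℂ) (ψ : Wt) (x : ℝ) : expKer (c • ψ) x = c * expKer ψ x := by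
  simp [expKer]; ring

lemma memLp_exp_neg_mul {η : ℝ} (hη : 0 < η) :
    MemLp (fun t : ℝ => (Real.exp (-η * t) : ℂ)) 2 halfVol := by
  have hc : Continuous (fun t : ℝ => (Real.exp (-η * t) : ℂ)) := by fun_prop
  rw [memLp_two_iff_integrable_sq_norm hc.aestronglyMeasurable]
  refine (integrableOn_exp_mul_Ioi (a := -2 * η) (by linarith) 0).congr
    (Eventually.of_forall fun t => ?_)
  simp only [Complex.norm_real, Real.norm_eq_abs, abs_of_pos (Real.exp_pos _)]
  rw [← Real.exp_nat_mul]
  congr 1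
  push_cast
  ring

lemma memLp_exp : MemLp (fun t : ℝ => (Real.exp (-t) : ℂ)) 2 halfVol := by
  simpa using memLp_exp_neg_mul one_pos

lemma norm_toLp_exp_le : ‖memLp_exp.toLp _‖ ≤ 1 := by
  have h : ‖memLp_exp.toLp _‖ ^ 2 = 1 / 2 := by
    rw [← @inner_self_eq_norm_sq ℂ, L2.inner_def]
    have : ∫ t, inner ℂ (memLp_exp.toLp _ t) (memLp_exp.toLp _ t) ∂halfVol
        = ∫ t in Set.Ioi (0 : ℝ), ((Real.exp (-2 * t) : ℝ) : ℂ) := by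
      refine integral_congr_ae ?_
      filter_upwards [memLp_exp.coeFn_toLp] with t ht
      rw [ht, RCLike.inner_apply, Complex.conj_ofReal, ← Complex.ofReal_mul, ← Real.exp_add]
      congr 2
      ring
    rw [this, integral_complex_ofReal, integral_exp_mul_Ioi (by norm_num)]
    simp
  have h0 := norm_nonneg (memLp_exp.toLp _)
  nlinarith

lemma norm_toLp_le {f : ℝ → ℂ} (hf : MemLp f 2 halfVol) {C : ℝ} (hC : 0 ≤ C)
    (h : ∀ᵐ t ∂halfVol, ‖f t‖ ≤ C * Real.exp (-t)) : ‖hf.toLp f‖ ≤ C := by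
  have : ‖hf.toLp f‖ ≤ C * ‖memLp_exp.toLp _‖ := by
    refine Lp.norm_le_mul_norm_of_ae_le_mul ?_
    filter_upwards [h, hf.coeFn_toLp, memLp_exp.coeFn_toLp] with t h1 h2 h3
    rw [h2, h3, Complex.norm_real, Real.norm_eq_abs, abs_of_pos (Real.exp_pos _)]
    exact h1
  nlinarith [norm_toLp_exp_le]

lemma memLp_of_exp_bound {f : ℝ → ℂ} (hf : AEStronglyMeasurable f halfVol) {C : ℝ}
    (h : ∀ᵐ t ∂halfVol, ‖f t‖ ≤ C * Real.exp (-t)) : MemLp f 2 halfVol := by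
  refine MemLp.of_le_mul (c := C) memLp_exp hf ?_
  filter_upwards [h] with t ht
  rwa [Complex.norm_real, Real.norm_eq_abs, abs_of_pos (Real.exp_pos _)]

lemma memLp_expKer (ψ : Wt) : MemLp (expKer ψ) 2 halfVol :=
  memLp_of_exp_bound (continuous_expKer ψ).aestronglyMeasurable
    (Eventually.of_forall (norm_expKer_le ψ))

/-- The kernel `expKer ψ` as an element of `L²(0, ∞)`, depending linearly on `ψ`. -/
def kerL2 : Wt →L[ℂ] HalfL2 :=
  LinearMap.mkContinuous
    { toFun := fun ψ => (memLp_expKer ψ).toLp _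
      map_add' := fun ψ χ => by
        rw [← MemLp.toLp_add]
        exact MemLp.toLp_congr _ _ (Eventually.of_forall fun x => expKer_add ψ χ x)
      map_smul' := fun c ψ => by
        rw [RingHom.id_apply, ← MemLp.toLp_const_smul]
        exact MemLp.toLp_congr _ _ (Eventually.of_forall fun x => expKer_smul c ψ x) }
    1 (fun ψ => by
      rw [one_mul]
      exact norm_toLp_le (memLp_expKer ψ) (norm_nonneg ψ) (Eventually.of_forall (norm_expKer_le ψ)))

lemma coeFn_kerL2 (ψ : Wt) : kerL2 ψ =ᵐ[halfVol] expKer ψ := (memLp_expKer ψ).coeFn_toLp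

lemma norm_kerL2_le (ψ : Wt) : ‖kerL2 ψ‖ ≤ ‖ψ‖ :=
  norm_toLp_le (memLp_expKer ψ) (norm_nonneg ψ) (Eventually.of_forall (norm_expKer_le ψ))

lemma integrable_expKer_mul (ψ : Wt) (f : HalfL2) :
    Integrable (fun t => expKer ψ t * f t) halfVol :=
  (memLp_expKer ψ).integrable_mul (Lp.memLp f)

lemma expKer_star (ψ : Wt) (t : ℝ) : expKer (star ψ) t = star (expKer ψ t) := by
  simp only [expKer, star_mul', BoundedContinuousFunction.star_apply, Complex.star_def,
    Complex.conj_ofReal]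

lemma integral_expKer_mul (ψ : Wt) (f : HalfL2) :
    ∫ t, expKer ψ t * f t ∂halfVol = inner ℂ (kerL2 (star ψ)) f := by
  rw [L2.inner_def]
  refine integral_congr_ae ?_
  filter_upwards [coeFn_kerL2 (star ψ)] with t ht
  rw [ht, expKer_star, RCLike.inner_apply, mul_comm]
  simp

lemma norm_integral_expKer_mul_le' (ψ : Wt) (f : HalfL2) :
    ‖∫ t, expKer ψ t * f t ∂halfVol‖ ≤ ‖kerL2 (star ψ)‖ * ‖f‖ := by
  rw [integral_expKer_mul]
  exact norm_inner_le_norm _ _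

lemma norm_integral_expKer_mul_le (ψ : Wt) (f : HalfL2) :
    ‖∫ t, expKer ψ t * f t ∂halfVol‖ ≤ ‖ψ‖ * ‖f‖ := by
  refine (norm_integral_expKer_mul_le' ψ f).trans ?_
  gcongr
  exact (norm_kerL2_le _).trans (norm_star ψ).le

/-- The bilinear pairing `(ψ, f) ↦ ∫ e^{-t} ψ t * f t` on `(0, ∞)`. -/
def kerPair : Wt →L[ℂ] HalfL2 →L[ℂ] ℂ :=
  LinearMap.mkContinuous₂
    (LinearMap.mk₂ ℂ (fun ψ f => ∫ t, expKer ψ t * f t ∂halfVol)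
      (fun ψ χ f => by
        rw [← integral_add (integrable_expKer_mul ψ f) (integrable_expKer_mul χ f)]
        simp only [expKer_add, add_mul])
      (fun c ψ f => by
        rw [smul_eq_mul, ← integral_const_mul]
        simp only [expKer_smul, mul_assoc])
      (fun ψ f g => by
        rw [← integral_add (integrable_expKer_mul ψ f) (integrable_expKer_mul ψ g)]
        refine integral_congr_ae ?_
        filter_upwards [Lp.coeFn_add f g] with t ht
        rw [ht, Pi.add_apply, mul_add])
      (fun c ψ f => by
        rw [smul_eq_mul, ← integral_const_mul]
        refine integral_congr_ae ?_
        filter_upwards [Lp.coeFn_smul c f] with t ht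
        rw [ht, Pi.smul_apply, smul_eq_mul]
        ring))
    1 (fun ψ f => by
      rw [one_mul]
      exact norm_integral_expKer_mul_le ψ f)

lemma kerPair_apply (ψ : Wt) (f : HalfL2) : kerPair ψ f = ∫ t, expKer ψ t * f t ∂halfVol := rfl

/-- The translate of a kernel: `expKer (shiftWt s ψ) t = expKer ψ (s + t)`. -/
def shiftWt (s : ℝ) (ψ : Wt) : Wt :=
  (Real.exp (-s) : ℂ) • ψ.compContinuous ⟨fun t => s + t, by fun_prop⟩

lemma expKer_shiftWt (s : ℝ) (ψ : Wt) (t : ℝ) : expKer (shiftWt s ψ) t = expKer ψ (s + t) := by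
  unfold shiftWt
  rw [expKer_smul]
  simp only [expKer, BoundedContinuousFunction.compContinuous_apply, ContinuousMap.coe_mk]
  rw [← mul_assoc, ← Complex.ofReal_mul, ← Real.exp_add]
  congr 3
  ring

lemma norm_shiftWt_le (s : ℝ) (ψ : Wt) : ‖shiftWt s ψ‖ ≤ ‖ψ‖ * Real.exp (-s) := by
  unfold shiftWt
  rw [norm_smul, Complex.norm_real, Real.norm_eq_abs, abs_of_pos (Real.exp_pos _), mul_comm]
  gcongr
  exact ψ.norm_compContinuous_le _

/-- The Hankel transform `s ↦ ∫ expKer ψ (s + t) f t` as a function on `ℝ`. -/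
def hankelFun (ψ : Wt) (f : ℝ → ℂ) (s : ℝ) : ℂ := ∫ t, expKer ψ (s + t) * f t ∂halfVol

lemma hankelFun_eq_kerPair (ψ : Wt) (f : HalfL2) (s : ℝ) :
    hankelFun ψ f s = kerPair (shiftWt s ψ) f := by
  simp only [hankelFun, kerPair_apply, expKer_shiftWt]

lemma norm_hankelFun_le (ψ : Wt) (f : HalfL2) (s : ℝ) :
    ‖hankelFun ψ f s‖ ≤ ‖ψ‖ * ‖f‖ * Real.exp (-s) := by
  rw [hankelFun_eq_kerPair]
  refine (norm_integral_expKer_mul_le _ _).trans ?_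
  calc _ ≤ ‖ψ‖ * Real.exp (-s) * ‖f‖ := by gcongr; exact norm_shiftWt_le s ψ
    _ = _ := by ring

lemma aestronglyMeasurable_hankelFun (ψ : Wt) (f : HalfL2) :
    AEStronglyMeasurable (hankelFun ψ f) halfVol := by
  refine AEStronglyMeasurable.integral_prod_right'
    (f := fun p : ℝ × ℝ => expKer ψ (p.1 + p.2) * f p.2) ?_
  have hk := continuous_expKer ψ
  refine AEStronglyMeasurable.mul ?_ (Lp.aestronglyMeasurable f).comp_snd
  exact Continuous.aestronglyMeasurable (by fun_prop)

lemma memLp_hankelFun (ψ : Wt) (f : HalfL2) : MemLp (hankelFun ψ f) 2 halfVol :=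
  memLp_of_exp_bound (aestronglyMeasurable_hankelFun ψ f)
    (Eventually.of_forall (norm_hankelFun_le ψ f))

lemma shiftWt_add (s : ℝ) (ψ χ : Wt) : shiftWt s (ψ + χ) = shiftWt s ψ + shiftWt s χ := by
  ext t
  simp [shiftWt, mul_add]

lemma shiftWt_smul (s : ℝ) (c : ℂ) (ψ : Wt) : shiftWt s (c • ψ) = c • shiftWt s ψ := by
  ext t
  simp [shiftWt]
  ring

/-- The Hankel operator with kernel `expKer ψ (s + t)` on `L²(0, ∞)`. -/
def hankel : Wt →L[ℂ] HalfL2 →L[ℂ] HalfL2 :=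
  LinearMap.mkContinuous₂
    (LinearMap.mk₂ ℂ (fun ψ f => (memLp_hankelFun ψ f).toLp _)
      (fun ψ χ f => by
        rw [← MemLp.toLp_add]
        refine MemLp.toLp_congr _ _ (Eventually.of_forall fun s => ?_)
        simp only [hankelFun_eq_kerPair, Pi.add_apply, shiftWt_add, map_add,
          add_apply])
      (fun c ψ f => by
        rw [← MemLp.toLp_const_smul]
        refine MemLp.toLp_congr _ _ (Eventually.of_forall fun s => ?_)
        simp only [hankelFun_eq_kerPair, Pi.smul_apply, shiftWt_smul, map_smul,
          smul_apply])
      (fun ψ f g => by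
        rw [← MemLp.toLp_add]
        refine MemLp.toLp_congr _ _ (Eventually.of_forall fun s => ?_)
        simp only [hankelFun_eq_kerPair, Pi.add_apply, map_add])
      (fun c ψ f => by
        rw [← MemLp.toLp_const_smul]
        refine MemLp.toLp_congr _ _ (Eventually.of_forall fun s => ?_)
        simp only [hankelFun_eq_kerPair, Pi.smul_apply, map_smul]))
    1 (fun ψ f => by
      rw [one_mul]
      exact norm_toLp_le (memLp_hankelFun ψ f) (by positivity)
        (Eventually.of_forall (norm_hankelFun_le ψ f)))

lemma coeFn_hankel (ψ : Wt) (f : HalfL2) : hankel ψ f =ᵐ[halfVol] hankelFun ψ f :=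
  (memLp_hankelFun ψ f).coeFn_toLp

lemma norm_hankel_le (ψ : Wt) : ‖hankel ψ‖ ≤ ‖ψ‖ :=
  ContinuousLinearMap.opNorm_le_bound _ (norm_nonneg ψ) fun f =>
    norm_toLp_le (memLp_hankelFun ψ f) (by positivity)
      (Eventually.of_forall (norm_hankelFun_le ψ f))

lemma hankelFun_symm (ψ : Wt) {f g : ℝ → ℂ} (hf : MemLp f 2 halfVol) (hg : MemLp g 2 halfVol) :
    ∫ s, g s * hankelFun ψ f s ∂halfVol = ∫ s, f s * hankelFun ψ g s ∂halfVol := by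
  have hk := continuous_expKer ψ
  have hInt : Integrable (Function.uncurry fun s t => expKer ψ (s + t) * (g s * f t))
      (halfVol.prod halfVol) := by
    have h1 : Integrable (fun t : ℝ => (Real.exp (-t) : ℂ) * f t) halfVol :=
      memLp_exp.integrable_mul hf
    have h2 : Integrable (fun t : ℝ => (Real.exp (-t) : ℂ) * g t) halfVol :=
      memLp_exp.integrable_mul hg
    refine ((h2.mul_prod h1).const_mul (‖ψ‖ : ℂ)).mono ?_ (Eventually.of_forall fun p => ?_)
    · refine AEStronglyMeasurable.mul (Continuous.aestronglyMeasurable (by fun_prop)) ?_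
      exact hg.aestronglyMeasurable.comp_fst.mul hf.aestronglyMeasurable.comp_snd
    · have := norm_expKer_le ψ (p.1 + p.2)
      simp only [Function.uncurry, norm_mul, Complex.norm_real, norm_norm]
      rw [Real.norm_eq_abs, Real.norm_eq_abs, abs_of_pos (Real.exp_pos _),
        abs_of_pos (Real.exp_pos _)]
      calc _ ≤ ‖ψ‖ * Real.exp (-(p.1 + p.2)) * (‖g p.1‖ * ‖f p.2‖) := by gcongr
        _ = _ := by rw [neg_add, Real.exp_add]; ring
  calc _ = ∫ s, ∫ t, expKer ψ (s + t) * (g s * f t) ∂halfVol ∂halfVol := by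
        refine integral_congr_ae (Eventually.of_forall fun s => ?_)
        simp only [hankelFun]
        rw [← integral_const_mul]
        refine integral_congr_ae (Eventually.of_forall fun t => ?_)
        simp only
        ring
    _ = ∫ t, ∫ s, expKer ψ (s + t) * (g s * f t) ∂halfVol ∂halfVol := integral_integral_swap hInt
    _ = _ := by
        refine integral_congr_ae (Eventually.of_forall fun t => ?_)
        simp only [hankelFun]
        rw [← integral_const_mul]
        refine integral_congr_ae (Eventually.of_forall fun s => ?_)
        simp only
        rw [add_comm t s]
        ring

lemma hankelFun_congr (ψ : Wt) {f g : ℝ → ℂ} (h : f =ᵐ[halfVol] g) :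
    hankelFun ψ f = hankelFun ψ g := by
  funext s
  refine integral_congr_ae ?_
  filter_upwards [h] with t ht
  rw [ht]

lemma inner_hankel (ψ : Wt) (f g : HalfL2) :
    inner ℂ g (hankel ψ f) = ∫ s, star (g s) * hankelFun ψ f s ∂halfVol := by
  rw [L2.inner_def]
  refine integral_congr_ae ?_
  filter_upwards [coeFn_hankel ψ f] with s hs
  rw [hs, RCLike.inner_apply, mul_comm]
  rfl

lemma isSelfAdjoint_hankel {ψ : Wt} (hψ : star ψ = ψ) : IsSelfAdjoint (hankel ψ) := by
  rw [ContinuousLinearMap.isSelfAdjoint_iff_isSymmetric]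
  intro f g
  change inner ℂ (hankel ψ f) g = inner ℂ f (hankel ψ g)
  have hf : MemLp (fun t => star (f t)) 2 halfVol := (Lp.memLp f).star
  rw [← inner_conj_symm, inner_hankel, inner_hankel, hankelFun_symm ψ (Lp.memLp g) hf,
    ← integral_conj]
  refine integral_congr_ae (Eventually.of_forall fun s => ?_)
  have hreal : ∀ x, star (expKer ψ x) = expKer ψ x := fun x => by rw [← expKer_star, hψ]
  simp only [map_mul, Complex.star_def, Complex.conj_conj]
  congr 1
  simp only [hankelFun]
  rw [← integral_conj]
  refine integral_congr_ae (Eventually.of_forall fun t => ?_)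
  simp only [map_mul, ← Complex.star_def, hreal]

/-! ### The shifted Airy kernel as a curve of weights -/

lemma norm_taylor_le {g g' g'' : ℝ → ℂ} (hg : ∀ x, HasDerivAt g (g' x) x)
    (hg' : ∀ x, HasDerivAt g' (g'' x) x) {x y K : ℝ} (hK : ∀ z ∈ Set.uIcc x y, ‖g'' z‖ ≤ K) :
    ‖g y - g x - (y - x) • g' x‖ ≤ K * |y - x| ^ 2 := by
  have hK0 : 0 ≤ K := (norm_nonneg _).trans (hK x Set.left_mem_uIcc)
  have hconv : Convex ℝ (Set.uIcc x y) := convex_uIcc x y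
  have h1 : ∀ z ∈ Set.uIcc x y, ‖g' z - g' x‖ ≤ K * |y - x| := fun z hz => by
    refine (hconv.norm_image_sub_le_of_norm_hasDerivWithin_le
      (fun w _ => (hg' w).hasDerivWithinAt) hK Set.left_mem_uIcc hz).trans ?_
    exact mul_le_mul_of_nonneg_left (Set.abs_sub_left_of_mem_uIcc hz) hK0
  have h2 := hconv.norm_image_sub_le_of_norm_hasDerivWithin_le
    (f := fun z => g z - (z - x) • g' x) (f' := fun z => g' z - g' x) (C := K * |y - x|)
    (fun w _ => by
      have := (((hasDerivAt_id w).sub_const x).smul_const (g' x))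
      rw [one_smul] at this
      exact ((hg w).sub this).hasDerivWithinAt)
    h1 Set.left_mem_uIcc Set.right_mem_uIcc
  simp only [sub_self, zero_smul, sub_zero, Real.norm_eq_abs] at h2
  calc _ = ‖g y - (y - x) • g' x - g x‖ := by congr 1; abel
    _ ≤ _ := h2
    _ = _ := by ring

lemma continuous_airyFn (m : ℕ) : Continuous (airyFn m 1) :=
  continuous_iff_continuousAt.2 fun x => (hasDerivAt_airyFn m one_pos x).continuousAt

/-- A constant with `‖airyFn m 1 x‖ ≤ airyBound m * exp (-x)`. -/
def airyBound (m : ℕ) : ℝ := (norm_airyFn_le m one_pos).choose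

lemma norm_airyFn_one_le (m : ℕ) (x : ℝ) : ‖airyFn m 1 x‖ ≤ airyBound m * Real.exp (-x) := by
  have := (norm_airyFn_le m one_pos).choose_spec x
  rwa [neg_one_mul] at this

lemma airyBound_nonneg (m : ℕ) : 0 ≤ airyBound m := by
  have := (norm_nonneg _).trans (norm_airyFn_one_le m 0)
  simpa using this

lemma norm_exp_mul_airyFn_le (m : ℕ) (τ x : ℝ) :
    ‖(Real.exp x : ℂ) * airyFn m 1 (τ + x)‖ ≤ airyBound m * Real.exp (-τ) := by
  rw [norm_mul, Complex.norm_real, Real.norm_eq_abs, abs_of_pos (Real.exp_pos _)]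
  calc _ ≤ Real.exp x * (airyBound m * Real.exp (-(τ + x))) := by
        gcongr
        exact norm_airyFn_one_le m _
    _ = airyBound m * (Real.exp x * Real.exp (-(τ + x))) := by ring
    _ = _ := by rw [← Real.exp_add]; congr 2; ring

/-- The weight whose kernel is `x ↦ airyFn m 1 (τ + x)`. -/
def airyWt (m : ℕ) (τ : ℝ) : Wt :=
  BoundedContinuousFunction.ofNormedAddCommGroup
    (fun x => (Real.exp x : ℂ) * airyFn m 1 (τ + x))
    (by have := continuous_airyFn m; fun_prop) _ (norm_exp_mul_airyFn_le m τ)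

lemma airyWt_apply (m : ℕ) (τ x : ℝ) :
    airyWt m τ x = (Real.exp x : ℂ) * airyFn m 1 (τ + x) := rfl

lemma expKer_airyWt (m : ℕ) (τ x : ℝ) : expKer (airyWt m τ) x = airyFn m 1 (τ + x) := by
  rw [expKer, airyWt_apply, ← mul_assoc, ← Complex.ofReal_mul, ← Real.exp_add]
  simp

lemma norm_airyWt_le (m : ℕ) (τ : ℝ) : ‖airyWt m τ‖ ≤ airyBound m * Real.exp (-τ) :=
  BoundedContinuousFunction.norm_ofNormedAddCommGroup_le _
    (mul_nonneg (airyBound_nonneg m) (Real.exp_pos _).le) _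

lemma shiftWt_airyWt (m : ℕ) (s τ : ℝ) : shiftWt s (airyWt m τ) = airyWt m (τ + s) := by
  ext x
  simp only [shiftWt, BoundedContinuousFunction.smul_apply, airyWt_apply, smul_eq_mul,
    BoundedContinuousFunction.compContinuous_apply, ContinuousMap.coe_mk]
  rw [← mul_assoc, ← Complex.ofReal_mul, ← Real.exp_add, neg_add_cancel_left, add_assoc]

lemma hasDerivAt_airyWt (m : ℕ) (τ : ℝ) : HasDerivAt (airyWt m) (airyWt (m + 1) τ) τ := by
  rw [hasDerivAt_iff_isLittleO]
  set K := airyBound (m + 2) * Real.exp (1 - τ)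
  have hK : 0 ≤ K := mul_nonneg (airyBound_nonneg _) (Real.exp_pos _).le
  refine Asymptotics.IsBigO.trans_isLittleO (g := fun τ' => |τ' - τ| ^ 2) ?_ ?_
  · refine Asymptotics.IsBigO.of_bound K ?_
    filter_upwards [Metric.ball_mem_nhds τ one_pos] with τ' hτ'
    rw [Metric.mem_ball, Real.dist_eq] at hτ'
    rw [Real.norm_eq_abs, abs_of_nonneg (by positivity)]
    refine (BoundedContinuousFunction.norm_le (by positivity)).2 fun x => ?_
    have hd : ∀ n σ, HasDerivAt (fun σ => airyWt n σ x) (airyWt (n + 1) σ x) σ := fun n σ => by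
      simp only [airyWt_apply]
      exact ((hasDerivAt_airyFn n one_pos (σ + x)).comp_add_const σ x).const_mul _
    refine norm_taylor_le (hd m) (hd (m + 1)) fun σ hσ => ?_
    refine (BoundedContinuousFunction.norm_coe_le_norm _ x).trans ((norm_airyWt_le _ _).trans ?_)
    have := Set.abs_sub_left_of_mem_uIcc hσ
    have h2 := neg_abs_le (σ - τ)
    refine mul_le_mul_of_nonneg_left (Real.exp_le_exp.2 ?_) (airyBound_nonneg (m + 2))
    linarith
  · exact Asymptotics.isLittleO_pow_sub_sub τ one_lt_two

/-! ### The Airy Hankel operators are contractions -/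

/-- The Fourier transform of `k ↦ exp (-η k²)`. -/
def gaussKer (η x : ℝ) : ℝ := √(Real.pi / η) * Real.exp (-(1 / (4 * η)) * x ^ 2)

lemma gaussKer_nonneg (η x : ℝ) : 0 ≤ gaussKer η x := by
  unfold gaussKer
  positivity

lemma gaussKer_sub_comm (η x y : ℝ) : gaussKer η (x - y) = gaussKer η (y - x) := by
  unfold gaussKer
  congr 3
  ring

lemma integrable_gaussKer {η : ℝ} (hη : 0 < η) : Integrable (gaussKer η) :=
  (integrable_exp_neg_mul_sq (by positivity)).const_mul _

lemma integral_gaussKer {η : ℝ} (hη : 0 < η) : ∫ x, gaussKer η x = 2 * Real.pi := by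
  unfold gaussKer
  rw [integral_const_mul, integral_gaussian, ← Real.sqrt_mul (by positivity),
    show Real.pi / η * (Real.pi / (1 / (4 * η))) = (2 * Real.pi) ^ 2 by field_simp; ring]
  exact Real.sqrt_sq (by positivity)

lemma integral_exp_mul_gaussian {η : ℝ} (hη : 0 < η) (x : ℝ) :
    ∫ k : ℝ, Complex.exp (Complex.I * x * k) * Real.exp (-η * k ^ 2) = gaussKer η x := by
  have := fourierIntegral_gaussian (b := η) (by simpa using hη) x
  push_cast at this ⊢
  rw [this, gaussKer, Real.sqrt_eq_rpow]
  push_cast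
  rw [Complex.ofReal_cpow (by positivity)]
  push_cast
  congr 2
  field_simp

lemma integrable_mul_gaussKer {η : ℝ} (hη : 0 < η) {w : ℝ → ℝ} (hw : Integrable w halfVol)
    (h0 : ∀ x, 0 ≤ w x) :
    Integrable (fun p : ℝ × ℝ => w p.1 * gaussKer η (p.1 - p.2)) (halfVol.prod halfVol) ∧
    ∫ p, w p.1 * gaussKer η (p.1 - p.2) ∂(halfVol.prod halfVol)
      ≤ 2 * Real.pi * ∫ x, w x ∂halfVol := by
  have hg : ∀ x, Integrable (fun y => gaussKer η (x - y)) :=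
    fun x => (integrable_gaussKer hη).comp_sub_left x
  have hle : ∀ x, ∫ y, gaussKer η (x - y) ∂halfVol ≤ 2 * Real.pi := fun x => by
    refine (setIntegral_le_integral (hg x)
      (Eventually.of_forall fun y => gaussKer_nonneg η _)).trans ?_
    rw [integral_sub_left_eq_self, integral_gaussKer hη]
  have hcont : Continuous fun p : ℝ × ℝ => gaussKer η (p.1 - p.2) := by
    unfold gaussKer
    fun_prop
  have hmeas : AEStronglyMeasurable (fun p : ℝ × ℝ => w p.1 * gaussKer η (p.1 - p.2))
      (halfVol.prod halfVol) := hw.aestronglyMeasurable.comp_fst.mul hcont.aestronglyMeasurable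
  have hbd : ∀ x, w x * ∫ y, gaussKer η (x - y) ∂halfVol ≤ 2 * Real.pi * w x := fun x => by
    rw [mul_comm]
    exact mul_le_mul_of_nonneg_right (hle x) (h0 x)
  have hint2 : Integrable (fun x => w x * ∫ y, gaussKer η (x - y) ∂halfVol) halfVol := by
    refine (hw.const_mul (2 * Real.pi)).mono' ?_ (Eventually.of_forall fun x => ?_)
    · exact hw.aestronglyMeasurable.mul
        (AEStronglyMeasurable.integral_prod_right' (f := fun p : ℝ × ℝ => gaussKer η (p.1 - p.2))
          hcont.aestronglyMeasurable)
    · rw [Real.norm_eq_abs, abs_of_nonneg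
        (mul_nonneg (h0 x) (integral_nonneg fun y => gaussKer_nonneg η _))]
      exact hbd x
  have hInt : Integrable (fun p : ℝ × ℝ => w p.1 * gaussKer η (p.1 - p.2))
      (halfVol.prod halfVol) := by
    refine (integrable_prod_iff hmeas).2
      ⟨Eventually.of_forall fun x => (hg x).restrict.const_mul (w x), ?_⟩
    refine hint2.congr (Eventually.of_forall fun x => ?_)
    simp only
    rw [← integral_const_mul]
    refine integral_congr_ae (Eventually.of_forall fun y => ?_)
    simp only
    rw [Real.norm_eq_abs, abs_of_nonneg (mul_nonneg (h0 x) (gaussKer_nonneg η _))]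
  refine ⟨hInt, ?_⟩
  rw [integral_prod _ hInt]
  simp only [integral_const_mul]
  rw [← integral_const_mul]
  exact integral_mono hint2 (hw.const_mul _) hbd

/-- The Fourier transform of a function on `(0, ∞)`. -/
def halfFourier (h : ℝ → ℂ) (k : ℝ) : ℂ := ∫ t, h t * Complex.exp (Complex.I * t * k) ∂halfVol

lemma norm_cexp_I_mul_mul (t k : ℝ) : ‖Complex.exp (Complex.I * t * k)‖ = 1 := by
  rw [mul_assoc, ← Complex.ofReal_mul, Complex.norm_exp_I_mul_ofReal]

lemma norm_halfFourier_le (h : ℝ → ℂ) (k : ℝ) : ‖halfFourier h k‖ ≤ ∫ t, ‖h t‖ ∂halfVol := by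
  refine (norm_integral_le_integral_norm _).trans_eq ?_
  simp only [norm_mul, norm_cexp_I_mul_mul, mul_one]

lemma aestronglyMeasurable_halfFourier {h : ℝ → ℂ} (hh : AEStronglyMeasurable h halfVol) :
    AEStronglyMeasurable (halfFourier h) := by
  refine AEStronglyMeasurable.integral_prod_right'
    (f := fun p : ℝ × ℝ => h p.2 * Complex.exp (Complex.I * p.2 * p.1)) ?_
  exact hh.comp_snd.mul (Continuous.aestronglyMeasurable (by fun_prop))

lemma integrable_gaussian_mul_halfFourier_sq {η : ℝ} (hη : 0 < η) {h : ℝ → ℂ}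
    (hh : Integrable h halfVol) :
    Integrable fun k : ℝ => Real.exp (-η * k ^ 2) * ‖halfFourier h k‖ ^ 2 := by
  refine ((integrable_exp_neg_mul_sq hη).mul_const ((∫ t, ‖h t‖ ∂halfVol) ^ 2)).mono' ?_
    (Eventually.of_forall fun k => ?_)
  · exact (Continuous.aestronglyMeasurable (by fun_prop)).mul
      ((aestronglyMeasurable_halfFourier hh.aestronglyMeasurable).norm.pow 2)
  · rw [Real.norm_eq_abs, abs_of_nonneg (by positivity)]
    gcongr
    exact norm_halfFourier_le h k

lemma integral_gaussian_mul_halfFourier_sq_le {η : ℝ} (hη : 0 < η) {h : ℝ → ℂ}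
    (hh : Integrable h halfVol) (h2 : MemLp h 2 halfVol) :
    ∫ k : ℝ, Real.exp (-η * k ^ 2) * ‖halfFourier h k‖ ^ 2
      ≤ 2 * Real.pi * ∫ t, ‖h t‖ ^ 2 ∂halfVol := by
  have hstar : Integrable (fun t => star (h t)) halfVol :=
    hh.mono hh.aestronglyMeasurable.star (Eventually.of_forall fun t => (norm_star _).le)
  have hsq : Integrable (fun t => ‖h t‖ ^ 2) halfVol :=
    (memLp_two_iff_integrable_sq_norm h2.aestronglyMeasurable).1 h2
  obtain ⟨hw, hwle⟩ := integrable_mul_gaussKer hη hsq (fun x => by positivity)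
  have hw' := hw.swap
  have key : ((∫ k : ℝ, Real.exp (-η * k ^ 2) * ‖halfFourier h k‖ ^ 2 : ℝ) : ℂ)
      = ∫ p : ℝ × ℝ, h p.1 * star (h p.2) * gaussKer η (p.1 - p.2) ∂(halfVol.prod halfVol) := by
    have e1 : ∀ k : ℝ, ((Real.exp (-η * k ^ 2) * ‖halfFourier h k‖ ^ 2 : ℝ) : ℂ)
        = ∫ p : ℝ × ℝ, h p.1 * star (h p.2) *
          (Complex.exp (Complex.I * ((p.1 - p.2 : ℝ) : ℂ) * k) * Real.exp (-η * k ^ 2))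
          ∂(halfVol.prod halfVol) := fun k => by
      have e2 : star (halfFourier h k)
          = ∫ t, star (h t) * Complex.exp (-(Complex.I * t * k)) ∂halfVol := by
        rw [halfFourier, Complex.star_def, ← integral_conj]
        refine integral_congr_ae (Eventually.of_forall fun t => ?_)
        simp only [map_mul, ← Complex.exp_conj, Complex.conj_I, Complex.conj_ofReal]
        congr 2
        ring
      have e3 : ((‖halfFourier h k‖ ^ 2 : ℝ) : ℂ) = halfFourier h k * star (halfFourier h k) := by
        rw [Complex.star_def, Complex.mul_conj, Complex.normSq_eq_norm_sq]
      rw [Complex.ofReal_mul, e3, e2, halfFourier, ← integral_prod_mul, ← integral_const_mul]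
      refine integral_congr_ae (Eventually.of_forall fun p => ?_)
      simp only
      have : Complex.exp (Complex.I * ((p.1 - p.2 : ℝ) : ℂ) * k)
          = Complex.exp (Complex.I * p.1 * k) * Complex.exp (-(Complex.I * p.2 * k)) := by
        rw [← Complex.exp_add]
        congr 1
        push_cast
        ring
      rw [this]
      ring
    rw [← integral_complex_ofReal]
    simp only [e1]
    rw [integral_integral_swap]
    · simp only [integral_const_mul, integral_exp_mul_gaussian hη]
    · refine (((integrable_exp_neg_mul_sq hη).ofReal (𝕜 := ℂ)).mul_prod
        (hh.mul_prod hstar)).mono ?_ (Eventually.of_forall fun q => ?_)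
      · refine AEStronglyMeasurable.mul ?_ (Continuous.aestronglyMeasurable (by fun_prop))
        exact (hh.mul_prod hstar).aestronglyMeasurable.comp_snd
      · simp only [Function.uncurry, norm_mul, norm_cexp_I_mul_mul, one_mul]
        exact (mul_comm _ _).le
  have hnn : 0 ≤ ∫ k : ℝ, Real.exp (-η * k ^ 2) * ‖halfFourier h k‖ ^ 2 :=
    integral_nonneg fun k => by positivity
  rw [← abs_of_nonneg hnn, ← Real.norm_eq_abs, ← Complex.norm_real, key]
  refine (norm_integral_le_of_norm_le ((hw.add hw').div_const 2)
    (Eventually.of_forall fun p => ?_)).trans ?_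
  · simp only [Pi.add_apply, Function.comp_apply, Prod.fst_swap, Prod.snd_swap, norm_mul,
      Complex.norm_real, Real.norm_eq_abs, abs_of_nonneg (gaussKer_nonneg η _), norm_star]
    rw [gaussKer_sub_comm η p.2 p.1]
    nlinarith [mul_nonneg (gaussKer_nonneg η (p.1 - p.2)) (sq_nonneg (‖h p.1‖ - ‖h p.2‖))]
  · have hswap := integral_prod_swap (μ := halfVol) (ν := halfVol)
      (fun p : ℝ × ℝ => ‖h p.1‖ ^ 2 * gaussKer η (p.1 - p.2))
    have hadd := integral_add hw hw'
    simp only [Function.comp_apply] at hadd hswap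
    rw [integral_div]
    simp only [Pi.add_apply, Function.comp_apply]
    rw [hadd, hswap]
    linarith

lemma airyFn_zero_congr {η η' : ℝ} (hη : 0 < η) (hη' : 0 < η') (x : ℝ) :
    airyFn 0 η x = airyFn 0 η' x := by
  have := airy_unique (f := fun x => airyFn 0 η x - airyFn 0 η' x)
    (f' := fun x => airyFn 1 η x - airyFn 1 η' x) (x₀ := 0)
    (fun x => (hasDerivAt_airyFn 0 hη x).sub (hasDerivAt_airyFn 0 hη' x))
    (fun x => ((hasDerivAt_airyFn 1 hη x).sub (hasDerivAt_airyFn 1 hη' x)).congr_deriv (by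
      rw [airyFn_two hη, airyFn_two hη', mul_sub]))
    (by simp only [airyFn_zero_zero hη, airyFn_zero_zero hη', sub_self])
    (by simp only [airyFn_one_zero hη, airyFn_one_zero hη', sub_self]) x
  exact sub_eq_zero.1 this.1

lemma airyInt_zero_add (η k τ s t : ℝ) :
    airyInt 0 (τ + s + t : ℝ) (hline η k) = airyInt 0 τ (hline η k) *
      (Real.exp (-η * s) * Complex.exp (Complex.I * s * k)) *
      (Real.exp (-η * t) * Complex.exp (Complex.I * t * k)) := by
  unfold airyInt hline
  push_cast
  rw [pow_zero, one_mul, one_mul, ← Complex.exp_add, ← Complex.exp_add, ← Complex.exp_add,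
    ← Complex.exp_add]
  congr 1
  ring_nf
  rw [Complex.I_sq]
  ring

lemma norm_airyInt_zero (η k τ : ℝ) :
    ‖airyInt 0 τ (hline η k)‖ = Real.exp (η ^ 3 / 3 - η * τ) * Real.exp (-η * k ^ 2) := by
  rw [norm_airyInt, pow_zero, one_mul, ← Real.exp_add]
  congr 1
  ring

lemma integral_mul_hankelFun_airyWt {η : ℝ} (hη : 0 < η) (τ : ℝ) (f g : HalfL2) :
    ∫ s, g s * hankelFun (airyWt 0 τ) f s ∂halfVol = (1 / (2 * Real.pi) : ℂ) *
      ∫ k : ℝ, airyInt 0 τ (hline η k) *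
        (halfFourier (fun t => Real.exp (-η * t) * g t) k *
          halfFourier (fun t => Real.exp (-η * t) * f t) k) := by
  have hf : Integrable (fun t => (Real.exp (-η * t) : ℂ) * f t) halfVol :=
    (memLp_exp_neg_mul hη).integrable_mul (Lp.memLp f)
  have hg : Integrable (fun t => (Real.exp (-η * t) : ℂ) * g t) halfVol :=
    (memLp_exp_neg_mul hη).integrable_mul (Lp.memLp g)
  have hE : Integrable fun k => airyInt 0 τ (hline η k) := integrable_airyInt 0 hη τ
  set F : ℝ → ℝ × ℝ → ℂ := fun k p => airyInt 0 τ (hline η k) *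
    (Real.exp (-η * p.1) * g p.1 * Complex.exp (Complex.I * p.1 * k) *
      (Real.exp (-η * p.2) * f p.2 * Complex.exp (Complex.I * p.2 * k))) with hF
  have hInt : Integrable (Function.uncurry F) (volume.prod (halfVol.prod halfVol)) := by
    refine (hE.mul_prod (hg.mul_prod hf)).mono ?_ (Eventually.of_forall fun q => ?_)
    · refine hE.aestronglyMeasurable.comp_fst.mul (AEStronglyMeasurable.mul ?_ ?_)
      · refine AEStronglyMeasurable.mul ?_ (Continuous.aestronglyMeasurable (by fun_prop))
        exact hg.aestronglyMeasurable.comp_fst.comp_snd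
      · refine AEStronglyMeasurable.mul ?_ (Continuous.aestronglyMeasurable (by fun_prop))
        exact hf.aestronglyMeasurable.comp_snd.comp_snd
    · simp only [Function.uncurry, hF, norm_mul, norm_cexp_I_mul_mul, mul_one, le_refl]
  have e1 : ∀ k, ∫ p, F k p ∂(halfVol.prod halfVol) = airyInt 0 τ (hline η k) *
        (halfFourier (fun t => Real.exp (-η * t) * g t) k *
          halfFourier (fun t => Real.exp (-η * t) * f t) k) := fun k => by
    rw [hF, integral_const_mul, halfFourier, halfFourier, ← integral_prod_mul]
  have e2 : ∀ s t : ℝ, ∫ k, F k (s, t)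
      = g s * (2 * Real.pi * (expKer (airyWt 0 τ) (s + t) * f t)) := fun s t => by
    have : ∀ k, F k (s, t) = g s * f t * airyInt 0 (τ + s + t : ℝ) (hline η k) := fun k => by
      rw [airyInt_zero_add, hF]
      ring
    simp only [this]
    rw [integral_const_mul, expKer_airyWt, airyFn_zero_congr one_pos hη, airyFn, add_assoc]
    have := Real.pi_ne_zero
    field_simp
  rw [← integral_congr_ae (Eventually.of_forall e1), integral_integral_swap hInt,
    integral_prod (fun p => ∫ k, F k p) hInt.integral_prod_right]
  simp only [e2, integral_const_mul]
  simp only [hankelFun]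
  rw [← integral_const_mul]
  refine integral_congr_ae (Eventually.of_forall fun s => ?_)
  have := Real.pi_ne_zero
  simp only
  field_simp

lemma integral_norm_sq (f : HalfL2) : ∫ t, ‖f t‖ ^ 2 ∂halfVol = ‖f‖ ^ 2 := by
  have h : ((∫ t, ‖f t‖ ^ 2 ∂halfVol : ℝ) : ℂ) = ((‖f‖ ^ 2 : ℝ) : ℂ) := by
    have := inner_self_eq_norm_sq_to_K (𝕜 := ℂ) f
    rw [L2.inner_def] at this
    push_cast
    refine Eq.trans ?_ this
    rw [← integral_complex_ofReal]
    refine integral_congr_ae (Eventually.of_forall fun t => ?_)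
    simp only
    rw [inner_self_eq_norm_sq_to_K]
    simp
  exact_mod_cast h

lemma integral_damped_sq_le {η : ℝ} (hη : 0 < η) (f : HalfL2) :
    ∫ t, ‖(Real.exp (-η * t) : ℂ) * f t‖ ^ 2 ∂halfVol ≤ ‖f‖ ^ 2 := by
  rw [← integral_norm_sq]
  refine integral_mono_of_nonneg (Eventually.of_forall fun t => by positivity)
    ((memLp_two_iff_integrable_sq_norm (Lp.aestronglyMeasurable f)).1 (Lp.memLp f)) ?_
  filter_upwards [ae_restrict_mem measurableSet_Ioi] with t ht
  have ht : 0 < t := ht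
  rw [norm_mul, Complex.norm_real, Real.norm_eq_abs, abs_of_pos (Real.exp_pos _)]
  have : Real.exp (-η * t) ≤ 1 := Real.exp_le_one_iff.2 (by nlinarith)
  gcongr
  nlinarith [norm_nonneg (f t)]

lemma norm_integral_mul_hankelFun_airyWt_le {η : ℝ} (hη : 0 < η) (τ : ℝ) (f g : HalfL2) :
    ‖∫ s, g s * hankelFun (airyWt 0 τ) f s ∂halfVol‖
      ≤ Real.exp (η ^ 3 / 3 - η * τ) * ((‖g‖ ^ 2 + ‖f‖ ^ 2) / 2) := by
  have hd : ∀ f : HalfL2, MemLp (fun t => (Real.exp (-η * t) : ℂ) * f t) 2 halfVol := fun f => by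
    refine MemLp.of_le (Lp.memLp f) ((Continuous.aestronglyMeasurable (by fun_prop)).mul
      (Lp.aestronglyMeasurable f)) ?_
    filter_upwards [ae_restrict_mem measurableSet_Ioi] with t ht
    have ht : 0 < t := ht
    rw [norm_mul, Complex.norm_real, Real.norm_eq_abs, abs_of_pos (Real.exp_pos _)]
    have : Real.exp (-η * t) ≤ 1 := Real.exp_le_one_iff.2 (by nlinarith)
    nlinarith [norm_nonneg (f t)]
  have hi : ∀ f : HalfL2, Integrable (fun t => (Real.exp (-η * t) : ℂ) * f t) halfVol :=
    fun f => (memLp_exp_neg_mul hη).integrable_mul (Lp.memLp f)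
  have hF : ∀ f : HalfL2, ∫ k : ℝ, Real.exp (-η * k ^ 2) *
      ‖halfFourier (fun t => Real.exp (-η * t) * f t) k‖ ^ 2 ≤ 2 * Real.pi * ‖f‖ ^ 2 := fun f => by
    refine (integral_gaussian_mul_halfFourier_sq_le hη (hi f) (hd f)).trans ?_
    gcongr
    exact integral_damped_sq_le hη f
  have hI := fun f : HalfL2 => integrable_gaussian_mul_halfFourier_sq hη (hi f)
  rw [integral_mul_hankelFun_airyWt hη, norm_mul]
  have hpi : ‖(1 / (2 * Real.pi) : ℂ)‖ = 1 / (2 * Real.pi) := by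
    rw [show (1 / (2 * Real.pi) : ℂ) = ((1 / (2 * Real.pi) : ℝ) : ℂ) by push_cast; rfl,
      Complex.norm_real, Real.norm_eq_abs, abs_of_pos (by positivity)]
  rw [hpi]
  have hbound := norm_integral_le_of_norm_le
    ((((hI g).add (hI f)).div_const 2).const_mul (Real.exp (η ^ 3 / 3 - η * τ)))
    (f := fun k : ℝ => airyInt 0 τ (hline η k) *
        (halfFourier (fun t => Real.exp (-η * t) * g t) k *
          halfFourier (fun t => Real.exp (-η * t) * f t) k))
    (Eventually.of_forall fun k => by
      rw [norm_mul, norm_mul, norm_airyInt_zero, mul_assoc]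
      refine mul_le_mul_of_nonneg_left ?_ (Real.exp_pos _).le
      simp only [Pi.add_apply]
      generalize ‖halfFourier (fun t => Real.exp (-η * t) * g t) k‖ = a
      generalize ‖halfFourier (fun t => Real.exp (-η * t) * f t) k‖ = b
      nlinarith [mul_nonneg (Real.exp_pos (-η * k ^ 2)).le (sq_nonneg (a - b))])
  simp only [Pi.add_apply] at hbound
  rw [integral_const_mul, integral_div, integral_add (hI g) (hI f)] at hbound
  calc _ ≤ 1 / (2 * Real.pi) * (Real.exp (η ^ 3 / 3 - η * τ) *
        ((2 * Real.pi * ‖g‖ ^ 2 + 2 * Real.pi * ‖f‖ ^ 2) / 2)) := by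
        gcongr
        refine hbound.trans ?_
        gcongr
        exacts [hF g, hF f]
    _ = _ := by
        have := Real.pi_ne_zero
        field_simp

lemma norm_hankel_airyWt_le_one (τ : ℝ) : ‖hankel (airyWt 0 τ)‖ ≤ 1 := by
  have hlim : ∀ f g : HalfL2, ‖∫ s, g s * hankelFun (airyWt 0 τ) f s ∂halfVol‖
      ≤ (‖g‖ ^ 2 + ‖f‖ ^ 2) / 2 := fun f g => by
    have ht : Tendsto (fun η : ℝ => Real.exp (η ^ 3 / 3 - η * τ) * ((‖g‖ ^ 2 + ‖f‖ ^ 2) / 2))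
        (nhdsWithin 0 (Set.Ioi 0)) (nhds ((‖g‖ ^ 2 + ‖f‖ ^ 2) / 2)) := by
      have hc : Continuous fun η : ℝ =>
        Real.exp (η ^ 3 / 3 - η * τ) * ((‖g‖ ^ 2 + ‖f‖ ^ 2) / 2) := by fun_prop
      simpa using (hc.tendsto 0).mono_left nhdsWithin_le_nhds
    refine ge_of_tendsto ht ?_
    filter_upwards [self_mem_nhdsWithin] with η hη
    exact norm_integral_mul_hankelFun_airyWt_le hη τ f g
  have hin : ∀ f g : HalfL2, ‖inner ℂ g (hankel (airyWt 0 τ) f)‖ ≤ (‖g‖ ^ 2 + ‖f‖ ^ 2) / 2 :=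
    fun f g => by
      rw [inner_hankel]
      have := hlim f (star g)
      have hs : ‖star g‖ ^ 2 = ‖g‖ ^ 2 := by
        rw [← integral_norm_sq, ← integral_norm_sq]
        refine integral_congr_ae ?_
        filter_upwards [Lp.coeFn_star g] with t ht
        rw [ht, Pi.star_apply, norm_star]
      rw [hs] at this
      refine le_trans (le_of_eq ?_) this
      congr 1
      refine integral_congr_ae ?_
      filter_upwards [Lp.coeFn_star g] with t ht
      rw [ht, Pi.star_apply]
  refine ContinuousLinearMap.opNorm_le_bound _ zero_le_one fun f => ?_
  rw [one_mul]
  set y := hankel (airyWt 0 τ) f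
  rcases eq_or_ne ‖y‖ 0 with h0 | h0
  · rw [h0]
    exact norm_nonneg f
  rcases eq_or_ne ‖f‖ 0 with hf | hf
  · rw [norm_eq_zero] at hf
    simp [y, hf]
  have hy : 0 < ‖y‖ := lt_of_le_of_ne (norm_nonneg _) h0.symm
  have hf : 0 < ‖f‖ := lt_of_le_of_ne (norm_nonneg _) hf.symm
  have := hin f (((‖f‖ / ‖y‖ : ℝ) : ℂ) • y)
  rw [inner_smul_left, norm_mul, norm_smul, Complex.conj_ofReal, Complex.norm_real,
    Real.norm_eq_abs, abs_of_pos (div_pos hf hy), inner_self_eq_norm_sq_to_K, norm_pow,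
    div_mul_cancel₀ _ h0] at this
  simp only [RCLike.norm_ofReal, abs_norm] at this
  rw [show ‖f‖ / ‖y‖ * ‖y‖ ^ 2 = ‖f‖ * ‖y‖ by field_simp] at this
  nlinarith

/-! ### Exponentially decaying functions and integration by parts -/

/-- Continuous functions that are `O (exp (-s))`. -/
def ExpDecay (f : ℝ → ℂ) : Prop := Continuous f ∧ ∃ C, ∀ s, ‖f s‖ ≤ C * Real.exp (-s)

lemma ExpDecay.memLp {f : ℝ → ℂ} (hf : ExpDecay f) : MemLp f 2 halfVol := by
  obtain ⟨hc, C, hC⟩ := hf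
  exact memLp_of_exp_bound hc.aestronglyMeasurable (Eventually.of_forall hC)

lemma ExpDecay.memLp_mul {f : ℝ → ℂ} (hf : ExpDecay f) :
    MemLp (fun t : ℝ => (t : ℂ) * f t) 2 halfVol := by
  obtain ⟨hc, C, hC⟩ := hf
  refine MemLp.of_le_mul (c := 2 * C) (memLp_exp_neg_mul (η := 1 / 2) (by norm_num))
    (Continuous.aestronglyMeasurable (by fun_prop)) ?_
  filter_upwards [ae_restrict_mem measurableSet_Ioi] with t ht
  have ht : 0 < t := ht
  have hC0 : 0 ≤ C := by simpa using (norm_nonneg _).trans (hC 0)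
  rw [norm_mul, Complex.norm_real, Complex.norm_real, Real.norm_eq_abs, Real.norm_eq_abs,
    abs_of_pos (Real.exp_pos _), abs_of_pos ht]
  have h1 : t ≤ 2 * Real.exp (1 / 2 * t) := by linarith [Real.add_one_le_exp (1 / 2 * t)]
  calc t * ‖f t‖ ≤ 2 * Real.exp (1 / 2 * t) * (C * Real.exp (-t)) := by
        gcongr
        exact hC t
    _ = 2 * C * (Real.exp (1 / 2 * t) * Real.exp (-t)) := by ring
    _ = _ := by rw [← Real.exp_add]; congr 2; ring

lemma ExpDecay.integrable_mul {f g : ℝ → ℂ} (hf : ExpDecay f) (hg : ExpDecay g) :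
    Integrable (fun t => f t * g t) halfVol := hf.memLp.integrable_mul hg.memLp

lemma ExpDecay.tendsto {f : ℝ → ℂ} (hf : ExpDecay f) : Tendsto f atTop (nhds 0) := by
  obtain ⟨hc, C, hC⟩ := hf
  refine squeeze_zero_norm hC ?_
  simpa using Real.tendsto_exp_neg_atTop_nhds_zero.const_mul C

lemma ExpDecay.add {f g : ℝ → ℂ} (hf : ExpDecay f) (hg : ExpDecay g) :
    ExpDecay fun s => f s + g s := by
  obtain ⟨hc, C, hC⟩ := hf
  obtain ⟨hd, D, hD⟩ := hg
  refine ⟨hc.add hd, C + D, fun s => (norm_add_le _ _).trans ?_⟩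
  rw [add_mul]
  exact add_le_add (hC s) (hD s)

lemma ExpDecay.const_mul {f : ℝ → ℂ} (hf : ExpDecay f) (c : ℂ) : ExpDecay fun s => c * f s := by
  obtain ⟨hc, C, hC⟩ := hf
  refine ⟨hc.const_mul c, ‖c‖ * C, fun s => ?_⟩
  rw [norm_mul, mul_assoc]
  exact mul_le_mul_of_nonneg_left (hC s) (norm_nonneg c)

lemma ExpDecay.comp_add_left {f : ℝ → ℂ} (hf : ExpDecay f) (τ : ℝ) :
    ExpDecay fun s => f (τ + s) := by
  obtain ⟨hc, C, hC⟩ := hf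
  refine ⟨by fun_prop, C * Real.exp (-τ), fun s => (hC _).trans_eq ?_⟩
  rw [neg_add, Real.exp_add, mul_assoc]

lemma ExpDecay.integral_deriv_mul {f f' g g' : ℝ → ℂ} (hf : ExpDecay f) (hf' : ExpDecay f')
    (hg : ExpDecay g) (hg' : ExpDecay g') (hdf : ∀ s, HasDerivAt f (f' s) s)
    (hdg : ∀ s, HasDerivAt g (g' s) s) :
    ∫ s, f' s * g s ∂halfVol = -(f 0 * g 0) - ∫ s, f s * g' s ∂halfVol := by
  have hlim : Tendsto (f * g) atTop (nhds 0) := by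
    have := hf.tendsto.mul hg.tendsto
    rwa [zero_mul] at this
  have hlim0 : Tendsto (f * g) (nhdsWithin 0 (Set.Ioi 0)) (nhds (f 0 * g 0)) :=
    ((hf.1.mul hg.1).tendsto 0).mono_left nhdsWithin_le_nhds
  have := integral_Ioi_mul_deriv_eq_deriv_mul (u := f) (v := g) (u' := f') (v' := g') (a := 0)
    (fun x _ => hdf x) (fun x _ => hdg x) (hf.integrable_mul hg') (hf'.integrable_mul hg)
    hlim0 hlim
  rw [this]
  ring

lemma expDecay_airyFn (m : ℕ) : ExpDecay (airyFn m 1) :=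
  ⟨continuous_airyFn m, airyBound m, norm_airyFn_one_le m⟩

/-! ### Smooth representatives of solutions of the Hankel integral equations -/

/-- The smooth function `x ↦ c * Ai⁽ᵐ⁾ x + κ * ∫ Ai⁽ᵐ⁾ (x + t) * g t`. -/
def airyExt (c κ : ℂ) (g : HalfL2) (m : ℕ) (x : ℝ) : ℂ :=
  c * airyFn m 1 x + κ * kerPair (airyWt m x) g

lemma hasDerivAt_airyExt (c κ : ℂ) (g : HalfL2) (m : ℕ) (x : ℝ) :
    HasDerivAt (airyExt c κ g m) (airyExt c κ g (m + 1) x) x := by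
  refine ((hasDerivAt_airyFn m one_pos x).const_mul c).add (HasDerivAt.const_mul κ ?_)
  exact ((kerPair.flip g).restrictScalars ℝ).hasFDerivAt.comp_hasDerivAt x (hasDerivAt_airyWt m x)

lemma norm_kerPair_airyWt_le (g : HalfL2) (m : ℕ) (x : ℝ) :
    ‖kerPair (airyWt m x) g‖ ≤ airyBound m * ‖g‖ * Real.exp (-x) := by
  refine (norm_integral_expKer_mul_le _ _).trans ?_
  calc _ ≤ airyBound m * Real.exp (-x) * ‖g‖ := by gcongr; exact norm_airyWt_le m x
    _ = _ := by ring

lemma expDecay_airyExt (c κ : ℂ) (g : HalfL2) (m : ℕ) : ExpDecay (airyExt c κ g m) := by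
  refine ((expDecay_airyFn m).const_mul c).add (ExpDecay.const_mul ⟨?_, _,
    norm_kerPair_airyWt_le g m⟩ κ)
  refine (kerPair.flip g).continuous.comp (continuous_iff_continuousAt.2 fun x =>
    (hasDerivAt_airyWt m x).continuousAt)

lemma kerPair_airyWt_add (g : HalfL2) (m : ℕ) (τ s : ℝ) :
    kerPair (airyWt m (τ + s)) g = hankelFun (airyWt m τ) g s := by
  rw [hankelFun_eq_kerPair, shiftWt_airyWt]

lemma coeFn_smul_kerL2_add_smul_hankel (c κ : ℂ) (g : HalfL2) (m : ℕ) (τ : ℝ) :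
    c • kerL2 (airyWt m τ) + κ • hankel (airyWt m τ) g
      =ᵐ[halfVol] fun s => airyExt c κ g m (τ + s) := by
  filter_upwards [Lp.coeFn_add (c • kerL2 (airyWt m τ)) (κ • hankel (airyWt m τ) g),
    Lp.coeFn_smul c (kerL2 (airyWt m τ)), Lp.coeFn_smul κ (hankel (airyWt m τ) g),
    coeFn_kerL2 (airyWt m τ), coeFn_hankel (airyWt m τ) g] with s h1 h2 h3 h4 h5
  rw [h1, Pi.add_apply, h2, h3, Pi.smul_apply, Pi.smul_apply, h4, h5, expKer_airyWt, airyExt,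
    kerPair_airyWt_add]
  rfl

lemma coeFn_hankel_system {c κ : ℂ} {τ : ℝ} {f g : HalfL2}
    (h : f = c • kerL2 (airyWt 0 τ) + κ • hankel (airyWt 0 τ) g) :
    f =ᵐ[halfVol] fun s => airyExt c κ g 0 (τ + s) := by
  rw [h]
  exact coeFn_smul_kerL2_add_smul_hankel c κ g 0 τ

lemma hankelFun_airyWt_succ (m : ℕ) (τ s : ℝ) {f f' : ℝ → ℂ} (hf : ExpDecay f)
    (hf' : ExpDecay f') (hd : ∀ s, HasDerivAt f (f' s) s) :
    hankelFun (airyWt (m + 1) τ) f s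
      = -(airyFn m 1 (τ + s) * f 0) - hankelFun (airyWt m τ) f' s := by
  have := ExpDecay.integral_deriv_mul ((expDecay_airyFn m).comp_add_left (τ + s))
    ((expDecay_airyFn (m + 1)).comp_add_left (τ + s)) hf hf'
    (fun t => (hasDerivAt_airyFn m one_pos _).comp_const_add (τ + s) t) hd
  simp only [hankelFun, expKer_airyWt, ← add_assoc]
  rw [this, add_zero]

lemma hankelFun_airyWt_two (τ s : ℝ) {f : ℝ → ℂ} (hf : ExpDecay f) :
    hankelFun (airyWt 2 τ) f s
      = (τ + s) * hankelFun (airyWt 0 τ) f s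
        + hankelFun (airyWt 0 τ) (fun t : ℝ => (t : ℂ) * f t) s := by
  have ha := (expDecay_airyFn 0).comp_add_left (τ + s)
  have hInt : Integrable (fun t : ℝ => airyFn 0 1 (τ + s + t) * (t * f t)) halfVol :=
    ha.memLp.integrable_mul hf.memLp_mul
  simp only [hankelFun, expKer_airyWt, ← add_assoc]
  rw [← integral_const_mul, ← integral_add ((ha.integrable_mul hf).const_mul _) hInt]
  refine integral_congr_ae (Eventually.of_forall fun t => ?_)
  simp only
  rw [airyFn_two one_pos]
  push_cast
  ring

/-- Smooth solutions `(P, Q)`, with derivatives `P m`, `Q m`, of the Hankel system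
`P = κ Ai + κ 𝒜 Q`, `Q = κ 𝒜 P`. -/
structure HankelSystem (κ : ℂ) (τ : ℝ) (P Q : ℕ → ℝ → ℂ) : Prop where
  decay_left : ∀ m, ExpDecay (P m)
  decay_right : ∀ m, ExpDecay (Q m)
  deriv_left : ∀ m s, HasDerivAt (P m) (P (m + 1) s) s
  deriv_right : ∀ m s, HasDerivAt (Q m) (Q (m + 1) s) s
  eq_left : ∀ m s, P m s = κ * airyFn m 1 (τ + s) + κ * hankelFun (airyWt m τ) (Q 0) s
  eq_right : ∀ m s, Q m s = κ * hankelFun (airyWt m τ) (P 0) s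

lemma hankelSystem_airyExt {κ : ℂ} {τ : ℝ} {p q : HalfL2}
    (hp : p = κ • kerL2 (airyWt 0 τ) + κ • hankel (airyWt 0 τ) q)
    (hq : q = κ • hankel (airyWt 0 τ) p) :
    HankelSystem κ τ (fun m s => airyExt κ κ q m (τ + s)) (fun m s => airyExt 0 κ p m (τ + s)) where
  decay_left m := (expDecay_airyExt κ κ q m).comp_add_left τ
  decay_right m := (expDecay_airyExt 0 κ p m).comp_add_left τ
  deriv_left m s := (hasDerivAt_airyExt κ κ q m (τ + s)).comp_const_add τ s
  deriv_right m s := (hasDerivAt_airyExt 0 κ p m (τ + s)).comp_const_add τ s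
  eq_left m s := by
    have hq' : q = (0 : ℂ) • kerL2 (airyWt 0 τ) + κ • hankel (airyWt 0 τ) p := by
      rw [zero_smul, zero_add, ← hq]
    rw [airyExt, kerPair_airyWt_add, hankelFun_congr _ (coeFn_hankel_system hq')]
  eq_right m s := by
    rw [airyExt, kerPair_airyWt_add, hankelFun_congr _ (coeFn_hankel_system hp), zero_mul, zero_add]

namespace HankelSystem

variable {κ : ℂ} {τ : ℝ} {P Q : ℕ → ℝ → ℂ}

lemma right_one (h : HankelSystem κ τ P Q) (s : ℝ) :
    Q 1 s = -(κ * airyFn 0 1 (τ + s) * P 0 0) - κ * hankelFun (airyWt 0 τ) (P 1) s := by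
  rw [h.eq_right 1, hankelFun_airyWt_succ 0 τ s (h.decay_left 0) (h.decay_left 1)
    (h.deriv_left 0)]
  ring

lemma integral_mul_deriv_self {f f' : ℝ → ℂ} (hf : ExpDecay f) (hf' : ExpDecay f')
    (hd : ∀ s, HasDerivAt f (f' s) s) : ∫ s, f s * f' s ∂halfVol = -(f 0 ^ 2 / 2) := by
  have := hf.integral_deriv_mul hf' hf hf' hd hd
  simp only [mul_comm (f' _) (f _)] at this
  linear_combination this / 2

lemma hankelFun_left_one_zero (h : HankelSystem κ τ P Q) :
    κ * hankelFun (airyWt 0 τ) (P 1) 0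
      = (P 0 0 ^ 2 - Q 0 0 ^ 2) / 2 - κ * airyFn 0 1 τ * P 0 0 := by
  have ha := (expDecay_airyFn 0).comp_add_left τ
  have e1 : κ * hankelFun (airyWt 0 τ) (P 1) 0
      = ∫ t, P 0 t * P 1 t ∂halfVol - κ * ∫ t, P 1 t * hankelFun (airyWt 0 τ) (Q 0) t ∂halfVol := by
    have : ∀ t, κ * (P 1 t * hankelFun (airyWt 0 τ) (Q 0) t)
        = P 0 t * P 1 t - κ * (airyFn 0 1 (τ + t) * P 1 t) := fun t => by
      rw [h.eq_left 0]
      ring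
    rw [← integral_const_mul]
    simp only [this]
    rw [integral_sub ((h.decay_left 0).integrable_mul (h.decay_left 1))
      ((ha.integrable_mul (h.decay_left 1)).const_mul κ), integral_const_mul]
    simp only [hankelFun, expKer_airyWt, zero_add, sub_sub_cancel]
  have e2 : κ * ∫ t, P 1 t * hankelFun (airyWt 0 τ) (Q 0) t ∂halfVol
      = -(∫ t, Q 0 t * Q 1 t ∂halfVol) - P 0 0 * (κ * hankelFun (airyWt 0 τ) (Q 0) 0) := by
    have : ∀ t, κ * (Q 0 t * hankelFun (airyWt 0 τ) (P 1) t)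
        = -(Q 0 t * Q 1 t) - P 0 0 * (κ * (airyFn 0 1 (τ + t) * Q 0 t)) := fun t => by
      rw [h.right_one]
      ring
    have hInt : Integrable (fun t => -(Q 0 t * Q 1 t)) halfVol :=
      ((h.decay_right 0).integrable_mul (h.decay_right 1)).neg
    rw [hankelFun_symm _ (h.decay_right 0).memLp (h.decay_left 1).memLp, ← integral_const_mul]
    simp only [this]
    rw [integral_sub hInt (((ha.integrable_mul (h.decay_right 0)).const_mul κ).const_mul _),
      integral_neg, integral_const_mul, integral_const_mul]
    simp only [hankelFun, expKer_airyWt, zero_add]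
  have e3 := h.eq_left 0 0
  rw [add_zero] at e3
  rw [e1, e2, integral_mul_deriv_self (h.decay_left 0) (h.decay_left 1) (h.deriv_left 0),
    integral_mul_deriv_self (h.decay_right 0) (h.decay_right 1) (h.deriv_right 0)]
  linear_combination -P 0 0 * e3

lemma right_one_zero (h : HankelSystem κ τ P Q) : Q 1 0 = (Q 0 0 ^ 2 - P 0 0 ^ 2) / 2 := by
  rw [h.right_one, h.hankelFun_left_one_zero, add_zero]
  ring

lemma left_two (h : HankelSystem κ τ P Q) (s : ℝ) :
    P 2 s = (τ + s) * P 0 s + κ * hankelFun (airyWt 0 τ) (fun t : ℝ => (t : ℂ) * Q 0 t) s := by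
  rw [h.eq_left 2, hankelFun_airyWt_two τ s (h.decay_right 0), h.eq_left 0, airyFn_two one_pos]
  push_cast
  ring

lemma right_two (h : HankelSystem κ τ P Q) (s : ℝ) :
    Q 2 s = (τ + s) * Q 0 s + κ * hankelFun (airyWt 0 τ) (fun t : ℝ => (t : ℂ) * P 0 t) s := by
  rw [h.eq_right 2, hankelFun_airyWt_two τ s (h.decay_left 0), h.eq_right 0]
  ring

lemma hankelFun_mul_right_zero (h : HankelSystem κ τ P Q) :
    κ * hankelFun (airyWt 0 τ) (fun t : ℝ => (t : ℂ) * Q 0 t) 0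
      = Q 0 0 * P 1 0 - P 0 0 * Q 1 0 := by
  have ha := (expDecay_airyFn 0).comp_add_left τ
  have hP := h.decay_left
  have hQ := h.decay_right
  set f : ℝ → ℂ := fun t => (t : ℂ) * P 0 t with hf
  set g : ℝ → ℂ := fun t => (t : ℂ) * Q 0 t with hg
  have iW : Integrable (fun t : ℝ => (t : ℂ) * P 0 t * Q 0 t) halfVol :=
    (hP 0).memLp_mul.integrable_mul (hQ 0).memLp
  have iZ := ((hP 0).integrable_mul (hQ 0)).const_mul (τ : ℂ)
  have e1 : κ * ∫ t, Q 0 t * hankelFun (airyWt 0 τ) g t ∂halfVol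
      = ∫ t, P 2 t * Q 0 t ∂halfVol - τ * ∫ t, P 0 t * Q 0 t ∂halfVol
        - ∫ t : ℝ, (t : ℂ) * P 0 t * Q 0 t ∂halfVol := by
    have hInt : Integrable (fun t => P 2 t * Q 0 t - τ * (P 0 t * Q 0 t)) halfVol :=
      ((hP 2).integrable_mul (hQ 0)).sub iZ
    rw [← integral_const_mul, ← integral_const_mul,
      ← integral_sub ((hP 2).integrable_mul (hQ 0)) iZ, ← integral_sub hInt iW]
    refine integral_congr_ae (Eventually.of_forall fun t => ?_)
    simp only [h.left_two]
    ring
  have e2 : κ * ∫ t, P 0 t * hankelFun (airyWt 0 τ) f t ∂halfVol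
      = ∫ t, Q 2 t * P 0 t ∂halfVol - τ * ∫ t, P 0 t * Q 0 t ∂halfVol
        - ∫ t : ℝ, (t : ℂ) * P 0 t * Q 0 t ∂halfVol := by
    have hInt : Integrable (fun t => Q 2 t * P 0 t - τ * (P 0 t * Q 0 t)) halfVol :=
      ((hQ 2).integrable_mul (hP 0)).sub iZ
    rw [← integral_const_mul, ← integral_const_mul,
      ← integral_sub ((hQ 2).integrable_mul (hP 0)) iZ, ← integral_sub hInt iW]
    refine integral_congr_ae (Eventually.of_forall fun t => ?_)
    simp only [h.right_two]
    ring
  have e3 : κ * ∫ t, Q 0 t * hankelFun (airyWt 0 τ) g t ∂halfVol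
      = ∫ t : ℝ, (t : ℂ) * P 0 t * Q 0 t ∂halfVol - κ * hankelFun (airyWt 0 τ) g 0 := by
    have iN : Integrable (fun t => airyFn 0 1 (τ + t) * g t) halfVol :=
      ha.memLp.integrable_mul (hQ 0).memLp_mul
    rw [hankelFun_symm _ (hQ 0).memLp_mul (hQ 0).memLp, hankelFun]
    simp only [expKer_airyWt, zero_add]
    rw [← integral_const_mul, ← integral_const_mul, ← integral_sub iW (iN.const_mul κ)]
    refine integral_congr_ae (Eventually.of_forall fun t => ?_)
    simp only [h.eq_left 0, hg]
    ring
  have e4 : κ * ∫ t, P 0 t * hankelFun (airyWt 0 τ) f t ∂halfVol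
      = ∫ t : ℝ, (t : ℂ) * P 0 t * Q 0 t ∂halfVol := by
    rw [hankelFun_symm _ (hP 0).memLp_mul (hP 0).memLp, ← integral_const_mul]
    refine integral_congr_ae (Eventually.of_forall fun t => ?_)
    simp only [h.eq_right 0]
    ring
  have e5 := (hP 1).integral_deriv_mul (hP 2) (hQ 0) (hQ 1) (h.deriv_left 1) (h.deriv_right 0)
  have e6 := (hQ 1).integral_deriv_mul (hQ 2) (hP 0) (hP 1) (h.deriv_right 1) (h.deriv_left 0)
  simp only [mul_comm (Q 1 _) (P 1 _)] at e6
  linear_combination e3 - e1 - e4 + e2 - e5 + e6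

lemma left_two_zero (h : HankelSystem κ τ P Q) :
    P 2 0 = τ * P 0 0 + Q 0 0 * P 1 0 - P 0 0 * Q 1 0 := by
  rw [h.left_two, h.hankelFun_mul_right_zero]
  push_cast
  ring

end HankelSystem

/-! ### The solution -/

/-- `κ` avoids the rays `(-∞, -1]` and `[1, ∞)`. -/
def AvoidsRays (κ : ℂ) : Prop := ∀ x : ℝ, (x ≤ -1 ∨ 1 ≤ x) → κ ≠ (x : ℂ)

lemma AvoidsRays.neg {κ : ℂ} (hκ : AvoidsRays κ) : AvoidsRays (-κ) := fun x hx h =>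
  hκ (-x) (by rcases hx with hx | hx <;> [right; left] <;> linarith) (by
    rw [Complex.ofReal_neg, ← h, neg_neg])

lemma AvoidsRays.isUnit_one_sub_smul {κ : ℂ} (hκ : AvoidsRays κ) {T : HalfL2 →L[ℂ] HalfL2}
    (hT : IsSelfAdjoint T) (h1 : ‖T‖ ≤ 1) : IsUnit (1 - κ • T) := by
  rcases eq_or_ne κ 0 with rfl | h0
  · simp
  have hspec : κ⁻¹ ∉ spectrum ℂ T := fun hmem => by
    have hre := hT.mem_spectrum_eq_re hmem
    have hle : ‖κ⁻¹‖ ≤ 1 := (spectrum.norm_le_norm_mul_of_mem hmem).trans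
      ((mul_le_mul h1 ContinuousLinearMap.norm_id_le (norm_nonneg _) zero_le_one).trans_eq
        (one_mul 1))
    set r := (κ⁻¹).re
    have hκr : κ = (r⁻¹ : ℝ) := by
      rw [Complex.ofReal_inv, ← hre, inv_inv]
    have hr0 : r ≠ 0 := fun h => by
      rw [h] at hκr
      simp at hκr
      exact h0 hκr
    rw [hre, Complex.norm_real, Real.norm_eq_abs] at hle
    have h1 : 1 ≤ |r⁻¹| := by
      rw [abs_inv]
      exact (one_le_inv₀ (abs_pos.2 hr0)).2 hle
    exact hκ r⁻¹ (by rcases le_abs'.1 h1 with h | h <;> [left; right] <;> exact h) hκr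
  rw [spectrum.notMem_iff] at hspec
  have : 1 - κ • T = κ • (algebraMap ℂ (HalfL2 →L[ℂ] HalfL2) κ⁻¹ - T) := by
    rw [smul_sub, Algebra.algebraMap_eq_smul_one, smul_smul, mul_inv_cancel₀ h0, one_smul]
  rw [this]
  exact (hspec.smul (Units.mk0 κ h0))

/-- The operator `1 - κ² 𝒜²`, where `𝒜` is the Airy Hankel operator at `τ`. -/
def airyRes (κ : ℂ) (τ : ℝ) : HalfL2 →L[ℂ] HalfL2 :=
  (1 - κ • hankel (airyWt 0 τ)) * (1 - (-κ) • hankel (airyWt 0 τ))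

lemma airyRes_apply (κ : ℂ) (τ : ℝ) (f : HalfL2) :
    airyRes κ τ f = f - κ • hankel (airyWt 0 τ) (κ • hankel (airyWt 0 τ) f) := by
  rw [airyRes, neg_smul, sub_neg_eq_add]
  simp only [mul_apply_eq_comp, sub_apply, add_apply, smul_apply,
    one_apply_eq_self, map_add, map_smul]
  module

/-- The first component of the solution of the Hankel system. -/
def hankelLeft (κ : ℂ) (τ : ℝ) : HalfL2 := Ring.inverse (airyRes κ τ) (κ • kerL2 (airyWt 0 τ))

/-- The second component of the solution of the Hankel system. -/
def hankelRight (κ : ℂ) (τ : ℝ) : HalfL2 := κ • hankel (airyWt 0 τ) (hankelLeft κ τ)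

section

variable {A A' : ℝ → ℝ} {κ : ℂ}

lemma IsAiry.star_airyWt (hA : IsAiry A A') (τ : ℝ) : star (airyWt 0 τ) = airyWt 0 τ := by
  ext x
  rw [BoundedContinuousFunction.star_apply, airyWt_apply, ← (hA.eq_airyFn one_pos _).1,
    ← Complex.ofReal_mul, Complex.star_def, Complex.conj_ofReal]

lemma IsAiry.isUnit_airyRes (hA : IsAiry A A') (hκ : AvoidsRays κ) (τ : ℝ) :
    IsUnit (airyRes κ τ) := by
  have hs := isSelfAdjoint_hankel (hA.star_airyWt τ)
  have hn := norm_hankel_airyWt_le_one τ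
  exact (hκ.isUnit_one_sub_smul hs hn).mul (hκ.neg.isUnit_one_sub_smul hs hn)

lemma IsAiry.hankelLeft_eq (hA : IsAiry A A') (hκ : AvoidsRays κ) (τ : ℝ) :
    hankelLeft κ τ
      = κ • kerL2 (airyWt 0 τ) + κ • hankel (airyWt 0 τ) (hankelRight κ τ) := by
  have h : airyRes κ τ (hankelLeft κ τ) = κ • kerL2 (airyWt 0 τ) := by
    rw [hankelLeft, ← mul_apply_eq_comp,
      Ring.mul_inverse_cancel _ (hA.isUnit_airyRes hκ τ), one_apply_eq_self]
  rw [airyRes_apply] at h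
  rw [hankelRight, ← h]
  abel

lemma IsAiry.airyRes_injective (hA : IsAiry A A') (hκ : AvoidsRays κ) (τ : ℝ) {f : HalfL2}
    (h : airyRes κ τ f = 0) : f = 0 := by
  have := congrArg (⇑(Ring.inverse (airyRes κ τ))) h
  rwa [← mul_apply_eq_comp, Ring.inverse_mul_cancel _ (hA.isUnit_airyRes hκ τ),
    one_apply_eq_self, map_zero] at this

lemma hasDerivAt_hankel_airyWt (m : ℕ) (τ : ℝ) :
    HasDerivAt (fun τ => hankel (airyWt m τ)) (hankel (airyWt (m + 1) τ)) τ :=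
  (hankel.restrictScalars ℝ).hasFDerivAt.comp_hasDerivAt τ (hasDerivAt_airyWt m τ)

lemma hasDerivAt_kerL2_airyWt (m : ℕ) (τ : ℝ) :
    HasDerivAt (fun τ => kerL2 (airyWt m τ)) (kerL2 (airyWt (m + 1) τ)) τ :=
  (kerL2.restrictScalars ℝ).hasFDerivAt.comp_hasDerivAt τ (hasDerivAt_airyWt m τ)

lemma hasDerivAt_kerPair_airyWt (m : ℕ) (τ : ℝ) :
    HasDerivAt (fun τ => kerPair (airyWt m τ)) (kerPair (airyWt (m + 1) τ)) τ :=
  (kerPair.restrictScalars ℝ).hasFDerivAt.comp_hasDerivAt τ (hasDerivAt_airyWt m τ)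

lemma hasDerivAt_clm_apply {E F : Type*} [NormedAddCommGroup E] [NormedSpace ℂ E]
    [NormedAddCommGroup F] [NormedSpace ℂ F] {T : ℝ → E →L[ℂ] F} {T' : E →L[ℂ] F} {f : ℝ → E}
    {f' : E} {τ : ℝ} (hT : HasDerivAt T T' τ) (hf : HasDerivAt f f' τ) :
    HasDerivAt (fun τ => T τ (f τ)) (T' (f τ) + T τ f') τ := by
  have h := ((ContinuousLinearMap.restrictScalarsL ℂ E F ℝ ℝ).hasFDerivAt.comp_hasDerivAt τ hT)
  exact h.clm_apply hf

lemma IsAiry.differentiableAt_hankelLeft (hA : IsAiry A A') (hκ : AvoidsRays κ) (τ : ℝ) :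
    DifferentiableAt ℝ (hankelLeft κ) τ := by
  have hT := (hasDerivAt_hankel_airyWt 0 τ).differentiableAt
  have hR : DifferentiableAt ℝ (airyRes κ) τ :=
    ((differentiableAt_const _).sub (hT.const_smul κ)).mul
      ((differentiableAt_const _).sub (hT.const_smul (-κ)))
  have hinv : DifferentiableAt ℝ (fun τ => Ring.inverse (airyRes κ τ)) τ :=
    hR.inverse (hA.isUnit_airyRes hκ τ)
  exact (hasDerivAt_clm_apply hinv.hasDerivAt
    ((hasDerivAt_kerL2_airyWt 0 τ).const_smul κ)).differentiableAt

/-! ### Derivatives of the solution -/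

/-- The `L²` class of the derivative of the smooth representative of `hankelLeft κ τ`. -/
def hankelLeftOne (κ : ℂ) (τ : ℝ) : HalfL2 :=
  κ • kerL2 (airyWt 1 τ) + κ • hankel (airyWt 1 τ) (hankelRight κ τ)

lemma IsAiry.hankelSystem (hA : IsAiry A A') (hκ : AvoidsRays κ) (τ : ℝ) :
    HankelSystem κ τ (fun m s => airyExt κ κ (hankelRight κ τ) m (τ + s))
      (fun m s => airyExt 0 κ (hankelLeft κ τ) m (τ + s)) :=
  hankelSystem_airyExt (hA.hankelLeft_eq hκ τ) rfl

lemma IsAiry.hankel_one_hankelLeft (hA : IsAiry A A') (hκ : AvoidsRays κ) (τ : ℝ) :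
    κ • hankel (airyWt 1 τ) (hankelLeft κ τ) + κ • hankel (airyWt 0 τ) (hankelLeftOne κ τ)
      = -(airyExt κ κ (hankelRight κ τ) 0 τ • (κ • kerL2 (airyWt 0 τ))) := by
  have h := hA.hankelSystem hκ τ
  have e1 := coeFn_hankel_system (hA.hankelLeft_eq hκ τ)
  have e2 := coeFn_smul_kerL2_add_smul_hankel κ κ (hankelRight κ τ) 1 τ
  refine Lp.ext ?_
  filter_upwards [Lp.coeFn_add (κ • hankel (airyWt 1 τ) (hankelLeft κ τ))
      (κ • hankel (airyWt 0 τ) (hankelLeftOne κ τ)),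
    Lp.coeFn_smul κ (hankel (airyWt 1 τ) (hankelLeft κ τ)),
    Lp.coeFn_smul κ (hankel (airyWt 0 τ) (hankelLeftOne κ τ)),
    coeFn_hankel (airyWt 1 τ) (hankelLeft κ τ), coeFn_hankel (airyWt 0 τ) (hankelLeftOne κ τ),
    Lp.coeFn_neg (airyExt κ κ (hankelRight κ τ) 0 τ • (κ • kerL2 (airyWt 0 τ))),
    Lp.coeFn_smul (airyExt κ κ (hankelRight κ τ) 0 τ) (κ • kerL2 (airyWt 0 τ)),
    Lp.coeFn_smul κ (kerL2 (airyWt 0 τ)), coeFn_kerL2 (airyWt 0 τ)]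
    with s h1 h2 h3 h4 h5 h6 h7 h8 h9
  rw [h1, Pi.add_apply, h2, h3, Pi.smul_apply, Pi.smul_apply, h4, h5, h6, Pi.neg_apply, h7,
    Pi.smul_apply, h8, Pi.smul_apply, h9, expKer_airyWt, hankelFun_congr _ e1,
    hankelLeftOne, hankelFun_congr _ e2,
    hankelFun_airyWt_succ 0 τ s (h.decay_left 0) (h.decay_left 1) (h.deriv_left 0)]
  simp only [smul_eq_mul, add_zero]
  ring

lemma IsAiry.hasDerivAt_hankel (hA : IsAiry A A') (hκ : AvoidsRays κ) (τ : ℝ) :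
    HasDerivAt (hankelLeft κ) (hankelLeftOne κ τ
        - airyExt κ κ (hankelRight κ τ) 0 τ • hankelRight κ τ) τ ∧
      HasDerivAt (hankelRight κ) (-(airyExt κ κ (hankelRight κ τ) 0 τ • hankelLeft κ τ)) τ := by
  obtain ⟨p', hp⟩ : ∃ p', HasDerivAt (hankelLeft κ) p' τ :=
    ⟨_, (hA.differentiableAt_hankelLeft hκ τ).hasDerivAt⟩
  have hT := hasDerivAt_hankel_airyWt 0 τ
  have hq := (hasDerivAt_clm_apply hT hp).const_smul κ
  have hp2 := ((hasDerivAt_kerL2_airyWt 0 τ).const_smul κ).add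
    ((hasDerivAt_clm_apply hT hq).const_smul κ)
  have hq' : HasDerivAt (hankelRight κ) _ τ := hq
  have e : p' = _ := hp.unique (hp2.congr_of_eventuallyEq
    (Eventually.of_forall fun τ => hA.hankelLeft_eq hκ τ))
  have h1 := hA.hankel_one_hankelLeft hκ τ
  set u := airyExt κ κ (hankelRight κ τ) 0 τ
  set T := hankel (airyWt 0 τ)
  set T₁ := hankel (airyWt 1 τ)
  set q := hankelRight κ τ
  have hL := hA.hankelLeft_eq hκ τ
  have hR : q = κ • T (hankelLeft κ τ) := rfl
  have hX : p' = hankelLeftOne κ τ - u • q := by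
    rw [← sub_eq_zero]
    refine hA.airyRes_injective hκ τ ?_
    have e' : p' = hankelLeftOne κ τ + κ • T (κ • T₁ (hankelLeft κ τ) + κ • T p') := by
      rw [← smul_add, hankelLeftOne, add_assoc, ← smul_add]
      exact e
    have h2 := congrArg (κ • T) h1
    have h3 := congrArg (κ • T) hL
    rw [airyRes_apply]
    simp only [smul_apply, map_add, map_sub, map_smul, map_neg] at e' h2 h3 ⊢
    linear_combination (norm := module) e' + h2 + u • hR + u • h3
  refine ⟨hX ▸ hp, hq'.congr_deriv ?_⟩
  rw [hX, map_sub, map_smul]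
  linear_combination (norm := module) h1 + u • hL

lemma airyExt_zero_left (κ : ℂ) (g : HalfL2) (m : ℕ) (x : ℝ) :
    airyExt 0 κ g m x = κ * kerPair (airyWt m x) g := by
  rw [airyExt, zero_mul, zero_add]

lemma hasDerivAt_airyExt_of_hasDerivAt (c κ : ℂ) (m : ℕ) {g : ℝ → HalfL2} {g' : HalfL2} {τ : ℝ}
    (hg : HasDerivAt g g' τ) :
    HasDerivAt (fun τ => airyExt c κ (g τ) m τ)
      (airyExt c κ (g τ) (m + 1) τ + κ * kerPair (airyWt m τ) g') τ := by
  have := ((hasDerivAt_airyFn m one_pos τ).const_mul c).add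
    ((hasDerivAt_clm_apply (hasDerivAt_kerPair_airyWt m τ) hg).const_mul κ)
  refine this.congr_deriv ?_
  simp only [airyExt]
  ring

lemma IsAiry.hasDerivAt_solution (hA : IsAiry A A') (hκ : AvoidsRays κ) (τ : ℝ) :
    HasDerivAt (fun τ => airyExt κ κ (hankelRight κ τ) 0 τ)
      (airyExt κ κ (hankelRight κ τ) 1 τ
        - airyExt κ κ (hankelRight κ τ) 0 τ * airyExt 0 κ (hankelLeft κ τ) 0 τ) τ := by
  refine (hasDerivAt_airyExt_of_hasDerivAt κ κ 0 (hA.hasDerivAt_hankel hκ τ).2).congr_deriv ?_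
  rw [map_neg, map_smul, smul_eq_mul, airyExt_zero_left]
  ring

lemma IsAiry.hasDerivAt_airyExt_left (hA : IsAiry A A') (hκ : AvoidsRays κ) (τ : ℝ) :
    HasDerivAt (fun τ => airyExt 0 κ (hankelLeft κ τ) 0 τ)
      (-(airyExt κ κ (hankelRight κ τ) 0 τ ^ 2)) τ := by
  refine (hasDerivAt_airyExt_of_hasDerivAt 0 κ 0 (hA.hasDerivAt_hankel hκ τ).1).congr_deriv ?_
  have h := hA.hankelSystem hκ τ
  have h1 := h.right_one_zero
  have h2 := h.hankelFun_left_one_zero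
  have h3 := kerPair_airyWt_add (hankelLeftOne κ τ) 0 τ 0
  rw [hankelLeftOne, hankelFun_congr _
    (coeFn_smul_kerL2_add_smul_hankel κ κ (hankelRight κ τ) 1 τ), ← hankelLeftOne, add_zero] at h3
  simp only [add_zero] at h1 h2
  rw [map_sub, map_smul, smul_eq_mul, h3, mul_sub, h2, zero_add, h1]
  have h4 : κ * kerPair (airyWt 0 τ) (hankelRight κ τ)
      = airyExt κ κ (hankelRight κ τ) 0 τ - κ * airyFn 0 1 τ := by
    rw [airyExt]
    ring
  linear_combination -airyExt κ κ (hankelRight κ τ) 0 τ * h4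

lemma IsAiry.hasDerivAt_airyExt_one (hA : IsAiry A A') (hκ : AvoidsRays κ) (τ : ℝ) :
    HasDerivAt (fun τ => airyExt κ κ (hankelRight κ τ) 1 τ)
      (airyExt κ κ (hankelRight κ τ) 2 τ
        - airyExt κ κ (hankelRight κ τ) 0 τ * airyExt 0 κ (hankelLeft κ τ) 1 τ) τ := by
  refine (hasDerivAt_airyExt_of_hasDerivAt κ κ 1 (hA.hasDerivAt_hankel hκ τ).2).congr_deriv ?_
  rw [map_neg, map_smul, smul_eq_mul, airyExt_zero_left]
  ring

lemma IsAiry.hasDerivAt_deriv_solution (hA : IsAiry A A') (hκ : AvoidsRays κ) (τ : ℝ) :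
    HasDerivAt (fun τ => airyExt κ κ (hankelRight κ τ) 1 τ
        - airyExt κ κ (hankelRight κ τ) 0 τ * airyExt 0 κ (hankelLeft κ τ) 0 τ)
      (τ * airyExt κ κ (hankelRight κ τ) 0 τ + 2 * airyExt κ κ (hankelRight κ τ) 0 τ ^ 3) τ := by
  refine ((hA.hasDerivAt_airyExt_one hκ τ).sub
    ((hA.hasDerivAt_solution hκ τ).mul (hA.hasDerivAt_airyExt_left hκ τ))).congr_deriv ?_
  have h := hA.hankelSystem hκ τ
  have h1 := h.right_one_zero
  have h2 := h.left_two_zero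
  simp only [add_zero] at h1 h2
  rw [h2, h1]
  ring

/-! ### Asymptotics at `+∞` -/

lemma IsAiry.abs_le (hA : IsAiry A A') (x : ℝ) : |A x| ≤ airyBound 0 * Real.exp (-x) := by
  rw [← Real.norm_eq_abs, ← Complex.norm_real, (hA.eq_airyFn one_pos x).1]
  exact norm_airyFn_one_le 0 x

lemma IsAiry.tendsto_zero (hA : IsAiry A A') : Tendsto (fun x => A x * A' x) atTop (nhds 0) := by
  have h := (expDecay_airyFn 0).tendsto.mul (expDecay_airyFn 1).tendsto
  rw [mul_zero] at h
  rw [tendsto_zero_iff_norm_tendsto_zero] at h ⊢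
  refine h.congr fun x => ?_
  rw [← (hA.eq_airyFn one_pos x).1, ← (hA.eq_airyFn one_pos x).2, ← Complex.ofReal_mul,
    Complex.norm_real]

lemma IsAiry.mul_nonpos (hA : IsAiry A A') {x : ℝ} (hx : 0 ≤ x) : A x * A' x ≤ 0 := by
  have hd : ∀ y, HasDerivAt (fun y => A y * A' y) (A' y * A' y + A y * (y * A y)) y :=
    fun y => (hA.1 y).mul (hA.2.1 y)
  have hmono : MonotoneOn (fun y => A y * A' y) (Set.Ici 0) := by
    refine monotoneOn_of_hasDerivWithinAt_nonneg (convex_Ici 0)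
      (fun y _ => (hd y).continuousAt.continuousWithinAt) (fun y _ => (hd y).hasDerivWithinAt)
      fun y hy => ?_
    rw [interior_Ici] at hy
    have hy : 0 < y := hy
    nlinarith [mul_nonneg hy.le (sq_nonneg (A y)), sq_nonneg (A' y)]
  refine ge_of_tendsto hA.tendsto_zero ?_
  filter_upwards [eventually_ge_atTop x] with y hy
  exact hmono hx (hx.trans hy) hy

lemma IsAiry.antitoneOn_sq (hA : IsAiry A A') : AntitoneOn (fun x => A x ^ 2) (Set.Ici 0) := by
  have hd : ∀ y, HasDerivAt (fun y => A y ^ 2) (2 * (A y * A' y)) y := fun y => by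
    refine ((hA.1 y).pow 2).congr_deriv ?_
    push_cast
    ring
  refine antitoneOn_of_hasDerivWithinAt_nonpos (convex_Ici 0)
    (fun y _ => (hd y).continuousAt.continuousWithinAt) (fun y _ => (hd y).hasDerivWithinAt)
    fun y hy => ?_
  linarith [hA.mul_nonpos (interior_subset hy)]

lemma IsAiry.ne_zero (hA : IsAiry A A') {x : ℝ} (hx : 0 ≤ x) : A x ≠ 0 := fun h => by
  have hz : ∀ y, x ≤ y → A y = 0 := fun y hy => by
    have := hA.antitoneOn_sq hx (hx.trans hy) hy
    simp only [h] at this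
    nlinarith
  have hev : A =ᶠ[nhds (x + 1)] fun _ => 0 := by
    filter_upwards [Ioi_mem_nhds (lt_add_one x)] with y hy
    exact hz y (le_of_lt hy)
  have h' : A' (x + 1) = 0 :=
    (hA.1 (x + 1)).unique ((hasDerivAt_const _ _).congr_of_eventuallyEq hev)
  have h0 := (airy_unique (f := fun x => (A x : ℂ)) (f' := fun x => (A' x : ℂ))
    (fun x => (hA.1 x).ofReal_comp)
    (fun x => by simpa using (hA.2.1 x).ofReal_comp) (x₀ := x + 1)
    (by simp [hz (x + 1) (by linarith)]) (by simp [h']) 0).1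
  have h1 : A 0 = 0 := by exact_mod_cast h0
  rw [hA.2.2.1] at h1
  have : 0 < (3 : ℝ) ^ (-(2 : ℝ) / 3) / Real.Gamma (2 / 3) :=
    div_pos (by positivity) (Real.Gamma_pos_of_pos (by norm_num))
  exact this.ne' h1

lemma IsAiry.sq_norm_kerL2_le (hA : IsAiry A A') {τ : ℝ} (hτ : 0 ≤ τ) :
    ‖kerL2 (airyWt 0 τ)‖ ^ 2 ≤ |A τ| * (airyBound 0 * Real.exp (-τ)) := by
  rw [← integral_norm_sq]
  have hInt : ∫ t, Real.exp (-t) ∂halfVol = 1 := by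
    simpa [halfVol] using integral_exp_neg_Ioi 0
  have hi : Integrable (fun t => Real.exp (-t)) halfVol :=
    integrableOn_exp_neg_Ioi 0
  rw [← mul_one (|A τ| * _), ← hInt, ← integral_const_mul]
  refine integral_mono_of_nonneg (Eventually.of_forall fun t => by positivity)
    (hi.const_mul _) ?_
  filter_upwards [coeFn_kerL2 (airyWt 0 τ), ae_restrict_mem measurableSet_Ioi] with t h1 ht
  have ht : 0 < t := ht
  rw [h1, expKer_airyWt, ← (hA.eq_airyFn one_pos _).1, Complex.norm_real, Real.norm_eq_abs, sq]
  have h2 : |A (τ + t)| ≤ |A τ| :=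
    sq_le_sq.1 (hA.antitoneOn_sq hτ (add_nonneg hτ ht.le) (by linarith))
  have h3 := hA.abs_le (τ + t)
  rw [neg_add, Real.exp_add, ← mul_assoc] at h3
  rw [mul_assoc]
  exact mul_le_mul h2 h3 (abs_nonneg _) (abs_nonneg _)

lemma IsAiry.norm_solution_sub_le (hA : IsAiry A A') (hκ : AvoidsRays κ) {τ : ℝ}
    (hsmall : ‖κ‖ * ‖hankel (airyWt 0 τ)‖ ≤ 1 / 2) :
    ‖airyExt κ κ (hankelRight κ τ) 0 τ - κ * A τ‖
      ≤ 2 * ‖κ‖ ^ 3 * ‖hankel (airyWt 0 τ)‖ * ‖kerL2 (airyWt 0 τ)‖ ^ 2 := by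
  set T := hankel (airyWt 0 τ)
  set a := kerL2 (airyWt 0 τ)
  set p := hankelLeft κ τ
  set q := hankelRight κ τ
  have hq : ‖q‖ ≤ ‖κ‖ * ‖T‖ * ‖p‖ := by
    rw [mul_assoc]
    exact (norm_smul κ _).trans_le (mul_le_mul_of_nonneg_left (T.le_opNorm p) (norm_nonneg κ))
  have hp : ‖p‖ ≤ ‖κ‖ * ‖a‖ + ‖κ‖ * ‖T‖ * ‖q‖ := by
    have h : p = κ • a + κ • T q := hA.hankelLeft_eq hκ τ
    rw [h, mul_assoc, ← norm_smul]
    refine (norm_add_le _ _).trans (add_le_add_right ?_ _)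
    rw [norm_smul]
    exact mul_le_mul_of_nonneg_left (T.le_opNorm q) (norm_nonneg κ)
  have hp' : ‖p‖ ≤ 2 * (‖κ‖ * ‖a‖) := by
    have h0 : 0 ≤ ‖κ‖ * ‖T‖ := by positivity
    nlinarith [norm_nonneg p, norm_nonneg q, mul_le_mul_of_nonneg_right hsmall (norm_nonneg q),
      mul_le_mul_of_nonneg_right hsmall (norm_nonneg p)]
  have hpair : ‖kerPair (airyWt 0 τ) q‖ ≤ ‖a‖ * ‖q‖ := by
    have := norm_integral_expKer_mul_le' (airyWt 0 τ) q
    rwa [hA.star_airyWt] at this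
  rw [airyExt, ← (hA.eq_airyFn one_pos τ).1, add_sub_cancel_left, norm_mul]
  calc ‖κ‖ * ‖kerPair (airyWt 0 τ) q‖
      ≤ ‖κ‖ * (‖a‖ * (‖κ‖ * ‖T‖ * (2 * (‖κ‖ * ‖a‖)))) := by
        gcongr
        refine hpair.trans ?_
        gcongr
        refine hq.trans ?_
        gcongr
    _ = _ := by ring

lemma IsAiry.tendsto_solution_div (hA : IsAiry A A') (hκ : AvoidsRays κ) :
    Tendsto (fun τ => airyExt κ κ (hankelRight κ τ) 0 τ / (A τ : ℂ)) atTop (nhds κ) := by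
  have hexp : Tendsto (fun τ => airyBound 0 * Real.exp (-τ)) atTop (nhds 0) := by
    simpa using Real.tendsto_exp_neg_atTop_nhds_zero.const_mul (airyBound 0)
  have hN : ∀ τ, ‖hankel (airyWt 0 τ)‖ ≤ airyBound 0 * Real.exp (-τ) := fun τ =>
    (norm_hankel_le _).trans (norm_airyWt_le 0 τ)
  rw [tendsto_iff_norm_sub_tendsto_zero]
  refine squeeze_zero' (Eventually.of_forall fun _ => norm_nonneg _) ?_
    (g := fun τ => 2 * ‖κ‖ ^ 3 * (airyBound 0 * Real.exp (-τ)) * (airyBound 0 * Real.exp (-τ))) ?_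
  · have hsm : ∀ᶠ τ in atTop, ‖κ‖ * (airyBound 0 * Real.exp (-τ)) < 1 / 2 := by
      have := hexp.const_mul ‖κ‖
      rw [mul_zero] at this
      exact this.eventually_lt_const (by norm_num)
    filter_upwards [hsm, eventually_ge_atTop 0] with τ hτ h0
    have hne : (A τ : ℂ) ≠ 0 := by exact_mod_cast hA.ne_zero h0
    have hpos : 0 < |A τ| := abs_pos.2 (hA.ne_zero h0)
    rw [div_sub' hne, norm_div, Complex.norm_real, Real.norm_eq_abs, div_le_iff₀ hpos,
      mul_comm (A τ : ℂ)]
    refine (hA.norm_solution_sub_le hκ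
      ((mul_le_mul_of_nonneg_left (hN τ) (norm_nonneg κ)).trans hτ.le)).trans ?_
    calc _ ≤ 2 * ‖κ‖ ^ 3 * (airyBound 0 * Real.exp (-τ))
          * (|A τ| * (airyBound 0 * Real.exp (-τ))) := by
          have := (norm_nonneg _).trans (hN τ)
          gcongr
          · exact hN τ
          · exact hA.sq_norm_kerL2_le h0
      _ = _ := by ring
  · simpa using (hexp.const_mul (2 * ‖κ‖ ^ 3)).mul hexp

end

/-- The Ablowitz–Segur solution `u(·; κ)` of Painlevé II with `u ∼ κ·Ai` at `+∞`
has no poles on the real line, for any `κ ∉ (-∞,-1] ∪ [1,+∞)`: there is a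
globally defined (twice differentiable on all of `ℝ`) solution. -/
theorem ablowitz_segur_no_real_poles
    (κ : ℂ) (hκ : ∀ x : ℝ, (x ≤ -1 ∨ 1 ≤ x) → κ ≠ (x : ℂ))
    (A A' : ℝ → ℝ) (hA : IsAiry A A') :
    ∃ u : ℝ → ℂ, IsAblowitzSegur A κ u := by
  have hd := funext fun τ => (hA.hasDerivAt_solution hκ τ).deriv
  refine ⟨fun τ => airyExt κ κ (hankelRight κ τ) 0 τ,
    fun τ => (hA.hasDerivAt_solution hκ τ).differentiableAt, ?_, ?_, hA.tendsto_solution_div hκ⟩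
  · rw [hd]
    exact fun τ => (hA.hasDerivAt_deriv_solution hκ τ).differentiableAt
  · rw [hd]
    exact fun τ => (hA.hasDerivAt_deriv_solution hκ τ).deriv
end
end

section
/- Fix an integer n ≥ 1 and β ∈ ℂ. The map μ ↦ H_n(μ, β) from ℝ to ℂ is differentiable. Moreover, if λ0 ∈ ℝ is such that H_{n−1}(λ0, β) ≠ 0 and H_n(λ0, β) ≠ 0, then the monic orthogonal polynomials p_{n−1} and p_n with respect to w(·; λ0, β) exist, h_{n−1} = ∫_ℝ p_{n−1}(x)² w(x; λ0, β) dx is nonzero, and the logarithmic derivative of the Hankel determinant satisfies (d/dμ H_n(μ, β))|_{μ=λ0} / H_n(λ0, β) = (2 i sin(πβ)/h_{n−1}) · ( p_n'(λ0)·p_{n−1}(λ0) − p_n(λ0)·p_{n−1}'(λ0) ) · e^{−λ0²}. -/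
open MeasureTheory Filter Polynomial

noncomputable section

/-- The discontinuous Gaussian weight `w(x; λ0, β)`. -/
def w (l : ℝ) (β : ℂ) (x : ℝ) : ℂ :=
  (Real.exp (-x ^ 2) : ℝ) *
    (if x < l then Complex.exp (Real.pi * Complex.I * β)
     else Complex.exp (-(Real.pi * Complex.I * β)))

/-- The Hankel determinant `H_n(λ0, β)` of the moments of `w(·; λ0, β)` (with `H_0 = 1`). -/
def H (n : ℕ) (l : ℝ) (β : ℂ) : ℂ :=
  Matrix.det (Matrix.of fun j k : Fin n =>
    ∫ x : ℝ, (x : ℂ) ^ ((j : ℕ) + (k : ℕ)) * w l β x)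

/-- The scaled jump location `λ0(n) = √(2n)·(1 + (t/2)·n^(-2/3))`. -/
def lam0 (t : ℝ) (n : ℕ) : ℝ :=
  Real.sqrt (2 * n) * (1 + t / 2 * (n : ℝ) ^ (-(2 : ℝ) / 3))

/-- `p` is the monic orthogonal polynomial of degree `n` for the weight `w(·; l, β)`. -/
def MonicOrthPoly (n : ℕ) (l : ℝ) (β : ℂ) (p : Polynomial ℂ) : Prop :=
  p.Monic ∧ p.natDegree = n ∧
  ∀ m : ℕ, m < n → ∫ x : ℝ, p.eval (x : ℂ) * (x : ℂ) ^ m * w l β x = 0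

section HankelForm

variable {K : Type*} [Field K]

/-- The Hankel matrix of the moments of a linear functional on polynomials. -/
def momentMatrix (L : K[X] →ₗ[K] K) (n : ℕ) : Matrix (Fin n) (Fin n) K :=
  Matrix.of fun j k => L (X ^ ((j : ℕ) + (k : ℕ)))

theorem sum_range_C_mul_X_pow_of_degree_lt {n : ℕ} {q : K[X]} (hq : q.degree < n) :
    ∑ i ∈ Finset.range n, C (q.coeff i) * X ^ i = q := by
  rcases eq_or_ne q 0 with rfl | h0
  · simp
  · exact (q.as_sum_range_C_mul_X_pow' ((natDegree_lt_iff_degree_lt h0).2 hq)).symm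

variable (L : K[X] →ₗ[K] K)

theorem momentMatrix_mulVec {n : ℕ} {q : K[X]} (hq : q.degree < n) (j : Fin n) :
    (momentMatrix L n).mulVec (fun i => q.coeff i) j = L (q * X ^ (j : ℕ)) := by
  conv_rhs => rw [← sum_range_C_mul_X_pow_of_degree_lt hq]
  simp only [Matrix.mulVec, dotProduct, momentMatrix, Matrix.of_apply]
  rw [Finset.sum_range, Finset.sum_mul, map_sum]
  refine Finset.sum_congr rfl fun i _ => ?_
  rw [mul_assoc, ← pow_add, C_mul', map_smul, smul_eq_mul, mul_comm, add_comm]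

theorem apply_mul_eq_zero_of_degree_lt {n : ℕ} {p q : K[X]}
    (hp : ∀ m < n, L (p * X ^ m) = 0) (hq : q.degree < n) : L (p * q) = 0 := by
  rw [← sum_range_C_mul_X_pow_of_degree_lt hq, Finset.mul_sum, map_sum]
  refine Finset.sum_eq_zero fun i hi => ?_
  rw [mul_left_comm, C_mul', map_smul, hp i (Finset.mem_range.1 hi), smul_zero]

theorem exists_monic_orthogonal {n : ℕ} (h : (momentMatrix L n).det ≠ 0) :
    ∃ p : K[X], p.Monic ∧ p.natDegree = n ∧ ∀ m < n, L (p * X ^ m) = 0 := by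
  set a := (momentMatrix L n)⁻¹.mulVec fun j => -L (X ^ n * X ^ (j : ℕ)) with ha
  have hu : IsUnit (momentMatrix L n).det := h.isUnit
  obtain ⟨q, hq⟩ := (degreeLTEquiv K n).surjective a
  have hdeg : (q : K[X]).degree < n := mem_degreeLT.1 q.2
  have hcoeff : (fun i : Fin n => (q : K[X]).coeff i) = a := by
    rw [← hq]; rfl
  refine ⟨X ^ n + (q : K[X]), monic_X_pow_add hdeg, natDegree_eq_of_degree_eq_some ?_, fun m hm => ?_⟩
  · rw [degree_add_eq_left_of_degree_lt (by rwa [degree_X_pow]), degree_X_pow]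
  · have := momentMatrix_mulVec L hdeg ⟨m, hm⟩
    rw [hcoeff, ha, Matrix.mulVec_mulVec, Matrix.mul_nonsing_inv _ hu, Matrix.one_mulVec] at this
    rw [add_mul, map_add, ← this, add_neg_cancel]

theorem degree_sub_X_pow_lt {n : ℕ} {p : K[X]} (hp : p.Monic) (hd : p.natDegree = n) :
    (p - X ^ n).degree < (n : WithBot ℕ) := by
  have : p.degree = n := by rw [degree_eq_natDegree hp.ne_zero, hd]
  rw [← this]
  exact degree_sub_lt_left (by rw [this, degree_X_pow]) hp.ne_zero (by rw [hp, leadingCoeff_X_pow])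

theorem apply_mul_monic {n : ℕ} {p q : K[X]} (hp : p.Monic) (hpd : p.natDegree = n)
    (ho : ∀ m < n, L (p * X ^ m) = 0) (hq : q.Monic) (hqd : q.natDegree = n) :
    L (p * q) = L (p ^ 2) := by
  have h : (q - p).degree < n := by
    rw [← sub_sub_sub_cancel_right q p (X ^ n)]
    exact (degree_sub_le _ _).trans_lt
      (max_lt (degree_sub_X_pow_lt hq hqd) (degree_sub_X_pow_lt hp hpd))
  have := apply_mul_eq_zero_of_degree_lt L ho h
  rwa [mul_sub, map_sub, sub_eq_zero, ← sq] at this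

theorem apply_sq_ne_zero {n : ℕ} {p : K[X]} (h : (momentMatrix L (n + 1)).det ≠ 0)
    (hp : p.Monic) (hpd : p.natDegree = n) (ho : ∀ m < n, L (p * X ^ m) = 0) :
    L (p ^ 2) ≠ 0 := by
  intro h0
  have hdeg : p.degree < (n + 1 : ℕ) := by
    rw [degree_eq_natDegree hp.ne_zero, hpd]; exact_mod_cast n.lt_succ_self
  have hz : (momentMatrix L (n + 1)).mulVec (fun i => p.coeff i) = 0 := by
    ext j
    rw [momentMatrix_mulVec L hdeg]
    rcases (Nat.lt_succ_iff.1 j.2).lt_or_eq with hj | hj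
    · exact ho _ hj
    · rw [hj, Pi.zero_apply, ← h0]
      exact apply_mul_monic L hp hpd ho (monic_X_pow n) (natDegree_X_pow n)
  have := congrFun (Matrix.eq_zero_of_mulVec_eq_zero h hz) (Fin.last n)
  simp only [Fin.val_last, Pi.zero_apply] at this
  rw [← hpd, hp.coeff_natDegree] at this
  exact one_ne_zero this

/-- The Christoffel–Darboux formula: the (confluent) kernel built from two consecutive monic
orthogonal polynomials reproduces evaluation at `x`, up to the norm. -/
theorem exists_christoffel_darboux {n : ℕ} {p q : K[X]} (x : K)
    (hp : p.Monic) (hpd : p.natDegree = n) (hpo : ∀ m < n, L (p * X ^ m) = 0)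
    (hq : q.Monic) (hqd : q.natDegree = n + 1) (hqo : ∀ m < n + 1, L (q * X ^ m) = 0) :
    ∃ k : K[X], k.degree < (n + 1 : ℕ) ∧
      k.eval x = q.derivative.eval x * p.eval x - q.eval x * p.derivative.eval x ∧
      ∀ r : K[X], r.degree < (n + 1 : ℕ) → L (k * r) = L (p ^ 2) * r.eval x := by
  have split (f : K[X]) : (X - C x) * (f /ₘ (X - C x)) + C (f.eval x) = f := by
    rw [X_sub_C_mul_divByMonic_eq_sub_modByMonic, modByMonic_X_sub_C_eq_C_eval, sub_add_cancel]
  have evalDeriv (f : K[X]) : (f /ₘ (X - C x)).eval x = f.derivative.eval x := by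
    conv_rhs => rw [← split f]
    simp
  have degLt {f : K[X]} {m : ℕ} (hf : f.degree < (m + 1 : ℕ)) : (f /ₘ (X - C x)).degree < m := by
    rcases eq_or_ne (f /ₘ (X - C x)) 0 with h0 | h0
    · rw [h0, degree_zero]; exact WithBot.bot_lt_coe m
    · have hf0 : f ≠ 0 := by rintro rfl; simp at h0
      have h1 := natDegree_divByMonic f (monic_X_sub_C x)
      rw [natDegree_X_sub_C] at h1
      have h2 := (natDegree_lt_iff_degree_lt hf0).2 hf
      refine (natDegree_lt_iff_degree_lt h0).1 ?_
      by_contra! h3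
      have hfd : f.natDegree = 0 := by omega
      refine h0 ((divByMonic_eq_zero_iff (monic_X_sub_C x)).2 ?_)
      rw [degree_X_sub_C, eq_C_of_natDegree_eq_zero hfd]
      exact degree_C_le.trans_lt zero_lt_one
  set s := q /ₘ (X - C x) with hs
  set t := p /ₘ (X - C x) with ht
  have hpdeg : p.degree < (n + 1 : ℕ) := by
    rw [degree_eq_natDegree hp.ne_zero, hpd]; exact_mod_cast n.lt_succ_self
  have hqdeg : q.degree < (n + 1 + 1 : ℕ) := by
    rw [degree_eq_natDegree hq.ne_zero, hqd]; exact_mod_cast (n + 1).lt_succ_self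
  have hsdeg : s.degree < (n + 1 : ℕ) := degLt hqdeg
  have htdeg : t.degree < n := degLt hpdeg
  have hsd : s.natDegree = n := by
    rw [hs, natDegree_divByMonic _ (monic_X_sub_C x), natDegree_X_sub_C, hqd, Nat.add_sub_cancel]
  have hsm : s.Monic := by
    refine (leadingCoeff_divByMonic_of_monic (monic_X_sub_C x) ?_).trans hq
    rw [degree_X_sub_C, degree_eq_natDegree hq.ne_zero, hqd]
    exact_mod_cast Nat.le_add_left 1 n
  have htdeg' : t.degree < (n + 1 : ℕ) := htdeg.trans (by exact_mod_cast n.lt_succ_self)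
  have Lsmul (c : K) (f : K[X]) : L (C c * f) = c * L f := by
    rw [C_mul', map_smul, smul_eq_mul]
  refine ⟨C (p.eval x) * s - C (q.eval x) * t, ?_, ?_, fun r hr => ?_⟩
  · refine (degree_sub_le _ _).trans_lt (max_lt ?_ ?_) <;> rw [C_mul']
    · exact (degree_smul_le _ _).trans_lt hsdeg
    · exact (degree_smul_le _ _).trans_lt htdeg'
  · simp only [eval_sub, eval_mul, eval_C, hs, ht, evalDeriv]
    ring
  · set u := r /ₘ (X - C x)
    have hudeg : u.degree < n := degLt hr
    have e1 : L (p * s) = L (p ^ 2) := apply_mul_monic L hp hpd hpo hsm hsd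
    have e2 : L (q * t) = 0 := apply_mul_eq_zero_of_degree_lt L hqo htdeg'
    have e3 : L (p * u) = 0 := apply_mul_eq_zero_of_degree_lt L hpo hudeg
    have e4 : L (q * u) = 0 := apply_mul_eq_zero_of_degree_lt L hqo
      (hudeg.trans (by exact_mod_cast n.lt_succ_self))
    have key : (C (p.eval x) * s - C (q.eval x) * t) * r =
        C (r.eval x) * (p * s - q * t) + C (p.eval x) * (q * u) - C (q.eval x) * (p * u) := by
      linear_combination (-(C (p.eval x) * s - C (q.eval x) * t)) * split r
        + (C (r.eval x) * s - C (q.eval x) * u) * split p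
        - (C (r.eval x) * t - C (p.eval x) * u) * split q
    rw [key, map_sub, map_add, Lsmul, Lsmul, Lsmul, map_sub, e1, e2, e3, e4]
    ring

theorem sum_pow_mul_cramer_momentMatrix {n : ℕ} {p q : K[X]} (x : K)
    (hp : p.Monic) (hpd : p.natDegree = n) (hpo : ∀ m < n, L (p * X ^ m) = 0)
    (hq : q.Monic) (hqd : q.natDegree = n + 1) (hqo : ∀ m < n + 1, L (q * X ^ m) = 0) :
    L (p ^ 2) * ∑ i : Fin (n + 1), x ^ (i : ℕ) *
        (momentMatrix L (n + 1)).cramer (fun j => x ^ (j : ℕ)) i =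
      (momentMatrix L (n + 1)).det *
        (q.derivative.eval x * p.eval x - q.eval x * p.derivative.eval x) := by
  obtain ⟨k, hk, hkx, hrep⟩ := exists_christoffel_darboux L x hp hpd hpo hq hqd hqo
  set M := momentMatrix L (n + 1)
  have hM : M.mulVec (fun i => k.coeff i) = L (p ^ 2) • fun j : Fin (n + 1) => x ^ (j : ℕ) := by
    ext j
    rw [momentMatrix_mulVec L hk, hrep _ ?_]
    · simp
    · rw [degree_X_pow]; exact_mod_cast j.2
  have hc : L (p ^ 2) • M.cramer (fun j => x ^ (j : ℕ)) = M.det • fun i : Fin (n + 1) => k.coeff i := by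
    rw [← map_smul, ← hM, Matrix.cramer_eq_adjugate_mulVec, Matrix.mulVec_mulVec,
      Matrix.adjugate_mul, Matrix.smul_mulVec, Matrix.one_mulVec]
  rw [← hkx, ← sum_range_C_mul_X_pow_of_degree_lt hk, eval_finsetSum,
    Finset.sum_range, Finset.mul_sum, Finset.mul_sum]
  refine Finset.sum_congr rfl fun i _ => ?_
  have := congrFun hc i
  simp only [Pi.smul_apply, smul_eq_mul] at this
  simp only [eval_mul, eval_C, eval_pow, eval_X]
  linear_combination x ^ (i : ℕ) * this

end HankelForm

theorem hasDerivAt_det {ι : Type*} [Fintype ι] [DecidableEq ι] {A : ℝ → Matrix ι ι ℂ}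
    {A' : Matrix ι ι ℂ} {t : ℝ} (h : ∀ i j, HasDerivAt (fun s => A s i j) (A' i j) t) :
    HasDerivAt (fun s => (A s).det) (∑ i, ((A t).updateRow i (A' i)).det) t := by
  let f : ContinuousMultilinearMap ℝ (fun _ : ι => ι → ℂ) ℂ :=
    { (Matrix.detRowAlternating (n := ι) (R := ℂ)).toMultilinearMap.restrictScalars ℝ with
      cont := Continuous.matrix_det continuous_id }
  have hrow (i : ι) :
      HasFDerivAt (fun s => A s i) (ContinuousLinearMap.toSpanSingleton ℝ (A' i)) t :=
    (hasDerivAt_pi.2 (h i)).hasFDerivAt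
  have := (HasFDerivAt.multilinear_comp (f := f) hrow).hasDerivAt
  convert! this using 1
  rw [sum_apply]
  refine Finset.sum_congr rfl fun i _ => ?_
  simp [ContinuousMultilinearMap.toContinuousLinearMap]
  rfl

theorem integrable_pow_mul_exp_neg_sq (k : ℕ) :
    Integrable fun x : ℝ => (x : ℂ) ^ k * (Real.exp (-x ^ 2) : ℝ) := by
  have h := (integrable_rpow_mul_exp_neg_mul_sq one_pos
    (s := (k : ℝ)) (by linarith [(Nat.cast_nonneg k : (0 : ℝ) ≤ k)])).ofReal (𝕜 := ℂ)
  refine h.congr (ae_of_all _ fun x => ?_)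
  simp

theorem pow_mul_w_eq (l : ℝ) (β : ℂ) (k : ℕ) (x : ℝ) :
    (x : ℂ) ^ k * w l β x =
      Complex.exp (-(Real.pi * Complex.I * β)) * ((x : ℂ) ^ k * (Real.exp (-x ^ 2) : ℝ)) +
      (2 * Complex.I * Complex.sin (Real.pi * β)) *
        (Set.Iio l).indicator (fun x : ℝ => (x : ℂ) ^ k * (Real.exp (-x ^ 2) : ℝ)) x := by
  have hs : 2 * Complex.I * Complex.sin (Real.pi * β) =
      Complex.exp (Real.pi * Complex.I * β) - Complex.exp (-(Real.pi * Complex.I * β)) := by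
    rw [Complex.sin, show (Real.pi : ℂ) * Complex.I * β = Real.pi * β * Complex.I by ring,
      ← neg_mul (Real.pi * β : ℂ)]
    linear_combination (Complex.exp (-(Real.pi * β) * Complex.I)
      - Complex.exp (Real.pi * β * Complex.I)) * Complex.I_mul_I
  rw [w, hs]
  by_cases hx : x < l
  · rw [Set.indicator_of_mem (show x ∈ Set.Iio l from hx), if_pos hx]; ring
  · rw [Set.indicator_of_notMem (show x ∉ Set.Iio l from hx), if_neg hx]; ring

theorem integrable_pow_mul_w (l : ℝ) (β : ℂ) (k : ℕ) :
    Integrable fun x : ℝ => (x : ℂ) ^ k * w l β x := by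
  simp_rw [pow_mul_w_eq]
  exact ((integrable_pow_mul_exp_neg_sq k).const_mul _).add
    (((integrable_pow_mul_exp_neg_sq k).indicator measurableSet_Iio).const_mul _)

theorem integrable_eval_mul_w (l : ℝ) (β : ℂ) (p : ℂ[X]) :
    Integrable fun x : ℝ => p.eval (x : ℂ) * w l β x := by
  simp_rw [eval_eq_sum_range, Finset.sum_mul, mul_assoc]
  exact integrable_finsetSum _ fun k _ => (integrable_pow_mul_w l β k).const_mul _

/-- Integration of polynomials against the weight `w(·; l, β)`. -/
def wFunctional (l : ℝ) (β : ℂ) : ℂ[X] →ₗ[ℂ] ℂ where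
  toFun p := ∫ x : ℝ, p.eval (x : ℂ) * w l β x
  map_add' p q := by
    simp_rw [eval_add, add_mul]
    exact integral_add (integrable_eval_mul_w l β p) (integrable_eval_mul_w l β q)
  map_smul' c p := by
    simp_rw [eval_smul, smul_eq_mul, mul_assoc, integral_const_mul, RingHom.id_apply]

theorem wFunctional_apply (l : ℝ) (β : ℂ) (p : ℂ[X]) :
    wFunctional l β p = ∫ x : ℝ, p.eval (x : ℂ) * w l β x := rfl

theorem momentMatrix_wFunctional (n : ℕ) (l : ℝ) (β : ℂ) :
    momentMatrix (wFunctional l β) n = Matrix.of fun j k : Fin n =>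
      ∫ x : ℝ, (x : ℂ) ^ ((j : ℕ) + (k : ℕ)) * w l β x := by
  ext j k
  simp [momentMatrix, wFunctional_apply]

theorem det_momentMatrix_wFunctional (n : ℕ) (l : ℝ) (β : ℂ) :
    (momentMatrix (wFunctional l β) n).det = H n l β := by
  rw [momentMatrix_wFunctional, H]

theorem monicOrthPoly_iff {n : ℕ} {l : ℝ} {β : ℂ} {p : ℂ[X]} :
    MonicOrthPoly n l β p ↔
      p.Monic ∧ p.natDegree = n ∧ ∀ m < n, wFunctional l β (p * X ^ m) = 0 := by
  simp [MonicOrthPoly, wFunctional_apply]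

theorem hasDerivAt_moment (l : ℝ) (β : ℂ) (k : ℕ) :
    HasDerivAt (fun μ : ℝ => ∫ x : ℝ, (x : ℂ) ^ k * w μ β x)
      (2 * Complex.I * Complex.sin (Real.pi * β) * ((l : ℂ) ^ k * (Real.exp (-l ^ 2) : ℝ))) l := by
  set g : ℝ → ℂ := fun x => (x : ℂ) ^ k * (Real.exp (-x ^ 2) : ℝ) with hg
  have hgi : Integrable g := integrable_pow_mul_exp_neg_sq k
  have hgc : Continuous g := by fun_prop
  have hsplit : (fun μ : ℝ => ∫ x : ℝ, (x : ℂ) ^ k * w μ β x) = fun μ : ℝ =>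
      Complex.exp (-(Real.pi * Complex.I * β)) * (∫ x, g x) +
      2 * Complex.I * Complex.sin (Real.pi * β) *
        ((∫ x in Set.Iic (0 : ℝ), g x) + ∫ x in (0 : ℝ)..μ, g x) := by
    ext μ
    simp_rw [pow_mul_w_eq]
    rw [integral_add (hgi.const_mul _) ((hgi.indicator measurableSet_Iio).const_mul _),
      integral_const_mul, integral_const_mul, integral_indicator measurableSet_Iio,
      ← integral_Iic_eq_integral_Iio,
      ← intervalIntegral.integral_Iic_sub_Iic hgi.integrableOn hgi.integrableOn, add_sub_cancel]
  rw [hsplit]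
  exact (((hgc.integral_hasStrictDerivAt 0 l).hasDerivAt.const_add _).const_mul _).const_add _

theorem hasDerivAt_H (n : ℕ) (l : ℝ) (β : ℂ) :
    HasDerivAt (fun μ : ℝ => H n μ β)
      (2 * Complex.I * Complex.sin (Real.pi * β) * (Real.exp (-l ^ 2) : ℝ) *
        ∑ i : Fin n, (l : ℂ) ^ (i : ℕ) *
          (momentMatrix (wFunctional l β) n).cramer (fun j => (l : ℂ) ^ (j : ℕ)) i) l := by
  set M := momentMatrix (wFunctional l β) n with hM
  set c := 2 * Complex.I * Complex.sin (Real.pi * β) * (Real.exp (-l ^ 2) : ℝ)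
  have hsymm : M.transpose = M := by
    ext i j
    simp [hM, momentMatrix, add_comm]
  have h := hasDerivAt_det (t := l)
    (A := fun μ => momentMatrix (wFunctional μ β) n)
    (A' := fun i j => (c * (l : ℂ) ^ (i : ℕ)) * (l : ℂ) ^ (j : ℕ)) fun i j => by
      simp only [momentMatrix_wFunctional, Matrix.of_apply]
      convert! hasDerivAt_moment l β (i + j) using 1
      rw [pow_add]; ring
  simp only [det_momentMatrix_wFunctional] at h
  convert! h using 1
  rw [Finset.mul_sum]
  refine Finset.sum_congr rfl fun i _ => ?_
  have hrow : (fun j : Fin n => c * (l : ℂ) ^ (i : ℕ) * (l : ℂ) ^ (j : ℕ)) =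
      (c * (l : ℂ) ^ (i : ℕ)) • fun j : Fin n => (l : ℂ) ^ (j : ℕ) := rfl
  rw [hrow, Matrix.det_updateRow_smul, ← Matrix.cramer_transpose_apply, hsymm, ← mul_assoc]

/-- Differentiability in the jump location and the differential identity for the
logarithmic derivative of the Hankel determinant. -/
theorem hankel_log_derivative
    (n : ℕ) (hn : 1 ≤ n) (β : ℂ) :
    Differentiable ℝ (fun μ : ℝ => H n μ β) ∧
    ∀ l : ℝ, H (n - 1) l β ≠ 0 → H n l β ≠ 0 →
      ∃ pm pn : Polynomial ℂ,
        MonicOrthPoly (n - 1) l β pm ∧ MonicOrthPoly n l β pn ∧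
        (∫ x : ℝ, (pm.eval (x : ℂ)) ^ 2 * w l β x) ≠ 0 ∧
        deriv (fun μ : ℝ => H n μ β) l / H n l β =
          (2 * Complex.I * Complex.sin (Real.pi * β) /
              (∫ x : ℝ, (pm.eval (x : ℂ)) ^ 2 * w l β x)) *
            (pn.derivative.eval (l : ℂ) * pm.eval (l : ℂ) -
              pn.eval (l : ℂ) * pm.derivative.eval (l : ℂ)) *
            (Real.exp (-l ^ 2) : ℂ) := by
  refine ⟨fun l => (hasDerivAt_H n l β).differentiableAt, fun l hm h => ?_⟩
  obtain ⟨n, rfl⟩ := Nat.exists_eq_add_of_le' hn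
  rw [Nat.add_sub_cancel] at hm ⊢
  rw [← det_momentMatrix_wFunctional] at hm h
  obtain ⟨p, hp, hpd, hpo⟩ := exists_monic_orthogonal _ hm
  obtain ⟨q, hq, hqd, hqo⟩ := exists_monic_orthogonal _ h
  have hnorm : ∫ x : ℝ, (p.eval (x : ℂ)) ^ 2 * w l β x = wFunctional l β (p ^ 2) := by
    simp [wFunctional_apply]
  have h0 := apply_sq_ne_zero _ h hp hpd hpo
  refine ⟨p, q, monicOrthPoly_iff.2 ⟨hp, hpd, hpo⟩, monicOrthPoly_iff.2 ⟨hq, hqd, hqo⟩,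
    hnorm ▸ h0, ?_⟩
  have key := sum_pow_mul_cramer_momentMatrix _ (l : ℂ) hp hpd hpo hq hqd hqo
  rw [(hasDerivAt_H (n + 1) l β).deriv, hnorm, ← det_momentMatrix_wFunctional]
  rw [div_mul_eq_mul_div, div_mul_eq_mul_div, div_eq_div_iff h h0]
  linear_combination 2 * Complex.I * Complex.sin (Real.pi * β) * (Real.exp (-l ^ 2) : ℝ) * key
end
end

section
/- For every integer n ≥ 1, the Hankel determinant of Gaussian moments satisfies det( ∫_ℝ x^{j+k} e^{−x²} dx )_{j,k=0}^{n−1} = (2π)^{n/2} · 2^{−n²/2} · ∏_{k=1}^{n−1} k!. -/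
open MeasureTheory Filter Polynomial

noncomputable section

/-- Every polynomial is integrable against the Gaussian weight. -/
theorem integrable_eval_mul_exp_neg_sq (p : ℝ[X]) :
    Integrable fun x : ℝ => p.eval x * Real.exp (-x ^ 2) := by
  induction p using Polynomial.induction_on' with
  | add p q hp hq =>
    simp only [eval_add, add_mul]
    exact hp.add hq
  | monomial n a =>
    have h := integrable_rpow_mul_exp_neg_mul_sq (b := 1) one_pos
      (s := (n : ℝ)) (by linarith [n.cast_nonneg (α := ℝ)])
    simp only [Real.rpow_natCast, neg_mul, one_mul] at h
    simpa only [eval_monomial, mul_assoc] using h.const_mul a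

/-- Integration of polynomials against the Gaussian weight `e^{-x²}`. -/
def gaussianFunctional : ℝ[X] →ₗ[ℝ] ℝ where
  toFun p := ∫ x : ℝ, p.eval x * Real.exp (-x ^ 2)
  map_add' p q := by
    simp only [eval_add, add_mul]
    exact integral_add (integrable_eval_mul_exp_neg_sq p) (integrable_eval_mul_exp_neg_sq q)
  map_smul' c p := by
    simp only [eval_smul, smul_eq_mul, mul_assoc, integral_const_mul, RingHom.id_apply]

theorem gaussianFunctional_apply (p : ℝ[X]) :
    gaussianFunctional p = ∫ x : ℝ, p.eval x * Real.exp (-x ^ 2) := rfl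

theorem gaussianFunctional_one : gaussianFunctional 1 = √Real.pi := by
  simpa [gaussianFunctional_apply] using integral_gaussian 1

/-- Integration by parts against the Gaussian weight. -/
theorem gaussianFunctional_X_mul (p : ℝ[X]) :
    gaussianFunctional (X * p) = 1 / 2 * gaussianFunctional (derivative p) := by
  have hderiv (x : ℝ) : HasDerivAt (fun x : ℝ => p.eval x * Real.exp (-x ^ 2))
      ((derivative p - (2 : ℝ) • (X * p)).eval x * Real.exp (-x ^ 2)) x := by
    refine ((p.hasDerivAt x).mul ((hasDerivAt_pow 2 x).neg.exp)).congr_deriv ?_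
    simp only [eval_sub, eval_smul, eval_mul, eval_X, smul_eq_mul, Pi.neg_apply]
    push_cast
    ring
  have h : gaussianFunctional (derivative p - (2 : ℝ) • (X * p)) = 0 :=
    integral_eq_zero_of_hasDerivAt_of_integrable hderiv
      (integrable_eval_mul_exp_neg_sq _) (integrable_eval_mul_exp_neg_sq p)
  rw [map_sub, map_smul, smul_eq_mul] at h
  linarith

/-- The monic orthogonal polynomials of the Gaussian weight `e^{-x²}`. -/
def monicHermite : ℕ → ℝ[X]
  | 0 => 1
  | m + 1 => X * monicHermite m - (1 / 2 : ℝ) • derivative (monicHermite m)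

theorem monicHermite_monic_and_natDegree (m : ℕ) :
    (monicHermite m).Monic ∧ (monicHermite m).natDegree = m := by
  induction m with
  | zero => simp [monicHermite]
  | succ m ih =>
    obtain ⟨hm, hd⟩ := ih
    have hXd : (X * monicHermite m).natDegree = m + 1 := by
      rw [monic_X.natDegree_mul hm, natDegree_X, hd, add_comm]
    have hXm : (X * monicHermite m).Monic := monic_X.mul hm
    have hlt : ((1 / 2 : ℝ) • derivative (monicHermite m)).degree <
        (X * monicHermite m).degree := by
      rw [degree_eq_natDegree hXm.ne_zero, hXd]
      refine ((degree_smul_le _ _).trans degree_le_natDegree).trans_lt ?_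
      have := natDegree_derivative_le (monicHermite m)
      exact_mod_cast (by omega : (derivative (monicHermite m)).natDegree < m + 1)
    refine ⟨hXm.sub_of_left hlt, ?_⟩
    rw [monicHermite, natDegree_eq_of_degree_eq (degree_sub_eq_left_of_degree_lt hlt), hXd]

theorem gaussianFunctional_monicHermite_mul (m : ℕ) (q : ℝ[X]) :
    gaussianFunctional (monicHermite m * q) =
      (1 / 2) ^ m * gaussianFunctional (derivative^[m] q) := by
  induction m generalizing q with
  | zero => simp [monicHermite]
  | succ m ih =>
    have h := gaussianFunctional_X_mul (monicHermite m * q)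
    rw [derivative_mul, map_add, ih (derivative q), ← mul_assoc] at h
    rw [monicHermite, sub_mul, smul_mul_assoc, map_sub, map_smul, smul_eq_mul, h,
      Function.iterate_succ_apply]
    ring

theorem gaussianFunctional_monicHermite_mul_X_pow_of_lt {j m : ℕ} (h : j < m) :
    gaussianFunctional (monicHermite m * X ^ j) = 0 := by
  rw [gaussianFunctional_monicHermite_mul,
    iterate_derivative_eq_zero (by rwa [natDegree_X_pow]), map_zero, mul_zero]

theorem gaussianFunctional_monicHermite_mul_X_pow_self (m : ℕ) :
    gaussianFunctional (monicHermite m * X ^ m) = (1 / 2) ^ m * √Real.pi * m.factorial := by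
  rw [gaussianFunctional_monicHermite_mul, iterate_derivative_X_pow_eq_smul,
    Nat.descFactorial_self, Nat.sub_self, pow_zero, map_smul, gaussianFunctional_one,
    smul_eq_mul]
  ring

theorem prod_range_half_pow_mul_sqrt_pi (n : ℕ) :
    ∏ k ∈ Finset.range n, ((1 / 2 : ℝ) ^ k * √Real.pi) =
      (2 * Real.pi) ^ ((n : ℝ) / 2) * (2 : ℝ) ^ (-((n : ℝ) ^ 2) / 2) := by
  induction n with
  | zero => simp
  | succ n ih =>
    have h : (1 / 2 : ℝ) ^ n = 2 ^ (-(n : ℝ)) := by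
      rw [Real.rpow_neg two_pos.le, Real.rpow_natCast, one_div, inv_pow]
    rw [Finset.prod_range_succ, ih, h, Real.sqrt_eq_rpow,
      Real.mul_rpow two_pos.le Real.pi_pos.le, Real.mul_rpow two_pos.le Real.pi_pos.le]
    have hpi : Real.pi ^ (((n + 1 : ℕ) : ℝ) / 2) =
        Real.pi ^ ((n : ℝ) / 2) * Real.pi ^ (1 / 2 : ℝ) := by
      rw [← Real.rpow_add Real.pi_pos]
      congr 1
      push_cast
      ring
    have htwo : (2 : ℝ) ^ (((n + 1 : ℕ) : ℝ) / 2) * 2 ^ (-(((n + 1 : ℕ) : ℝ) ^ 2) / 2) =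
        2 ^ ((n : ℝ) / 2) * 2 ^ (-((n : ℝ) ^ 2) / 2) * 2 ^ (-(n : ℝ)) := by
      simp only [← Real.rpow_add two_pos]
      congr 1
      push_cast
      ring
    rw [hpi, mul_right_comm (2 ^ (((n + 1 : ℕ) : ℝ) / 2)), htwo]
    ring

/-- The Hankel determinant of Gaussian moments:
`det(∫ x^{j+k} e^{-x²} dx) = (2π)^{n/2}·2^{-n²/2}·∏_{k=1}^{n-1} k!`. -/
theorem gaussian_hankel_det (n : ℕ) (hn : 1 ≤ n) :
    Matrix.det (Matrix.of fun j k : Fin n =>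
        ∫ x : ℝ, x ^ ((j : ℕ) + (k : ℕ)) * Real.exp (-x ^ 2)) =
      (2 * Real.pi) ^ ((n : ℝ) / 2) * (2 : ℝ) ^ (-((n : ℝ) ^ 2) / 2) *
        ∏ k ∈ Finset.range n, (Nat.factorial k : ℝ) := by
  set H : Matrix (Fin n) (Fin n) ℝ := Matrix.of fun j k : Fin n =>
    ∫ x : ℝ, x ^ ((j : ℕ) + (k : ℕ)) * Real.exp (-x ^ 2) with hH
  have hHapply (j k : Fin n) : H j k = gaussianFunctional (X ^ (j : ℕ) * X ^ (k : ℕ)) := by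
    simp [hH, gaussianFunctional_apply, pow_add]
  let B : Matrix (Fin n) (Fin n) ℝ :=
    Matrix.of fun i j : Fin n => (monicHermite j).coeff i
  have hB : B.det = 1 := Matrix.det_matrixOfPolynomials (fun j : Fin n => monicHermite j)
    (fun j => (monicHermite_monic_and_natDegree j).2)
    (fun j => (monicHermite_monic_and_natDegree j).1)
  have hBH (i k : Fin n) :
      (B.transpose * H) i k = gaussianFunctional (monicHermite i * X ^ (k : ℕ)) := by
    have hsum := (monicHermite i).as_sum_range' n
      ((monicHermite_monic_and_natDegree i).2.trans_lt i.isLt)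
    rw [hsum, Finset.sum_mul, map_sum, ← Fin.sum_univ_eq_sum_range
      (fun j => gaussianFunctional (monomial j ((monicHermite i).coeff j) * X ^ (k : ℕ))),
      Matrix.mul_apply]
    refine Finset.sum_congr rfl fun j _ => ?_
    rw [hHapply, ← smul_X_eq_monomial, smul_mul_assoc, map_smul]
    rfl
  have hdet : (B.transpose * H).det = H.det := by
    rw [Matrix.det_mul, Matrix.det_transpose, hB, one_mul]
  rw [← hdet, Matrix.det_of_isUpperTriangular fun i j hij => by
    rw [hBH]
    exact gaussianFunctional_monicHermite_mul_X_pow_of_lt hij]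
  simp only [hBH, gaussianFunctional_monicHermite_mul_X_pow_self]
  rw [Fin.prod_univ_eq_prod_range (fun k => (1 / 2 : ℝ) ^ k * √Real.pi * k.factorial),
    Finset.prod_mul_distrib, prod_range_half_pow_mul_sqrt_pi]
end
end

section
/- Fix an integer n ≥ 1 and λ0 ∈ ℝ. Let q_0, …, q_{n−1} be real polynomials with deg q_k = k for each k and ∫_ℝ q_j(x) q_k(x) e^{−x²} dx = δ_{jk} for 0 ≤ j, k ≤ n−1. Let Z_n = ∫_{ℝ^n} ∏_{1 ≤ i < j ≤ n}(x_i − x_j)² ∏_{k=1}^n e^{−x_k²} dx. Then for every s ∈ ℂ: Z_n^{−1} ∫_{ℝ^n} ∏_{1 ≤ i < j ≤ n}(x_i − x_j)² ∏_{k=1}^n ( e^{−x_k²} · (1 if x_k < λ0, s if x_k ≥ λ0) ) dx = det( δ_{jk} − (1 − s) ∫_{λ0}^∞ q_j(x) q_k(x) e^{−x²} dx )_{j,k=0}^{n−1}. (With s = 1 − κ², this is the identity expressing the generating function Σ_k (1−κ²)^k E_n(k, λ0) as the determinant det(1 − κ² K_n|_{[λ0,∞)}) of the finite-rank GUE correlation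 kernel.) -/
open MeasureTheory Filter Polynomial

noncomputable section

/-- **Andréief's identity**: the integral of a product of two determinants built from
families of functions is a factorial times the determinant of the matrix of pairings. -/
theorem integral_det_mul_det {ι X 𝕜 : Type*} [Fintype ι] [DecidableEq ι] [RCLike 𝕜]
    [MeasurableSpace X] (μ : Measure X) [SigmaFinite μ] (f g : ι → X → 𝕜)
    (hfg : ∀ j k, Integrable (fun x => f j x * g k x) μ) :
    ∫ x : ι → X, (Matrix.of fun i j => f j (x i)).det * (Matrix.of fun i j => g j (x i)).det
        ∂(Measure.pi fun _ => μ) =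
      (Fintype.card ι).factorial * (Matrix.of fun j k => ∫ x, f j x * g k x ∂μ).det := by
  have expand (x : ι → X) :
      (Matrix.of fun i j => f j (x i)).det * (Matrix.of fun i j => g j (x i)).det =
        ∑ σ : Equiv.Perm ι, ∑ τ : Equiv.Perm ι,
          ((Equiv.Perm.sign σ : ℤ) : 𝕜) * ((Equiv.Perm.sign τ : ℤ) : 𝕜) *
            ∏ i, f (σ i) (x i) * g (τ i) (x i) := by
    rw [← Matrix.det_transpose, ← Matrix.det_transpose (Matrix.of fun i j => g j (x i)),
      Matrix.det_apply', Matrix.det_apply', Finset.sum_mul_sum]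
    simp only [Matrix.transpose_apply, Matrix.of_apply, Finset.prod_mul_distrib]
    exact Finset.sum_congr rfl fun σ _ => Finset.sum_congr rfl fun τ _ => by ring
  have hint (σ τ : Equiv.Perm ι) : Integrable (fun x : ι → X =>
      ((Equiv.Perm.sign σ : ℤ) : 𝕜) * ((Equiv.Perm.sign τ : ℤ) : 𝕜) *
        ∏ i, f (σ i) (x i) * g (τ i) (x i)) (Measure.pi fun _ => μ) :=
    (Integrable.fintype_prod (f := fun i y => f (σ i) y * g (τ i) y)
      fun i => hfg (σ i) (τ i)).const_mul _
  simp_rw [expand]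
  rw [integral_finsetSum _ fun σ _ => integrable_finsetSum _ fun τ _ => hint σ τ]
  have inner (σ : Equiv.Perm ι) : ∫ x : ι → X, ∑ τ : Equiv.Perm ι,
      ((Equiv.Perm.sign σ : ℤ) : 𝕜) * ((Equiv.Perm.sign τ : ℤ) : 𝕜) *
        ∏ i, f (σ i) (x i) * g (τ i) (x i) ∂(Measure.pi fun _ => μ) =
      (Matrix.of fun j k => ∫ x, f j x * g k x ∂μ).det := by
    rw [integral_finsetSum _ fun τ _ => hint σ τ]
    simp_rw [integral_const_mul, mul_assoc, ← Finset.mul_sum]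
    have hdet : ∑ τ : Equiv.Perm ι, ((Equiv.Perm.sign τ : ℤ) : 𝕜) *
        ∫ x : ι → X, ∏ i, f (σ i) (x i) * g (τ i) (x i) ∂(Measure.pi fun _ => μ) =
        ((Matrix.of fun j k => ∫ x, f j x * g k x ∂μ).submatrix σ id).det := by
      rw [← Matrix.det_transpose, Matrix.det_apply']
      refine Finset.sum_congr rfl fun τ _ => ?_
      rw [integral_fintype_prod_eq_prod (fun i y => f (σ i) y * g (τ i) y)]
      rfl
    rw [hdet, Matrix.det_permute, ← mul_assoc, ← Int.cast_mul, ← Units.val_mul,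
      Int.units_mul_self, Units.val_one, Int.cast_one, one_mul]
  simp_rw [inner]
  rw [Finset.sum_const, Finset.card_univ, Fintype.card_perm, nsmul_eq_mul]

/-- Evaluating polynomials of degrees `0, …, n - 1` at `n` points gives a Vandermonde determinant
scaled by the product of the leading coefficients. -/
theorem det_eval_eq_prod_leadingCoeff_mul_det_vandermonde {R : Type*} [CommRing R] {n : ℕ}
    (p : Fin n → R[X]) (hdeg : ∀ k, (p k).natDegree = (k : ℕ)) (v : Fin n → R) :
    (Matrix.of fun i j => (p j).eval (v i)).det =
      (∏ k, (p k).leadingCoeff) * (Matrix.vandermonde v).det := by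
  have hle (k : Fin n) : (p k).natDegree ≤ k := (hdeg k).le
  rw [Matrix.eval_matrixOfPolynomials_eq_vandermonde_mul_matrixOfPolynomials v p hle,
    Matrix.det_mul,
    Matrix.det_of_isUpperTriangular (Matrix.matrixOfPolynomials_blockTriangular p hle), mul_comm]
  congr 1
  refine Finset.prod_congr rfl fun k _ => ?_
  rw [Matrix.of_apply, leadingCoeff, hdeg]

/-- The squared Vandermonde determinant as a product over ordered pairs of indices. -/
theorem det_vandermonde_sq {R : Type*} [CommRing R] {n : ℕ} (v : Fin n → R) :
    (Matrix.vandermonde v).det ^ 2 =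
      ∏ p ∈ Finset.univ.filter (fun p : Fin n × Fin n => p.1 < p.2), (v p.1 - v p.2) ^ 2 := by
  rw [Matrix.det_vandermonde, Finset.prod_filter, Fintype.prod_prod_type, ← Finset.prod_pow]
  refine Finset.prod_congr rfl fun i _ => ?_
  rw [← Finset.prod_pow, ← Finset.prod_filter, Finset.filter_lt_eq_Ioi]
  exact Finset.prod_congr rfl fun j _ => by ring

/-- The integral of the squared Vandermonde determinant against a product weight, expressed
through the Gram matrix of polynomials of degrees `0, …, n - 1`. -/
theorem prod_leadingCoeff_sq_mul_integral_vandermonde_sq {n : ℕ} (q : Fin n → ℝ[X])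
    (hdeg : ∀ k, (q k).natDegree = (k : ℕ)) (w : ℝ → ℂ)
    (hw : ∀ j k, Integrable fun x : ℝ => (((q j).eval x : ℝ) : ℂ) * ((((q k).eval x : ℝ) : ℂ) * w x)) :
    ((∏ k, (q k).leadingCoeff : ℝ) : ℂ) ^ 2 *
      ∫ x : Fin n → ℝ,
        ((∏ p ∈ Finset.univ.filter (fun p : Fin n × Fin n => p.1 < p.2),
          (x p.1 - x p.2) ^ 2 : ℝ) : ℂ) * ∏ k, w (x k) =
      n.factorial *
        (Matrix.of fun j k => ∫ x : ℝ,
          (((q j).eval x : ℝ) : ℂ) * ((((q k).eval x : ℝ) : ℂ) * w x)).det := by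
  have key := integral_det_mul_det volume (fun j x => (((q j).eval x : ℝ) : ℂ))
    (fun k x => (((q k).eval x : ℝ) : ℂ) * w x) hw
  rw [Fintype.card_fin] at key
  rw [← key, ← integral_const_mul]
  refine integral_congr_ae (Eventually.of_forall fun x => ?_)
  have hq : (Matrix.of fun i j => (((q j).eval (x i) : ℝ) : ℂ)).det =
      ((∏ k, (q k).leadingCoeff : ℝ) : ℂ) * ((Matrix.vandermonde x).det : ℝ) := by
    rw [← Complex.ofReal_mul, ← det_eval_eq_prod_leadingCoeff_mul_det_vandermonde q hdeg x]
    exact (Complex.ofRealHom.map_det _).symm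
  have hqw : (Matrix.of fun i j => (((q j).eval (x i) : ℝ) : ℂ) * w (x i)).det =
      (∏ k, w (x k)) * (Matrix.of fun i j => (((q j).eval (x i) : ℝ) : ℂ)).det := by
    rw [← Matrix.det_mul_column]
    simp [mul_comm]
  simp only [hq, hqw, ← det_vandermonde_sq]
  push_cast
  ring

/-- The GUE generating function equals the finite-rank Fredholm-type determinant
`det(δ_{jk} - (1-s)·∫_{λ0}^∞ q_j q_k e^{-x²})` built from orthonormal Hermite
polynomials. -/
theorem gue_generating_function_as_kernel_det
    (n : ℕ) (hn : 1 ≤ n) (l : ℝ) (q : Fin n → Polynomial ℝ)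
    (hdeg : ∀ k : Fin n, (q k).natDegree = (k : ℕ))
    (horth : ∀ j k : Fin n,
      (∫ x : ℝ, (q j).eval x * (q k).eval x * Real.exp (-x ^ 2)) =
        if j = k then 1 else 0) :
    ∀ s : ℂ,
      (∫ x : Fin n → ℝ,
          ((∏ p ∈ Finset.univ.filter (fun p : Fin n × Fin n => p.1 < p.2),
              (x p.1 - x p.2) ^ 2 : ℝ) : ℂ) *
            ∏ k : Fin n, ((Real.exp (-(x k) ^ 2) : ℝ) * (if x k < l then 1 else s))) /
        ((∫ x : Fin n → ℝ,
          (∏ p ∈ Finset.univ.filter (fun p : Fin n × Fin n => p.1 < p.2),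
            (x p.1 - x p.2) ^ 2) * ∏ k : Fin n, Real.exp (-(x k) ^ 2) : ℝ) : ℂ) =
      Matrix.det (Matrix.of fun j k : Fin n =>
        (if j = k then (1 : ℂ) else 0) -
          (1 - s) *
            ((∫ x in Set.Ici l, (q j).eval x * (q k).eval x * Real.exp (-x ^ 2) : ℝ) : ℂ)) := by
  intro s
  have hgauss (p : ℝ[X]) : Integrable fun x : ℝ => ((p.eval x * Real.exp (-x ^ 2) : ℝ) : ℂ) :=
    (integrable_eval_mul_exp_neg_sq p).ofReal
  have hdecomp (j k : Fin n) (t : ℂ) (x : ℝ) :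
      (((q j).eval x : ℝ) : ℂ) *
          ((((q k).eval x : ℝ) : ℂ) * ((Real.exp (-x ^ 2) : ℝ) * (if x < l then 1 else t))) =
        (((q j * q k).eval x * Real.exp (-x ^ 2) : ℝ) : ℂ) -
          (1 - t) * (Set.Ici l).indicator
            (fun y => (((q j * q k).eval y * Real.exp (-y ^ 2) : ℝ) : ℂ)) x := by
    by_cases hx : x < l
    · rw [Set.indicator_of_notMem (by simpa using hx), if_pos hx, eval_mul]
      push_cast
      ring
    · rw [Set.indicator_of_mem (by simpa using hx), if_neg hx, eval_mul]
      push_cast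
      ring
  have hind (j k : Fin n) (t : ℂ) : Integrable fun x : ℝ => (1 - t) * (Set.Ici l).indicator
      (fun y => (((q j * q k).eval y * Real.exp (-y ^ 2) : ℝ) : ℂ)) x :=
    ((hgauss (q j * q k)).indicator measurableSet_Ici).const_mul _
  have hgram (t : ℂ) := prod_leadingCoeff_sq_mul_integral_vandermonde_sq q hdeg
    (fun x => (Real.exp (-x ^ 2) : ℝ) * (if x < l then 1 else t)) fun j k => by
      simp_rw [hdecomp]
      exact (hgauss _).sub (hind j k t)
  have hentry (j k : Fin n) (t : ℂ) :
      ∫ x : ℝ, (((q j).eval x : ℝ) : ℂ) *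
          ((((q k).eval x : ℝ) : ℂ) * ((Real.exp (-x ^ 2) : ℝ) * (if x < l then 1 else t))) =
        (if j = k then (1 : ℂ) else 0) - (1 - t) *
          ((∫ x in Set.Ici l, (q j).eval x * (q k).eval x * Real.exp (-x ^ 2) : ℝ) : ℂ) := by
    simp_rw [hdecomp]
    rw [integral_sub (hgauss _) (hind j k t), integral_const_mul,
      integral_indicator measurableSet_Ici, integral_complex_ofReal, integral_complex_ofReal]
    simp only [eval_mul, horth]
    split_ifs <;> simp
  simp only [hentry] at hgram
  have hlead : ((∏ k, (q k).leadingCoeff : ℝ) : ℂ) ≠ 0 := by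
    rw [Complex.ofReal_ne_zero, Finset.prod_ne_zero_iff]
    intro k _ hk
    have hself := horth k k
    rw [leadingCoeff_eq_zero.mp hk] at hself
    simp at hself
  have hone : (Matrix.of fun j k : Fin n => if j = k then (1 : ℂ) else 0) = 1 := by
    ext j k
    rw [Matrix.of_apply, Matrix.one_apply]
  have hZ := hgram 1
  simp only [ite_self, mul_one, sub_self, zero_mul, sub_zero, hone, Matrix.det_one] at hZ
  rw [← integral_complex_ofReal]
  simp only [Complex.ofReal_mul _ (∏ k : Fin n, Real.exp _),
    Complex.ofReal_prod Finset.univ (fun k : Fin n => Real.exp _)]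
  have hZ0 := right_ne_zero_of_mul (hZ.trans_ne (Nat.cast_ne_zero.mpr n.factorial_ne_zero))
  rw [div_eq_iff hZ0]
  refine mul_left_cancel₀ (pow_ne_zero 2 hlead) ((hgram s).trans ?_)
  rw [mul_left_comm, hZ, mul_comm]
end
end

section
/- Fix an integer n ≥ 0, β ∈ ℂ and λ0 ∈ ℝ with H_n(λ0, β) ≠ 0, and let p_n be the monic orthogonal polynomial of degree n with respect to w(·; λ0, β). Then ∫_ℝ x · p_n(x)² · w(x; λ0, β) dx = − i sin(πβ) · e^{−λ0²} · p_n(λ0)². In particular, if h_n = ∫_ℝ p_n(x)² w(x; λ0, β) dx ≠ 0, the recurrence coefficient Q_n = h_n^{−1} ∫_ℝ x p_n(x)² w(x; λ0, β) dx satisfies Q_n = − h_n^{−1} · sinh(iπβ) · p_n(λ0)² · e^{−λ0²}. -/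
open MeasureTheory Filter Polynomial

noncomputable section

lemma integrable_polynomial_mul_exp_neg_sq (q : Polynomial ℂ) :
    Integrable fun x : ℝ => q.eval (x : ℂ) * (Real.exp (-x ^ 2) : ℂ) := by
  induction q using Polynomial.induction_on' with
  | add p q hp hq =>
    simp only [eval_add, add_mul]
    exact hp.add hq
  | monomial k a =>
    have hk : Integrable fun x : ℝ => x ^ k * Real.exp (-x ^ 2) := by
      simpa using integrable_rpow_mul_exp_neg_mul_sq one_pos
        (s := k) (by linarith [Nat.cast_nonneg (α := ℝ) k])
    convert (hk.ofReal (𝕜 := ℂ)).const_mul a using 2 with x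
    simp [mul_assoc]

lemma integrable_polynomial_mul_w (q : Polynomial ℂ) (l : ℝ) (β : ℂ) :
    Integrable fun x : ℝ => q.eval (x : ℂ) * w l β x := by
  have hq := integrable_polynomial_mul_exp_neg_sq q
  have hpw := Integrable.piecewise (measurableSet_Iio (a := l))
    (hq.mul_const (Complex.exp (Real.pi * Complex.I * β))).integrableOn
    (hq.mul_const (Complex.exp (-(Real.pi * Complex.I * β)))).integrableOn
  refine hpw.congr (.of_forall fun x => ?_)
  by_cases hx : x < l <;> simp [Set.piecewise, w, hx, mul_assoc]

lemma hasDerivAt_polynomial_mul_exp_neg_sq (q : Polynomial ℂ) (x : ℝ) :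
    HasDerivAt (fun x : ℝ => q.eval (x : ℂ) * (Real.exp (-x ^ 2) : ℂ))
      ((derivative q - 2 * X * q).eval (x : ℂ) * (Real.exp (-x ^ 2) : ℂ)) x := by
  have h1 : HasDerivAt (fun x : ℝ => q.eval (x : ℂ)) ((derivative q).eval (x : ℂ)) x :=
    (q.hasDerivAt (x : ℂ)).comp_ofReal
  have h2 : HasDerivAt (fun x : ℝ => Real.exp (-x ^ 2)) (Real.exp (-x ^ 2) * (-(2 * x))) x := by
    simpa using ((hasDerivAt_pow 2 x).neg).exp
  refine (h1.mul h2.ofReal_comp).congr_deriv ?_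
  simp
  ring

/-- Integration by parts against the discontinuous Gaussian weight. -/
lemma integral_derivative_sub_mul_w (q : Polynomial ℂ) (l : ℝ) (β : ℂ) :
    ∫ x : ℝ, (derivative q - 2 * X * q).eval (x : ℂ) * w l β x =
      2 * Complex.I * Complex.sin (Real.pi * β) * (Real.exp (-l ^ 2) : ℂ) * q.eval (l : ℂ) := by
  have hF := integrable_polynomial_mul_exp_neg_sq q
  have hG := integrable_polynomial_mul_exp_neg_sq (derivative q - 2 * X * q)
  have hd := hasDerivAt_polynomial_mul_exp_neg_sq q
  have hbot := integral_Iic_of_hasDerivAt_of_tendsto' (a := l) (fun x _ => hd x) hG.integrableOn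
    (tendsto_zero_of_hasDerivAt_of_integrableOn_Iic (a := l) (fun x _ => hd x)
      hG.integrableOn hF.integrableOn)
  have htop := integral_Ioi_of_hasDerivAt_of_tendsto' (a := l) (fun x _ => hd x) hG.integrableOn
    (tendsto_zero_of_hasDerivAt_of_integrableOn_Ioi (a := l) (fun x _ => hd x)
      hG.integrableOn hF.integrableOn)
  rw [integral_Iic_eq_integral_Iio] at hbot
  rw [← integral_Ici_eq_integral_Ioi] at htop
  have hw := integrable_polynomial_mul_w (derivative q - 2 * X * q) l β
  have hlt : ∫ x in Set.Iio l, (derivative q - 2 * X * q).eval (x : ℂ) * w l β x =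
      (q.eval (l : ℂ) * (Real.exp (-l ^ 2) : ℂ) - 0) *
        Complex.exp (Real.pi * Complex.I * β) := by
    rw [← hbot, ← integral_mul_const]
    refine setIntegral_congr_fun measurableSet_Iio fun x hx => ?_
    simp only [w, if_pos (Set.mem_Iio.mp hx), mul_assoc]
  have hge : ∫ x in Set.Ici l, (derivative q - 2 * X * q).eval (x : ℂ) * w l β x =
      (0 - q.eval (l : ℂ) * (Real.exp (-l ^ 2) : ℂ)) *
        Complex.exp (-(Real.pi * Complex.I * β)) := by
    rw [← htop, ← integral_mul_const]
    refine setIntegral_congr_fun measurableSet_Ici fun x hx => ?_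
    simp only [w, if_neg (not_lt.mpr (Set.mem_Ici.mp hx)), mul_assoc]
  rw [← integral_add_compl (measurableSet_Iio (a := l)) hw, Set.compl_Iio, hlt, hge, Complex.sin,
    show -(Real.pi * β : ℂ) * Complex.I = -(Real.pi * Complex.I * β) by ring,
    show (Real.pi * β : ℂ) * Complex.I = Real.pi * Complex.I * β by ring]
  linear_combination q.eval (l : ℂ) * (Real.exp (-l ^ 2) : ℂ) *
    (Complex.exp (Real.pi * Complex.I * β) - Complex.exp (-(Real.pi * Complex.I * β))) *
      Complex.I_sq

lemma MonicOrthPoly.integral_mul_eq_zero {n : ℕ} {l : ℝ} {β : ℂ} {p : Polynomial ℂ}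
    (hp : MonicOrthPoly n l β p) {r : Polynomial ℂ} (hr : r.degree < n) :
    ∫ x : ℝ, (p * r).eval (x : ℂ) * w l β x = 0 := by
  have hsum (x : ℝ) : (p * r).eval (x : ℂ) * w l β x =
      ∑ m ∈ Finset.range (r.natDegree + 1),
        r.coeff m * (p.eval (x : ℂ) * (x : ℂ) ^ m * w l β x) := by
    rw [eval_mul, eval_eq_sum_range (p := r), Finset.mul_sum, Finset.sum_mul]
    exact Finset.sum_congr rfl fun m _ => by ring
  simp only [hsum]
  rw [integral_finsetSum]
  · refine Finset.sum_eq_zero fun m _ => ?_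
    rw [integral_const_mul]
    by_cases hm : m < n
    · rw [hp.2.2 m hm, mul_zero]
    · rw [coeff_eq_zero_of_degree_lt (hr.trans_le (by exact_mod_cast not_lt.mp hm)), zero_mul]
  · intro m _
    refine Integrable.const_mul ?_ _
    exact (integrable_polynomial_mul_w (p * X ^ m) l β).congr (.of_forall fun x => by simp)

/-- The first moment identity for the monic orthogonal polynomials:
`∫ x·pₙ(x)²·w dx = -i·sin(πβ)·e^{-λ0²}·pₙ(λ0)²`, and the resulting formula for
the recurrence coefficient `Qₙ = hₙ⁻¹ ∫ x pₙ² w`. -/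
theorem first_moment_identity
    (n : ℕ) (β : ℂ) (l : ℝ) (hH : H n l β ≠ 0)
    (p : Polynomial ℂ) (hp : MonicOrthPoly n l β p) :
    (∫ x : ℝ, (x : ℂ) * (p.eval (x : ℂ)) ^ 2 * w l β x) =
      -Complex.I * Complex.sin (Real.pi * β) * (Real.exp (-l ^ 2) : ℂ) *
        (p.eval (l : ℂ)) ^ 2 ∧
    ((∫ x : ℝ, (p.eval (x : ℂ)) ^ 2 * w l β x) ≠ 0 →
      (∫ x : ℝ, (p.eval (x : ℂ)) ^ 2 * w l β x)⁻¹ *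
          (∫ x : ℝ, (x : ℂ) * (p.eval (x : ℂ)) ^ 2 * w l β x) =
        -(∫ x : ℝ, (p.eval (x : ℂ)) ^ 2 * w l β x)⁻¹ *
          Complex.sinh (Complex.I * Real.pi * β) * (p.eval (l : ℂ)) ^ 2 *
          (Real.exp (-l ^ 2) : ℂ)) := by
  have hp0 : p ≠ 0 := hp.1.ne_zero
  have horth := hp.integral_mul_eq_zero (r := derivative p) <| by
    simpa [degree_eq_natDegree hp0, hp.2.1] using degree_derivative_lt hp0
  have hparts := integral_derivative_sub_mul_w (p ^ 2) l β
  have hsplit (x : ℝ) : (derivative (p ^ 2) - 2 * X * p ^ 2).eval (x : ℂ) * w l β x =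
      2 * ((p * derivative p).eval (x : ℂ) * w l β x) -
        2 * ((x : ℂ) * (p.eval (x : ℂ)) ^ 2 * w l β x) := by
    simp [derivative_pow]
    ring
  have hint : Integrable fun x : ℝ => (x : ℂ) * (p.eval (x : ℂ)) ^ 2 * w l β x := by
    exact (integrable_polynomial_mul_w (X * p ^ 2) l β).congr (.of_forall fun x => by simp)
  simp only [hsplit] at hparts
  rw [integral_sub ((integrable_polynomial_mul_w _ l β).const_mul 2) (hint.const_mul 2),
    integral_const_mul, integral_const_mul, horth, eval_pow] at hparts
  have hmoment : (∫ x : ℝ, (x : ℂ) * (p.eval (x : ℂ)) ^ 2 * w l β x) =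
      -Complex.I * Complex.sin (Real.pi * β) * (Real.exp (-l ^ 2) : ℂ) *
        (p.eval (l : ℂ)) ^ 2 := by
    linear_combination (-1 / 2 : ℂ) * hparts
  refine ⟨hmoment, fun _ => ?_⟩
  rw [hmoment, show Complex.I * Real.pi * β = (Real.pi * β : ℂ) * Complex.I by ring,
    Complex.sinh_mul_I]
  ring
end
end

section
/- Let I ⊆ ℝ be open and let q : I → ℂ be twice differentiable with q''(t) = t·q(t) + 2·q(t)³ − 1/2 for all t ∈ I (the nonuniform Painlevé II equation). Define U(t) = q(t)² + q'(t) + t/2. Then U is twice differentiable on I and satisfies U'(t) = 2·q(t)·U(t) for all t ∈ I, and 2·U(t)·U''(t) = U'(t)² + 4·U(t)³ − 2·t·U(t)² for all t ∈ I; in particular, at every t with U(t) ≠ 0, U''(t) = U'(t)²/(2U(t)) + 2U(t)² − t·U(t), so that y(t) := 2^{−1/3}·U(−2^{1/3} t) solves the Painlevé XXXIV equation y'' = 4y² + 2ty + (y')²/(2y) wherever y ≠ 0. -/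
open MeasureTheory Filter Polynomial

noncomputable section

/-- If `q` solves the nonuniform Painlevé II `q'' = tq + 2q³ - 1/2` on an open set
`I`, then `U = q² + q' + t/2` satisfies `U' = 2qU` and `2UU'' = (U')² + 4U³ - 2tU²`;
hence `y(t) = 2^{-1/3}·U(-2^{1/3}·t)` solves Painlevé XXXIV wherever `y ≠ 0`. -/
theorem nonuniform_painleve_II_to_XXXIV
    (I : Set ℝ) (hI : IsOpen I) (q q' q'' : ℝ → ℂ)
    (hq : ∀ t ∈ I, HasDerivAt q (q' t) t)
    (hq' : ∀ t ∈ I, HasDerivAt q' (q'' t) t)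
    (hP2 : ∀ t ∈ I, q'' t = (t : ℂ) * q t + 2 * q t ^ 3 - 1 / 2)
    (U : ℝ → ℂ) (hU : U = fun t : ℝ => q t ^ 2 + q' t + (t : ℂ) / 2)
    (y : ℝ → ℂ)
    (hy : y = fun s : ℝ =>
      (((2 : ℝ) ^ (-(1 : ℝ) / 3) : ℝ) : ℂ) * U (-((2 : ℝ) ^ ((1 : ℝ) / 3)) * s)) :
    ∃ U' U'' : ℝ → ℂ,
      (∀ t ∈ I, HasDerivAt U (U' t) t) ∧
      (∀ t ∈ I, HasDerivAt U' (U'' t) t) ∧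
      (∀ t ∈ I, U' t = 2 * q t * U t) ∧
      (∀ t ∈ I, 2 * U t * U'' t = U' t ^ 2 + 4 * U t ^ 3 - 2 * (t : ℂ) * U t ^ 2) ∧
      (∀ t ∈ I, U t ≠ 0 →
        U'' t = U' t ^ 2 / (2 * U t) + 2 * U t ^ 2 - (t : ℂ) * U t) ∧
      (∃ y' y'' : ℝ → ℂ,
        ∀ t : ℝ, -((2 : ℝ) ^ ((1 : ℝ) / 3)) * t ∈ I →
          HasDerivAt y (y' t) t ∧ HasDerivAt y' (y'' t) t ∧
          (y t ≠ 0 →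
            y'' t = 4 * y t ^ 2 + 2 * (t : ℂ) * y t + y' t ^ 2 / (2 * y t))) := by
  have hUeq (t : ℝ) : U t = q t ^ 2 + q' t + (t : ℂ) / 2 := by rw [hU]
  have hUd : ∀ t ∈ I, HasDerivAt U (2 * q t * U t) t := by
    intro t ht
    have hid : HasDerivAt (fun s : ℝ => (s : ℂ) / 2) (1 / 2) t :=
      (HasDerivAt.ofReal_comp (hasDerivAt_id t)).div_const 2 |>.congr_deriv (by simp)
    rw [hUeq, hU]
    refine ((((hq t ht).pow 2).add (hq' t ht)).add hid).congr_deriv ?_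
    rw [hP2 t ht]
    push_cast
    ring
  have hUd' : ∀ t ∈ I, HasDerivAt (fun s => 2 * q s * U s)
      (2 * q' t * U t + 2 * q t * (2 * q t * U t)) t := fun t ht =>
    ((hq t ht).const_mul 2).mul (hUd t ht)
  refine ⟨fun t => 2 * q t * U t, fun t => 2 * q' t * U t + 2 * q t * (2 * q t * U t),
    hUd, hUd', fun _ _ => rfl, ?_, ?_, ?_⟩
  · intro t _
    linear_combination (-4 * U t ^ 2) * hUeq t
  · intro t _ h0
    field_simp
    linear_combination (-2) * hUeq t
  · have hinv : (2 : ℝ) ^ (-(1 : ℝ) / 3) = ((2 : ℝ) ^ ((1 : ℝ) / 3))⁻¹ := by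
      rw [neg_div, Real.rpow_neg zero_le_two]
    have hcube : ((2 : ℝ) ^ ((1 : ℝ) / 3)) ^ 3 = 2 := by
      rw [← Real.rpow_natCast, ← Real.rpow_mul zero_le_two]
      norm_num
    have hpos : (0 : ℝ) < (2 : ℝ) ^ ((1 : ℝ) / 3) := by positivity
    rw [hinv] at hy
    generalize (2 : ℝ) ^ ((1 : ℝ) / 3) = c at *
    have hc : (c : ℂ) ≠ 0 := by exact_mod_cast hpos.ne'
    have hc3 : (c : ℂ) ^ 3 = 2 := by exact_mod_cast hcube
    have hscale (t : ℝ) : HasDerivAt (fun s : ℝ => -c * s) (-c) t := by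
      simpa using (hasDerivAt_id t).const_mul (-c)
    refine ⟨fun t => -(2 * q (-c * t) * U (-c * t)),
      fun t => c * (2 * q' (-c * t) * U (-c * t)
        + 2 * q (-c * t) * (2 * q (-c * t) * U (-c * t))), fun t ht => ⟨?_, ?_, ?_⟩⟩
    · rw [hy]
      refine (((hUd _ ht).scomp t (hscale t)).const_mul ((c⁻¹ : ℝ) : ℂ)).congr_deriv ?_
      rw [Complex.real_smul]
      push_cast
      field_simp
    · refine ((hUd' _ ht).scomp t (hscale t)).neg.congr_deriv ?_
      rw [Complex.real_smul]
      push_cast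
      ring
    · intro hy0
      have hUy : U (-c * t) = c * y t := by
        rw [hy]
        push_cast
        field_simp
      have hqy := hUeq (-c * t)
      rw [hUy] at hqy
      push_cast at hqy
      simp only [hUy]
      generalize q (-c * t) = a at *
      generalize q' (-c * t) = b at *
      field_simp
      linear_combination (-2 * (c : ℂ) ^ 2) * hqy + (2 * y t + t) * hc3
end
end

section
/- Let f : ℝ → ℝ be twice differentiable with f''(x) = x·f(x) for all x ∈ ℝ (the Airy equation). Assume that x²·f(x)² → 0, x·f'(x)² → 0 and f(x)·f'(x) → 0 as x → +∞, and that for every t ∈ ℝ the function τ ↦ (τ − t)·f(τ)² is integrable on [t, ∞). Then for every t ∈ ℝ: ∫_t^∞ (τ − t)·f(τ)² dτ = (1/3)·( 2·t²·f(t)² − f(t)·f'(t) − 2·t·f'(t)² ). (Applied to f = Ai, this evaluates the limiting mean number of GUE eigenvalues to the right of the scaled point.) -/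
open MeasureTheory Filter Polynomial

noncomputable section

/-- If `x * g x` tends to zero at infinity, then so does `g x`. -/
theorem tendsto_zero_of_tendsto_self_mul {g : ℝ → ℝ}
    (h : Tendsto (fun x : ℝ => x * g x) atTop (nhds 0)) : Tendsto g atTop (nhds 0) := by
  have hmul := tendsto_inv_atTop_zero.mul h
  rw [zero_mul] at hmul
  refine hmul.congr' ?_
  filter_upwards [eventually_gt_atTop (0 : ℝ)] with x hx
  rw [inv_mul_cancel_left₀ hx.ne']

/-- An antiderivative of `(x - t) * f x ^ 2` for a solution `f` of the Airy equation. -/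
theorem airy_hasDerivAt_primitive {f f' : ℝ → ℝ} {x : ℝ} (t : ℝ)
    (hf : HasDerivAt f (f' x) x) (hf' : HasDerivAt f' (x * f x) x) :
    HasDerivAt (fun y : ℝ => (1 / 3) * (y ^ 2 * f y ^ 2 - y * f' y ^ 2 + f y * f' y)
      - t * (y * f y ^ 2 - f' y ^ 2)) ((x - t) * f x ^ 2) x := by
  have hx := hasDerivAt_id' x
  refine ((((((hx.fun_pow 2).fun_mul (hf.fun_pow 2)).fun_sub (hx.fun_mul (hf'.fun_pow 2))).fun_add
    (hf.fun_mul hf')).const_mul (1 / 3)).fun_sub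
    (((hx.fun_mul (hf.fun_pow 2)).fun_sub (hf'.fun_pow 2)).const_mul t)).congr_deriv ?_
  norm_num
  ring

/-- Total integral of `(τ-t)·f(τ)²` for a decaying solution of the Airy equation:
`∫_t^∞ (τ-t)f(τ)² dτ = (1/3)(2t²f(t)² - f(t)f'(t) - 2t f'(t)²)`. -/
theorem airy_total_integral
    (f f' : ℝ → ℝ)
    (hf : ∀ x : ℝ, HasDerivAt f (f' x) x)
    (hf' : ∀ x : ℝ, HasDerivAt f' (x * f x) x)
    (hlim1 : Tendsto (fun x : ℝ => x ^ 2 * f x ^ 2) atTop (nhds 0))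
    (hlim2 : Tendsto (fun x : ℝ => x * f' x ^ 2) atTop (nhds 0))
    (hlim3 : Tendsto (fun x : ℝ => f x * f' x) atTop (nhds 0))
    (hint : ∀ t : ℝ, IntegrableOn (fun τ : ℝ => (τ - t) * f τ ^ 2) (Set.Ici t)) :
    ∀ t : ℝ,
      (∫ τ in Set.Ici t, (τ - t) * f τ ^ 2) =
        (1 / 3) * (2 * t ^ 2 * f t ^ 2 - f t * f' t - 2 * t * f' t ^ 2) := by
  intro t
  have hff : Tendsto (fun x : ℝ => x * f x ^ 2) atTop (nhds 0) :=
    tendsto_zero_of_tendsto_self_mul (hlim1.congr fun x => by ring)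
  have hff' : Tendsto (fun x : ℝ => f' x ^ 2) atTop (nhds 0) :=
    tendsto_zero_of_tendsto_self_mul hlim2
  have hlim := (((hlim1.sub hlim2).add hlim3).const_mul (1 / 3)).sub
    ((hff.sub hff').const_mul t)
  rw [integral_Ici_eq_integral_Ioi,
    integral_Ioi_of_hasDerivAt_of_tendsto'
      (fun x _ => airy_hasDerivAt_primitive t (hf x) (hf' x))
      ((hint t).mono_set Set.Ioi_subset_Ici_self) hlim]
  ring
end
end

section
/- For every x ∈ ℝ with −1 < x < 1: (2/π) · ∫_{−1}^{1} log|x − s| · √(1 − s²) ds = x² − 1/2 − log 2. (This is the equilibrium condition g₊(x) + g₋(x) = 2x² + l with l = −1 − 2·log 2 for the semicircle density ψ(s) = (2/π)√(1 − s²) on [−1,1].) -/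
open MeasureTheory Filter Polynomial

noncomputable section

open Real in
lemma integral_log_sin_mul_cos_four_mul :
    ∫ v in (0 : ℝ)..π, log (sin v) * cos (4 * v) = -(π / 4) := by
  have hint : IntervalIntegrable (fun v ↦ log (sin v) * cos (4 * v)) volume 0 π :=
    intervalIntegrable_log_sin.mul_continuousOn (by fun_prop)
  have key := intervalIntegral.integral_eq_sub_of_hasDerivAt_of_le
    (f := fun v ↦ sin v * log (sin v) * (cos v * cos (2 * v))
      - (sin (2 * v) / 4 + v / 4 + sin (4 * v) / 16)) pi_pos.le ?_ ?_ hint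
  · rw [key]
    have h4 : sin (4 * π) = 0 := by exact_mod_cast sin_nat_mul_pi 4
    simp [h4]
  · have h : Continuous fun v ↦ sin v * log (sin v) := continuous_mul_log.comp continuous_sin
    exact ((h.mul (by fun_prop)).sub (by fun_prop)).continuousOn
  · intro v hv
    have hs : sin v ≠ 0 := (sin_pos_of_pos_of_lt_pi hv.1 hv.2).ne'
    have hlin (c : ℝ) : HasDerivAt (fun v : ℝ ↦ c * v) c v := by
      simpa using (hasDerivAt_id v).const_mul c
    have h := (((hasDerivAt_sin v).mul ((hasDerivAt_sin v).log hs)).mul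
      ((hasDerivAt_cos v).mul (hlin 2).cos)).sub
      ((((hlin 2).sin.div_const 4).add ((hasDerivAt_id v).div_const 4)).add
        ((hlin 4).sin.div_const 16))
    refine h.congr_deriv ?_
    have e4 : (4 : ℝ) * v = 2 * (2 * v) := by ring
    simp only [Pi.mul_apply]
    rw [e4, cos_two_mul (2 * v), sin_two_mul v, cos_two_mul v]
    have hs2 : sin v ^ 2 = 1 - cos v ^ 2 := sin_sq v
    have hcot : sin v * (cos v / sin v) = cos v := by field_simp
    rw [hcot]
    linear_combination (-(log (sin v)) * (6 * cos v ^ 2 - 1)) * hs2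

open Real in
lemma integral_log_sin_mul_sin_four_mul :
    ∫ v in (0 : ℝ)..π, log (sin v) * sin (4 * v) = 0 := by
  have h := intervalIntegral.integral_comp_sub_left (a := 0) (b := π)
    (fun v ↦ log (sin v) * sin (4 * v)) π
  have e (v : ℝ) : sin (4 * (π - v)) = -sin (4 * v) := by
    have := sin_nat_mul_two_pi_sub (4 * v) 2
    rw [← this]; congr 1; push_cast; ring
  simp only [sin_pi_sub, e, sub_self, sub_zero, mul_neg, intervalIntegral.integral_neg] at h
  linarith

open Real in
lemma integral_log_sin_mul_sin_sq (θ : ℝ) :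
    ∫ v in ((θ - π) / 2)..((θ + π) / 2), log (sin v) * sin (2 * v - θ) ^ 2 =
      -(π / 2) * log 2 + π / 8 * cos (2 * θ) := by
  have hper : Function.Periodic (fun v ↦ log (sin v) * sin (2 * v - θ) ^ 2) π := by
    intro v
    have : 2 * (v + π) - θ = 2 * v - θ + 2 * π := by ring
    simp only [this, sin_add_two_pi, sin_add_pi, log_neg_eq_log]
  have h := hper.intervalIntegral_add_eq ((θ - π) / 2) 0
  rw [show (θ - π) / 2 + π = (θ + π) / 2 by ring, zero_add] at h
  rw [h]
  have e (v : ℝ) : log (sin v) * sin (2 * v - θ) ^ 2 = 1 / 2 * log (sin v)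
      - (cos (2 * θ) / 2 * (log (sin v) * cos (4 * v))
        + sin (2 * θ) / 2 * (log (sin v) * sin (4 * v))) := by
    have := cos_sub (4 * v) (2 * θ)
    rw [sin_sq_eq_half_sub, show 2 * (2 * v - θ) = 4 * v - 2 * θ by ring, this]
    ring
  have hlog : IntervalIntegrable (fun v ↦ log (sin v)) volume 0 π := intervalIntegrable_log_sin
  have hcos : IntervalIntegrable (fun v ↦ log (sin v) * cos (4 * v)) volume 0 π :=
    hlog.mul_continuousOn (by fun_prop)
  have hsin : IntervalIntegrable (fun v ↦ log (sin v) * sin (4 * v)) volume 0 π :=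
    hlog.mul_continuousOn (by fun_prop)
  simp only [e]
  rw [intervalIntegral.integral_sub (hlog.const_mul _)
      ((hcos.const_mul _).add (hsin.const_mul _)),
    intervalIntegral.integral_add (hcos.const_mul _) (hsin.const_mul _)]
  simp only [intervalIntegral.integral_const_mul]
  rw [integral_log_sin_mul_cos_four_mul, integral_log_sin_mul_sin_four_mul,
    integral_log_sin_zero_pi]
  ring

open Real in
lemma integral_mul_sqrt_one_sub_sq (f : ℝ → ℝ) :
    ∫ s in (-1 : ℝ)..1, f s * √(1 - s ^ 2) = ∫ t in (0 : ℝ)..π, f (cos t) * sin t ^ 2 := by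
  have h := integral_image_eq_integral_abs_deriv_smul (s := Set.Icc 0 π) measurableSet_Icc
    (fun t _ ↦ (hasDerivAt_cos t).hasDerivWithinAt) injOn_cos (fun s ↦ f s * √(1 - s ^ 2))
  rw [bijOn_cos.image_eq] at h
  rw [intervalIntegral.integral_of_le (by norm_num), intervalIntegral.integral_of_le pi_pos.le,
    ← integral_Icc_eq_integral_Ioc, ← integral_Icc_eq_integral_Ioc, h]
  refine setIntegral_congr_fun measurableSet_Icc fun t ht ↦ ?_
  have hs := sin_nonneg_of_mem_Icc ht
  simp only [abs_neg, abs_of_nonneg hs, smul_eq_mul, ← sin_sq, sqrt_sq hs]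
  ring

open Real in
lemma intervalIntegrable_log_sin_add_div_two_mul_sin_sq (θ a b : ℝ) :
    IntervalIntegrable (fun t ↦ log (sin ((t + θ) / 2)) * sin t ^ 2) volume a b := by
  refine IntervalIntegrable.mul_continuousOn ?_ (by fun_prop)
  refine MeromorphicOn.intervalIntegrable_log (f := fun t ↦ sin ((t + θ) / 2)) fun t _ ↦ ?_
  exact AnalyticAt.meromorphicAt (by fun_prop)

open Real in
lemma integral_log_cos_sub_cos_mul_sin_sq (θ : ℝ) (hθ : θ ∈ Set.Icc 0 π) :
    ∫ t in (0 : ℝ)..π, log (cos θ - cos t) * sin t ^ 2 =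
      -(π / 2) * log 2 + π / 4 * cos (2 * θ) := by
  have hsplit : ∫ t in (0 : ℝ)..π, log (cos θ - cos t) * sin t ^ 2 =
      ∫ t in (0 : ℝ)..π, (log 2 * sin t ^ 2 + (log (sin ((t + θ) / 2)) * sin t ^ 2
        + log (sin ((t + -θ) / 2)) * sin t ^ 2)) := by
    refine intervalIntegral.integral_congr_ae ?_
    filter_upwards [compl_mem_ae_iff.mpr (measure_singleton θ)] with t ht hmem
    rw [Set.uIoc_of_le pi_pos.le] at hmem
    have hprod : cos θ - cos t = 2 * (sin ((t + θ) / 2) * sin ((t + -θ) / 2)) := by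
      rw [cos_sub_cos, show (t + -θ) / 2 = -((θ - t) / 2) by ring, sin_neg, add_comm t θ]
      ring
    have hne : cos θ - cos t ≠ 0 := fun h ↦
      ht (injOn_cos ⟨hmem.1.le, hmem.2⟩ hθ (sub_eq_zero.mp h).symm)
    rw [hprod] at hne ⊢
    have h2 := right_ne_zero_of_mul hne
    rw [log_mul two_ne_zero h2, log_mul (left_ne_zero_of_mul h2) (right_ne_zero_of_mul h2)]
    ring
  have hplus : ∫ t in (0 : ℝ)..π, log (sin ((t + θ) / 2)) * sin t ^ 2 =
      2 * ∫ v in (θ / 2)..((θ + π) / 2), log (sin v) * sin (2 * v - θ) ^ 2 := by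
    have h := intervalIntegral.integral_comp_div_add (a := 0) (b := π)
      (fun v ↦ log (sin v) * sin (2 * v - θ) ^ 2) two_ne_zero (θ / 2)
    rw [smul_eq_mul, show (0 : ℝ) / 2 + θ / 2 = θ / 2 by ring,
      show π / 2 + θ / 2 = (θ + π) / 2 by ring] at h
    rw [← h]
    congr! 5 with t
    · ring
    · ring_nf
  have hminus : ∫ t in (0 : ℝ)..π, log (sin ((t + -θ) / 2)) * sin t ^ 2 =
      2 * ∫ v in ((θ - π) / 2)..(θ / 2), log (sin v) * sin (2 * v - θ) ^ 2 := by
    have h := intervalIntegral.integral_comp_sub_div (a := 0) (b := π)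
      (fun v ↦ log (sin v) * sin (2 * v - θ) ^ 2) two_ne_zero (θ / 2)
    rw [smul_eq_mul, show θ / 2 - (0 : ℝ) / 2 = θ / 2 by ring,
      show θ / 2 - π / 2 = (θ - π) / 2 by ring] at h
    rw [← h]
    refine intervalIntegral.integral_congr fun t _ ↦ ?_
    rw [show θ / 2 - t / 2 = -((t + -θ) / 2) by ring, sin_neg, log_neg_eq_log,
      show 2 * -((t + -θ) / 2) - θ = -t by ring, sin_neg, neg_sq]
  have hint (a b : ℝ) :
      IntervalIntegrable (fun v ↦ log (sin v) * sin (2 * v - θ) ^ 2) volume a b :=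
    IntervalIntegrable.mul_continuousOn intervalIntegrable_log_sin (by fun_prop)
  have hadd := intervalIntegral.integral_add_adjacent_intervals
    (hint ((θ - π) / 2) (θ / 2)) (hint (θ / 2) ((θ + π) / 2))
  rw [integral_log_sin_mul_sin_sq] at hadd
  rw [hsplit, intervalIntegral.integral_add (Continuous.intervalIntegrable (by fun_prop) _ _)
      ((intervalIntegrable_log_sin_add_div_two_mul_sin_sq θ _ _).add
        (intervalIntegrable_log_sin_add_div_two_mul_sin_sq (-θ) _ _)),
    intervalIntegral.integral_add (intervalIntegrable_log_sin_add_div_two_mul_sin_sq θ _ _)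
      (intervalIntegrable_log_sin_add_div_two_mul_sin_sq (-θ) _ _),
    hplus, hminus, intervalIntegral.integral_const_mul, integral_sin_sq]
  simp only [sin_zero, sin_pi, zero_mul, sub_zero, zero_add]
  linear_combination 2 * hadd

/-- The equilibrium condition for the semicircle density inside the support:
`(2/π)∫_{-1}^1 log|x-s|·√(1-s²) ds = x² - 1/2 - log 2` for `-1 < x < 1`. -/
theorem semicircle_equilibrium_equality
    (x : ℝ) (hx1 : -1 < x) (hx2 : x < 1) :
    (2 / Real.pi) * ∫ s in (-1 : ℝ)..1, Real.log |x - s| * Real.sqrt (1 - s ^ 2) =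
      x ^ 2 - 1 / 2 - Real.log 2 := by
  have hcos : Real.cos (Real.arccos x) = x := Real.cos_arccos hx1.le hx2.le
  have h := integral_log_cos_sub_cos_mul_sin_sq (Real.arccos x)
    ⟨Real.arccos_nonneg x, Real.arccos_le_pi x⟩
  rw [Real.cos_two_mul, hcos] at h
  simp only [Real.log_abs]
  rw [integral_mul_sqrt_one_sub_sq fun s ↦ Real.log (x - s), h]
  have hpi := Real.pi_ne_zero
  field_simp
  ring
end
end

section
/- For every x ∈ ℝ with |x| > 1: (2/π) · ∫_{−1}^{1} log|x − s| · √(1 − s²) ds < x² − 1/2 − log 2. (This is the strict variational inequality g₊(x) + g₋(x) < 2x² + l with l = −1 − 2·log 2 outside the support [−1,1] of the equilibrium measure.) -/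
open MeasureTheory Filter Polynomial

noncomputable section

lemma integral_cos_int_mul {k : ℤ} (hk : k ≠ 0) :
    ∫ θ in (0 : ℝ)..Real.pi, Real.cos (k * θ) = 0 := by
  have hk' : (k : ℝ) ≠ 0 := by exact_mod_cast hk
  rw [intervalIntegral.integral_comp_mul_left (fun θ => Real.cos θ) hk', integral_cos]
  simp [Real.sin_int_mul_pi]

lemma integral_cos_nat_mul_mul_sin_sq {n : ℕ} (h0 : n ≠ 0) (h2 : n ≠ 2) :
    ∫ θ in (0 : ℝ)..Real.pi, Real.cos (n * θ) * Real.sin θ ^ 2 = 0 := by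
  have h : ∀ θ : ℝ, Real.cos (n * θ) * Real.sin θ ^ 2 =
      (1 / 2) * Real.cos ((n : ℤ) * θ) - (1 / 4) * Real.cos (((n : ℤ) + 2 : ℤ) * θ)
        - (1 / 4) * Real.cos (((n : ℤ) - 2 : ℤ) * θ) := by
    intro θ
    push_cast
    rw [add_mul, sub_mul, Real.cos_add, Real.cos_sub, Real.sin_sq_eq_half_sub]
    ring
  have hc : ∀ (c : ℝ) (k : ℤ), IntervalIntegrable (fun θ : ℝ => c * Real.cos (k * θ))
      volume 0 Real.pi := fun c k => Continuous.intervalIntegrable (by fun_prop) _ _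
  simp_rw [h]
  rw [intervalIntegral.integral_sub ((hc _ _).sub (hc _ _)) (hc _ _),
    intervalIntegral.integral_sub (hc _ _) (hc _ _)]
  simp only [intervalIntegral.integral_const_mul]
  rw [integral_cos_int_mul (by omega), integral_cos_int_mul (by omega),
    integral_cos_int_mul (by omega)]
  norm_num

lemma integral_sin_sq_zero_pi : ∫ θ in (0 : ℝ)..Real.pi, Real.sin θ ^ 2 = Real.pi / 2 := by
  simp [integral_sin_sq]

lemma integral_cos_two_mul_mul_sin_sq :
    ∫ θ in (0 : ℝ)..Real.pi, Real.cos (2 * θ) * Real.sin θ ^ 2 = -(Real.pi / 4) := by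
  have h : ∀ θ : ℝ, Real.cos (2 * θ) * Real.sin θ ^ 2 =
      (1 / 2) * Real.cos ((2 : ℤ) * θ) - (1 / 4) * Real.cos ((4 : ℤ) * θ) - 1 / 4 := by
    intro θ
    have h4 : Real.cos ((4 : ℤ) * θ) = 2 * Real.cos (2 * θ) ^ 2 - 1 := by
      rw [← Real.cos_two_mul]; push_cast; ring_nf
    rw [h4, Real.sin_sq_eq_half_sub]
    push_cast
    ring
  have hc : ∀ (c : ℝ) (k : ℤ), IntervalIntegrable (fun θ : ℝ => c * Real.cos (k * θ))
      volume 0 Real.pi := fun c k => Continuous.intervalIntegrable (by fun_prop) _ _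
  simp_rw [h]
  rw [intervalIntegral.integral_sub ((hc _ _).sub (hc _ _)) (by simp),
    intervalIntegral.integral_sub (hc _ _) (hc _ _)]
  simp only [intervalIntegral.integral_const_mul]
  rw [integral_cos_int_mul (by omega), integral_cos_int_mul (by omega)]
  simp
  ring

lemma hasSum_pow_mul_cos_div {r : ℝ} (h0 : 0 ≤ r) (h1 : r < 1) (θ : ℝ) :
    HasSum (fun n : ℕ => r ^ n * Real.cos (n * θ) / n)
      (-(Real.log (1 - 2 * r * Real.cos θ + r ^ 2) / 2)) := by
  set z : ℂ := r * Complex.exp (θ * Complex.I) with hz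
  have hnorm : ‖z‖ < 1 := by
    rw [hz, norm_mul, Complex.norm_exp_ofReal_mul_I, Complex.norm_real, Real.norm_of_nonneg h0]
    simpa
  convert Complex.hasSum_re (Complex.hasSum_taylorSeries_neg_log hnorm) using 1
  · ext n
    have : z ^ n = (r ^ n : ℝ) * Complex.exp ((n * θ : ℝ) * Complex.I) := by
      rw [hz, mul_pow, ← Complex.exp_nat_mul]
      push_cast
      ring_nf
    rw [this, Complex.div_natCast_re, Complex.re_ofReal_mul, Complex.exp_ofReal_mul_I_re]
  · rw [Complex.neg_re, Complex.log_re, ← Real.log_sqrt]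
    · congr 2
      rw [Complex.norm_def, Complex.normSq_apply]
      congr 1
      simp only [hz, Complex.sub_re, Complex.sub_im, Complex.one_re, Complex.one_im,
        Complex.re_ofReal_mul, Complex.im_ofReal_mul, Complex.exp_ofReal_mul_I_re,
        Complex.exp_ofReal_mul_I_im]
      linear_combination -r ^ 2 * Real.sin_sq_add_cos_sq θ
    · nlinarith [sq_nonneg (1 - r * Real.cos θ), Real.sin_sq_add_cos_sq θ,
        sq_nonneg (r * Real.sin θ)]

lemma integral_log_mul_sin_sq {r : ℝ} (h0 : 0 ≤ r) (h1 : r < 1) :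
    ∫ θ in (0 : ℝ)..Real.pi, Real.log (1 - 2 * r * Real.cos θ + r ^ 2) * Real.sin θ ^ 2 =
      Real.pi * r ^ 2 / 4 := by
  have key : HasSum
      (fun n : ℕ => ∫ θ in (0 : ℝ)..Real.pi, r ^ n * Real.cos (n * θ) / n * Real.sin θ ^ 2)
      (∫ θ in (0 : ℝ)..Real.pi,
        -(Real.log (1 - 2 * r * Real.cos θ + r ^ 2) / 2) * Real.sin θ ^ 2) := by
    refine intervalIntegral.hasSum_integral_of_dominated_convergence (fun n _ => r ^ n)
      (fun n => Continuous.aestronglyMeasurable (by fun_prop)) (fun n => ?_)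
      (ae_of_all _ fun _ _ => summable_geometric_of_lt_one h0 h1) (by simp)
      (ae_of_all _ fun θ _ => (hasSum_pow_mul_cos_div h0 h1 θ).mul_right _)
    refine ae_of_all _ fun θ _ => ?_
    have hn : |(n : ℝ)|⁻¹ ≤ 1 := by
      rw [Nat.abs_cast]; exact Nat.cast_inv_le_one n
    have hs : |Real.sin θ| ^ 2 ≤ 1 := by
      rw [sq_abs]; exact Real.sin_sq_le_one θ
    rw [Real.norm_eq_abs, abs_mul, abs_div, abs_mul, abs_pow, abs_pow, abs_of_nonneg h0,
      div_eq_mul_inv]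
    calc r ^ n * |Real.cos (n * θ)| * |(n : ℝ)|⁻¹ * |Real.sin θ| ^ 2
        ≤ r ^ n * 1 * 1 * 1 := by
          gcongr
          exact Real.abs_cos_le_one _
      _ = r ^ n := by ring
  have hterm : ∀ n : ℕ,
      ∫ θ in (0 : ℝ)..Real.pi, r ^ n * Real.cos (n * θ) / n * Real.sin θ ^ 2 =
        r ^ n / n * ∫ θ in (0 : ℝ)..Real.pi, Real.cos (n * θ) * Real.sin θ ^ 2 := by
    intro n
    rw [← intervalIntegral.integral_const_mul]
    congr 1
    ext θ
    ring
  simp_rw [hterm] at key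
  have hsingle := hasSum_single (f := fun n : ℕ => r ^ n / n *
      ∫ θ in (0 : ℝ)..Real.pi, Real.cos (n * θ) * Real.sin θ ^ 2) 2 (by
    intro n hn
    rcases eq_or_ne n 0 with rfl | h
    · simp
    · simp only [integral_cos_nat_mul_mul_sin_sq h hn, mul_zero])
  have heq := key.unique hsingle
  have hl : ∫ θ in (0 : ℝ)..Real.pi,
        -(Real.log (1 - 2 * r * Real.cos θ + r ^ 2) / 2) * Real.sin θ ^ 2 =
      -(1 / 2) * ∫ θ in (0 : ℝ)..Real.pi,
        Real.log (1 - 2 * r * Real.cos θ + r ^ 2) * Real.sin θ ^ 2 := by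
    rw [← intervalIntegral.integral_const_mul]
    congr 1
    ext θ
    ring
  rw [hl] at heq
  push_cast at heq
  rw [integral_cos_two_mul_mul_sin_sq] at heq
  linarith

lemma integral_comp_cos_mul_sin {g : ℝ → ℝ} (hg : ContinuousOn g (Set.Icc (-1) 1)) :
    ∫ s in (-1 : ℝ)..1, g s = ∫ θ in (0 : ℝ)..Real.pi, g (Real.cos θ) * Real.sin θ := by
  have h := intervalIntegral.integral_comp_mul_deriv'' (a := 0) (b := Real.pi)
    (f := Real.cos) (f' := fun θ => -Real.sin θ) (g := g) (by fun_prop)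
    (fun θ _ => (Real.hasDerivAt_cos θ).hasDerivWithinAt) (by fun_prop)
    (hg.mono (by rintro _ ⟨θ, -, rfl⟩; exact Real.cos_mem_Icc θ))
  rw [Real.cos_zero, Real.cos_pi, intervalIntegral.integral_symm (-1 : ℝ) 1] at h
  simp only [Function.comp_apply, mul_neg, intervalIntegral.integral_neg] at h
  linarith

/-- The logarithmic potential of the semicircle density at `cosh t`. -/
lemma integral_log_cosh_sub_mul_sqrt {t : ℝ} (ht : 0 < t) :
    ∫ s in (-1 : ℝ)..1, Real.log |Real.cosh t - s| * Real.sqrt (1 - s ^ 2) =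
      Real.pi / 2 * (t - Real.log 2 + Real.exp (-(2 * t)) / 2) := by
  have hcosh : 1 < Real.cosh t := Real.one_lt_cosh.2 ht.ne'
  have hr1 : Real.exp (-t) < 1 := by simpa using ht
  rw [integral_comp_cos_mul_sin]
  · have hpt : ∀ θ ∈ Set.uIcc 0 Real.pi,
        Real.log |Real.cosh t - Real.cos θ| * Real.sqrt (1 - Real.cos θ ^ 2) * Real.sin θ =
        (t - Real.log 2) * Real.sin θ ^ 2 +
          Real.log (1 - 2 * Real.exp (-t) * Real.cos θ + Real.exp (-t) ^ 2)
            * Real.sin θ ^ 2 := by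
      intro θ hθ
      rw [Set.uIcc_of_le Real.pi_pos.le] at hθ
      have hpos : 0 < Real.cosh t - Real.cos θ := by linarith [Real.cos_le_one θ]
      have hfac : 1 - 2 * Real.exp (-t) * Real.cos θ + Real.exp (-t) ^ 2 =
          2 * Real.exp (-t) * (Real.cosh t - Real.cos θ) := by
        have : Real.exp t * Real.exp (-t) = 1 := by rw [← Real.exp_add]; simp
        rw [Real.cosh_eq]
        linear_combination -this
      rw [hfac, Real.log_mul (by positivity) hpos.ne', Real.log_mul (by norm_num) (by positivity),
        Real.log_exp, Real.log_abs, ← Real.abs_sin_eq_sqrt_one_sub_cos_sq,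
        abs_of_nonneg (Real.sin_nonneg_of_mem_Icc hθ)]
      ring
    rw [intervalIntegral.integral_congr hpt, intervalIntegral.integral_add,
      intervalIntegral.integral_const_mul, integral_sin_sq_zero_pi,
      integral_log_mul_sin_sq (Real.exp_pos _).le hr1, ← Real.exp_nat_mul]
    · push_cast
      rw [show 2 * -t = -(2 * t) by ring]
      ring
    · exact Continuous.intervalIntegrable (by fun_prop) _ _
    · refine Continuous.intervalIntegrable (Continuous.mul (Continuous.log (by fun_prop) ?_)
        (by fun_prop)) _ _
      intro θ
      nlinarith [Real.cos_le_one θ, Real.exp_pos (-t), sq_pos_of_pos (sub_pos.2 hr1)]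
  · refine ContinuousOn.mul (ContinuousOn.log (by fun_prop) ?_) (by fun_prop)
    intro s hs
    exact abs_ne_zero.2 (by linarith [hs.2])

/-- The strict variational inequality for the semicircle density outside the support:
`(2/π)∫_{-1}^1 log|x-s|·√(1-s²) ds < x² - 1/2 - log 2` for `|x| > 1`. -/
theorem semicircle_variational_inequality
    (x : ℝ) (hx : 1 < |x|) :
    (2 / Real.pi) * ∫ s in (-1 : ℝ)..1, Real.log |x - s| * Real.sqrt (1 - s ^ 2) <
      x ^ 2 - 1 / 2 - Real.log 2 := by
  have habs : ∫ s in (-1 : ℝ)..1, Real.log |x - s| * Real.sqrt (1 - s ^ 2) =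
      ∫ s in (-1 : ℝ)..1, Real.log |(|x|) - s| * Real.sqrt (1 - s ^ 2) := by
    rcases abs_choice x with h | h
    · rw [h]
    · rw [h, ← neg_neg (1 : ℝ), ← intervalIntegral.integral_comp_neg, neg_neg]
      congr 1
      ext s
      rw [← abs_neg (x - -s), neg_sq]
      ring_nf
  have ht : 0 < Real.arcosh |x| := Real.arcosh_pos hx
  have hc : Real.cosh (Real.arcosh |x|) = |x| := Real.cosh_arcosh hx.le
  rw [habs, ← sq_abs x, ← hc]
  generalize Real.arcosh |x| = t at ht
  rw [integral_log_cosh_sub_mul_sqrt ht]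
  have hsinh := Real.self_lt_sinh_iff.2 (show 0 < 2 * t by linarith)
  have hexp := Real.cosh_sub_sinh (2 * t)
  have hcosh := Real.cosh_two_mul t
  have hsq := Real.cosh_sq t
  have hpi : 2 / Real.pi * (Real.pi / 2 * (t - Real.log 2 + Real.exp (-(2 * t)) / 2)) =
      t - Real.log 2 + Real.exp (-(2 * t)) / 2 := by
    field_simp
  rw [hpi]
  linarith
end
end
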